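/- Fix a positive integer q. Assume GRH holds for the Dirichlet L-functions L(s,χ) and L(s,χχ₋₄) for every Dirichlet character χ modulo q. Let a, b be residues with a ≡ b ≡ 1 (mod gcd(4,q)), gcd(a,q) = gcd(b,q) = 1, and suppose C_{q,a,b} := Σ_{χ mod q, χ² = χ₀} (χ(a) − χ(b)) · (1 − χ(2)/√2)^{−1/2} · √(L(1/2,χ)L(1/2,χχ₋₄)) > 0, where χ₀ is the principal character mod q and the non-negative square root is taken. Then #{n ≤ x : S(n;q,a) > S(n;q,b)} = x(1 + o(1)) as x → ∞. -/

import Mathlib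

open Complex Filter
open scoped Classical

noncomputable section

/-- `n` is a sum of two squares. -/
def IsSum2Sq (n : ℕ) : Prop := ∃ a b : ℕ, n = a ^ 2 + b ^ 2

/-- The Dirichlet L-function `L(s,χ)` (junk value `0` if the modulus is `0`). -/
noncomputable def LVal {N : ℕ} (χ : DirichletCharacter ℂ N) (s : ℂ) : ℂ :=
  if h : N = 0 then 0 else
    haveI : NeZero N := ⟨h⟩
    DirichletCharacter.LFunction χ s

/-- GRH for `L(s,χ)`: all zeros with `0 < Re s < 1` have real part `1/2`. -/
def GRH {N : ℕ} (χ : DirichletCharacter ℂ N) : Prop :=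
  ∀ s : ℂ, 0 < s.re → s.re < 1 → LVal χ s = 0 → s.re = 1 / 2

/-- The unique non-principal Dirichlet character modulo 4. -/
noncomputable def chiNeg4 : DirichletCharacter ℂ 4 := ZMod.χ₄.ringHomComp (Int.castRingHom ℂ)

/-- The product `χ ⋅ χ₋₄`, as a Dirichlet character modulo `4q`. -/
noncomputable def mulChiNeg4 {q : ℕ} (χ : DirichletCharacter ℂ q) : DirichletCharacter ℂ (4 * q) :=
  DirichletCharacter.changeLevel (dvd_mul_left q 4) χ *
    DirichletCharacter.changeLevel (dvd_mul_right 4 q) chiNeg4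

/-- `S(x;q,a)`, the number of sums of two squares `n ≤ x` with `n ≡ a (mod q)`. -/
noncomputable def Scount (q a : ℕ) (x : ℝ) : ℕ :=
  ((Finset.Icc 1 ⌊x⌋₊).filter (fun m => IsSum2Sq m ∧ (m : ZMod q) = (a : ZMod q))).card

/-- The sequence `n ↦ 1_S(n) χ(n)`. -/
noncomputable def STwist {q : ℕ} (χ : DirichletCharacter ℂ q) (n : ℕ) : ℂ :=
  if IsSum2Sq n then χ (n : ZMod q) else 0

/-- `∑_{n ≤ x, n ∈ S} χ(n)`. -/
noncomputable def SSum {q : ℕ} (χ : DirichletCharacter ℂ q) (x : ℝ) : ℂ :=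
  ∑ n ∈ Finset.Icc 1 ⌊x⌋₊, STwist χ n

/-- A set of positive integers has natural density one. -/
def HasDensityOne (P : ℕ → Prop) : Prop :=
  Tendsto (fun n : ℕ => (((Finset.Icc 1 n).filter P).card : ℝ) / n) atTop (nhds 1)

/-- The integral of `f` over the truncated Hankel contour around `ρ`, with horizontal extent
`c` and radius `r`; the two horizontal segments are taken as boundary values from below
(lower segment, traversed rightwards, `arg(s-ρ) = -π`) and from above (upper segment,
traversed leftwards, `arg(s-ρ) = π`), and the circle `|s-ρ| = r` is traversed
anticlockwise. -/
noncomputable def hankelIntegral (f : ℂ → ℂ) (ρ : ℂ) (c r : ℝ) : ℂ :=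
  limUnder (nhdsWithin (0 : ℝ) (Set.Ioi 0)) (fun ε =>
    ((∫ σ in (ρ.re - c)..(ρ.re - r), f (σ + (ρ.im - ε) * I))
      + ∫ θ in (-Real.pi)..Real.pi, f (ρ + r * Complex.exp (θ * I)) * (I * r * Complex.exp (θ * I)))
      - ∫ σ in (ρ.re - c)..(ρ.re - r), f (σ + (ρ.im + ε) * I))

/-- The integral `∫ g(s) |ds|` of a nonnegative density `g` over the truncated Hankel
contour around `ρ` (horizontal extent `c`, radius `r`), horizontal segments again taken
as boundary values from below resp. above. -/
noncomputable def hankelAbsIntegral (g : ℂ → ℝ) (ρ : ℂ) (c r : ℝ) : ℝ :=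
  limUnder (nhdsWithin (0 : ℝ) (Set.Ioi 0)) (fun ε =>
    (∫ σ in (ρ.re - c)..(ρ.re - r), g (σ + (ρ.im - ε) * I))
      + (∫ θ in (-Real.pi)..Real.pi, g (ρ + r * Complex.exp (θ * I)) * r)
      + ∫ σ in (ρ.re - c)..(ρ.re - r), g (σ + (ρ.im + ε) * I))

/-- The constant `C_q` of the paper. -/
noncomputable def Cconst (q : ℕ) : ℝ :=
  (2 * Real.pi ^ (-(1 / 4 : ℝ)) / Real.Gamma (1 / 4)) *
    (∏' p : Nat.Primes, if (p : ℕ) % 4 = 3 then (1 - (p : ℝ) ^ (-(2:ℝ))) ^ (-(1 / 4 : ℝ)) else 1) *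
    ∏ p ∈ q.primeFactors.filter (fun p => p % 4 = 3), (1 - 1 / (p : ℝ)) ^ ((1 : ℝ) / 2)

/-- A nonvanishing holomorphic function on a nonempty convex open set has a holomorphic
logarithm. -/
theorem exists_holomorphic_log {U : Set ℂ} (hU : IsOpen U) (hc : Convex ℝ U) (hne : U.Nonempty)
    {g : ℂ → ℂ} (hg : DifferentiableOn ℂ g U) (h0 : ∀ z ∈ U, g z ≠ 0) :
    ∃ f : ℂ → ℂ, DifferentiableOn ℂ f U ∧ ∀ z ∈ U, exp (f z) = g z := by
  have hsc : IsSimplyConnected U := by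
    have := hc.contractibleSpace hne
    exact (SimplyConnectedSpace.ofContractible (Y := U))
  obtain ⟨f, hf, hfg⟩ := Complex.exists_continuousOn_eqOn_exp_comp hsc hU hg.continuousOn
    (by rintro ⟨z, hz, h⟩; exact h0 z hz h)
  refine ⟨f, fun z hz => ?_, fun z hz => hfg hz⟩
  have hUz : U ∈ nhds z := hU.mem_nhds hz
  have hcont : ContinuousAt f z := hf.continuousAt hUz
  have hev : ∀ᶠ w in nhds z, f w = f z + log (g w / g z) := by
    have h1 : ∀ᶠ w in nhds z, ‖f w - f z‖ < 1 := by
      have := Metric.tendsto_nhds.1 hcont 1 one_pos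
      simpa [dist_eq_norm] using this
    filter_upwards [h1, hUz] with w hw hwU
    have e1 : exp (f w) = g w := hfg hwU
    have e2 : exp (f z) = g z := hfg hz
    rw [← e1, ← e2, ← Complex.exp_sub, Complex.log_exp]
    · ring
    · have := (abs_le.1 ((Complex.abs_im_le_norm (f w - f z)).trans hw.le)).1
      linarith [Real.pi_gt_three]
    · have := (abs_le.1 ((Complex.abs_im_le_norm (f w - f z)).trans hw.le)).2
      linarith [Real.pi_gt_three]
  have hd : DifferentiableAt ℂ (fun w => f z + log (g w / g z)) z := by
    have hgz : DifferentiableAt ℂ g z := hg.differentiableAt hUz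
    refine (DifferentiableAt.clog (hgz.div_const _) ?_).const_add _
    rw [div_self (h0 z hz)]
    exact one_mem_slitPlane
  exact (hd.congr_of_eventuallyEq hev).differentiableWithinAt

/-- Gaussian absorption of polynomial growth. -/
theorem one_add_rpow_mul_exp_neg_sq_le {α : ℝ} (hα : 0 ≤ α) (y t : ℝ) :
    (1 + |y|) ^ α * Real.exp (-(y - t) ^ 2) ≤ Real.exp (α ^ 2 / 4) * (1 + |t|) ^ α := by
  have h1 : 1 + |y| ≤ (1 + |t|) * (1 + |y - t|) := by
    have : |y| ≤ |t| + |y - t| := by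
      calc |y| = |t + (y - t)| := by ring_nf
        _ ≤ _ := abs_add_le _ _
    nlinarith [abs_nonneg t, abs_nonneg (y - t)]
  have h2 : (1 + |y - t|) ^ α ≤ Real.exp (α * |y - t|) := by
    rw [mul_comm, Real.exp_mul]
    apply Real.rpow_le_rpow (by positivity) _ hα
    linarith [Real.add_one_le_exp |y - t|]
  calc (1 + |y|) ^ α * Real.exp (-(y - t) ^ 2)
      ≤ ((1 + |t|) * (1 + |y - t|)) ^ α * Real.exp (-(y - t) ^ 2) := by
        gcongr
    _ = (1 + |t|) ^ α * ((1 + |y - t|) ^ α * Real.exp (-(y - t) ^ 2)) := by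
        rw [Real.mul_rpow (by positivity) (by positivity)]; ring
    _ ≤ (1 + |t|) ^ α * (Real.exp (α * |y - t|) * Real.exp (-(y - t) ^ 2)) := by
        gcongr
    _ ≤ (1 + |t|) ^ α * Real.exp (α ^ 2 / 4) := by
        rw [← Real.exp_add]
        gcongr
        nlinarith [sq_nonneg (|y - t| - α / 2), sq_abs (y - t)]
    _ = _ := by ring

/-- Interpolation of polynomial growth in a vertical strip. -/
theorem polynomial_growth_interpolation {f : ℂ → ℂ} {a b A B α β K c : ℝ} (hab : a < b)
    (hf : Differentiable ℂ f) (hα : 0 ≤ α) (hβ : 0 ≤ β)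
    (hK : ∀ s : ℂ, a ≤ s.re → s.re ≤ b → ‖f s‖ ≤ K * Real.exp (c * |s.im|))
    (hA : ∀ s : ℂ, s.re = a → ‖f s‖ ≤ A * (1 + |s.im|) ^ α)
    (hB : ∀ s : ℂ, s.re = b → ‖f s‖ ≤ B * (1 + |s.im|) ^ β) :
    ∃ C, 0 < C ∧ ∀ s : ℂ, a ≤ s.re → s.re ≤ b →
      ‖f s‖ ≤ C * (1 + |s.im|) ^
        (α * (1 - (s.re - a) / (b - a)) + β * ((s.re - a) / (b - a))) := by
  set m := Real.exp ((|a| + |b|) ^ 2) with hm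
  have hm0 : 0 < m := Real.exp_pos _
  set A' := (|A| + 1) * m * Real.exp (α ^ 2 / 4) with hA'
  set B' := (|B| + 1) * m * Real.exp (β ^ 2 / 4) with hB'
  have hA0 : 0 < A' := by positivity
  have hB0 : 0 < B' := by positivity
  refine ⟨max A' B', by positivity, fun s hsa hsb => ?_⟩
  set t := s.im with ht
  set g : ℂ → ℂ := fun z => f z * exp ((z - t * I) ^ 2) with hg
  have hgn : ∀ z : ℂ, a ≤ z.re → z.re ≤ b →
      ‖g z‖ ≤ ‖f z‖ * (m * Real.exp (-(z.im - t) ^ 2)) := by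
    intro z h1 h2
    simp only [hg, norm_mul, Complex.norm_exp]
    gcongr
    rw [hm, ← Real.exp_add]
    apply Real.exp_le_exp.2
    have : ((z - t * I) ^ 2).re = z.re ^ 2 - (z.im - t) ^ 2 := by
      simp [pow_two]
    rw [this]
    have h3 : |z.re| ≤ |a| + |b| := by
      rw [abs_le]
      constructor
      · linarith [neg_abs_le a, abs_nonneg b]
      · linarith [le_abs_self b, abs_nonneg a]
    have : z.re ^ 2 ≤ (|a| + |b|) ^ 2 := by
      rw [← sq_abs]; gcongr
    linarith
  have hgA : ∀ z ∈ re ⁻¹' {a}, ‖g z‖ ≤ A' * (1 + |t|) ^ α := by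
    intro z hz
    have hz : z.re = a := hz
    calc ‖g z‖ ≤ ‖f z‖ * (m * Real.exp (-(z.im - t) ^ 2)) := hgn z hz.ge (by linarith)
      _ ≤ ((|A| + 1) * (1 + |z.im|) ^ α) * (m * Real.exp (-(z.im - t) ^ 2)) := by
        gcongr
        refine (hA z hz).trans ?_
        gcongr
        linarith [le_abs_self A]
      _ = (|A| + 1) * m * ((1 + |z.im|) ^ α * Real.exp (-(z.im - t) ^ 2)) := by ring
      _ ≤ (|A| + 1) * m * (Real.exp (α ^ 2 / 4) * (1 + |t|) ^ α) := by
        exact mul_le_mul_of_nonneg_left (one_add_rpow_mul_exp_neg_sq_le hα _ _) (by positivity)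
      _ = _ := by rw [hA']; ring
  have hgB : ∀ z ∈ re ⁻¹' {b}, ‖g z‖ ≤ B' * (1 + |t|) ^ β := by
    intro z hz
    have hz : z.re = b := hz
    calc ‖g z‖ ≤ ‖f z‖ * (m * Real.exp (-(z.im - t) ^ 2)) := hgn z (by linarith) hz.le
      _ ≤ ((|B| + 1) * (1 + |z.im|) ^ β) * (m * Real.exp (-(z.im - t) ^ 2)) := by
        gcongr
        refine (hB z hz).trans ?_
        gcongr
        linarith [le_abs_self B]
      _ = (|B| + 1) * m * ((1 + |z.im|) ^ β * Real.exp (-(z.im - t) ^ 2)) := by ring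
      _ ≤ (|B| + 1) * m * (Real.exp (β ^ 2 / 4) * (1 + |t|) ^ β) := by
        exact mul_le_mul_of_nonneg_left (one_add_rpow_mul_exp_neg_sq_le hβ _ _) (by positivity)
      _ = _ := by rw [hB']; ring
  have hgd : Differentiable ℂ g := by
    intro z
    exact (hf z).mul (by fun_prop)
  have hbdd : BddAbove ((norm ∘ g) '' HadamardThreeLines.verticalClosedStrip a b) := by
    refine ⟨|K| * m * Real.exp (|c| * |t| + |c| ^ 2 / 4), ?_⟩
    rintro _ ⟨z, hz, rfl⟩
    have hz : z.re ∈ Set.Icc a b := hz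
    calc ‖g z‖ ≤ ‖f z‖ * (m * Real.exp (-(z.im - t) ^ 2)) := hgn z hz.1 hz.2
      _ ≤ (|K| * Real.exp (|c| * (|t| + |z.im - t|))) * (m * Real.exp (-(z.im - t) ^ 2)) := by
        gcongr
        refine (hK z hz.1 hz.2).trans ?_
        have : |z.im| ≤ |t| + |z.im - t| := by
          calc |z.im| = |t + (z.im - t)| := by ring_nf
            _ ≤ _ := abs_add_le _ _
        refine mul_le_mul (le_abs_self K) (Real.exp_le_exp.2 ?_) (Real.exp_nonneg _) (abs_nonneg _)
        exact mul_le_mul (le_abs_self c) this (abs_nonneg _) (abs_nonneg _)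
      _ = |K| * m * (Real.exp (|c| * (|t| + |z.im - t|)) * Real.exp (-(z.im - t) ^ 2)) := by ring
      _ ≤ _ := by
        rw [← Real.exp_add]
        refine mul_le_mul_of_nonneg_left (Real.exp_le_exp.2 ?_) (by positivity)
        nlinarith [sq_nonneg (|z.im - t| - |c| / 2), sq_abs (z.im - t)]
  have key := HadamardThreeLines.norm_le_interp_of_mem_verticalClosedStrip' hab
    (z := s) ⟨hsa, hsb⟩ hgd.diffContOnCl hbdd hgA hgB
  have hgs : ‖f s‖ ≤ ‖g s‖ := by
    simp only [hg, norm_mul, Complex.norm_exp]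
    have : ((s - t * I) ^ 2).re = s.re ^ 2 := by
      simp [pow_two, ht]
    rw [this]
    exact le_mul_of_one_le_right (norm_nonneg _) (Real.one_le_exp (sq_nonneg _))
  set x := (s.re - a) / (b - a) with hx
  have hx0 : 0 ≤ x := div_nonneg (by linarith) (by linarith)
  have hx1 : x ≤ 1 := by rw [hx, div_le_one (by linarith)]; linarith
  have ht0 : 0 < 1 + |t| := by positivity
  calc ‖f s‖ ≤ _ := hgs.trans key
    _ = (A' ^ (1 - x) * B' ^ x) * (1 + |t|) ^ (α * (1 - x) + β * x) := by
      rw [Real.mul_rpow hA0.le (by positivity), Real.mul_rpow hB0.le (by positivity),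
        ← Real.rpow_mul ht0.le, ← Real.rpow_mul ht0.le, Real.rpow_add ht0]
      ring
    _ ≤ ((max A' B') ^ (1 - x) * (max A' B') ^ x) * (1 + |t|) ^ (α * (1 - x) + β * x) := by
      have h1 : 0 ≤ 1 - x := by linarith
      have e1 : A' ^ (1 - x) ≤ (max A' B') ^ (1 - x) :=
        Real.rpow_le_rpow hA0.le (le_max_left _ _) h1
      have e2 : B' ^ x ≤ (max A' B') ^ x :=
        Real.rpow_le_rpow hB0.le (le_max_right _ _) hx0
      gcongr
    _ = _ := by
      rw [← Real.rpow_add (by positivity)]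
      simp

/-- A zero-free holomorphic function has a logarithmic derivative controlled by the ratio of its
maximum to its central value. -/
theorem exists_norm_logDeriv_le_of_ne_zero {r R : ℝ} (hr : 0 < r) (hrR : r < R) :
    ∃ C : ℝ, 0 < C ∧ ∀ (g : ℂ → ℂ) (c : ℂ) (M m : ℝ), DifferentiableOn ℂ g (Metric.ball c R) →
      (∀ z ∈ Metric.ball c R, g z ≠ 0) → (∀ z ∈ Metric.ball c R, ‖g z‖ ≤ M) →
      0 < m → m ≤ ‖g c‖ →
      ∀ z ∈ Metric.closedBall c r, ‖logDeriv g z‖ ≤ C * (Real.log (M / m) + 1) := by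
  set r' := (r + R) / 2 with hr'
  have h1 : r < r' := by rw [hr']; linarith
  have h2 : r' < R := by rw [hr']; linarith
  have h3 : 0 < R - r' := by linarith
  have h4 : 0 < r' - r := by linarith
  have h5 : 0 < r' := by linarith
  refine ⟨2 * r' / (R - r') / (r' - r), by positivity, ?_⟩
  intro g c M m hg hg0 hM hm hmc z hz
  have hcR : c ∈ Metric.ball c R := Metric.mem_ball_self (by linarith)
  obtain ⟨f, hf, hfg⟩ := exists_holomorphic_log Metric.isOpen_ball (convex_ball c R) ⟨c, hcR⟩ hg hg0
  have hmM : m ≤ M := hmc.trans (hM c hcR)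
  have hM0 : 0 < M := hm.trans_le hmM
  have hlog : 0 ≤ Real.log (M / m) := Real.log_nonneg (by rwa [one_le_div hm])
  set M' := Real.log (M / m) + 1 with hM'
  have hM'0 : 0 < M' := by linarith
  set f0 : ℂ → ℂ := fun w => f (c + w) - f c with hf0
  have hmem : ∀ w ∈ Metric.ball (0:ℂ) R, c + w ∈ Metric.ball c R := by
    intro w hw
    simpa [dist_eq_norm] using hw
  have hf0d : DifferentiableOn ℂ f0 (Metric.ball 0 R) := by
    refine DifferentiableOn.sub ?_ (differentiableOn_const _)
    exact hf.comp (by fun_prop) hmem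
  have hre : ∀ w ∈ Metric.ball c R, (f w).re = Real.log ‖g w‖ := by
    intro w hw
    rw [← hfg w hw, Complex.norm_exp, Real.log_exp]
  have hmaps : Set.MapsTo f0 (Metric.ball 0 R) {z | z.re ≤ M'} := by
    intro w hw
    have hw' := hmem w hw
    simp only [Set.mem_ofPred_eq, hf0, sub_re, hre _ hw', hre _ hcR]
    have e1 : Real.log ‖g (c + w)‖ ≤ Real.log M :=
      Real.log_le_log (norm_pos_iff.2 (hg0 _ hw')) (hM _ hw')
    have e2 : Real.log m ≤ Real.log ‖g c‖ := Real.log_le_log hm hmc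
    rw [hM', Real.log_div hM0.ne' hm.ne']
    linarith
  have hbc : ∀ w ∈ Metric.closedBall (0:ℂ) r', ‖f0 w‖ ≤ M' * (2 * r' / (R - r')) := by
    intro w hw
    have hwn : ‖w‖ ≤ r' := by simpa using hw
    have := Complex.borelCaratheodory_zero hM'0 hf0d hmaps (by linarith)
      (z := w) (by simp; linarith) (by simp [hf0])
    refine this.trans ?_
    rw [mul_div_assoc', div_le_div_iff₀ (by linarith) h3]
    have : 0 ≤ ‖w‖ := norm_nonneg w
    nlinarith [mul_pos hM'0 h3, mul_nonneg hM'0.le (sub_nonneg.2 hwn)]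
  have hzn : ‖z - c‖ ≤ r := by simpa [dist_eq_norm] using hz
  have hzR : z ∈ Metric.ball c R := by
    simp [dist_eq_norm]; linarith
  have hder : ‖deriv f0 (z - c)‖ ≤ M' * (2 * r' / (R - r')) / (r' - r) := by
    have hsub : Metric.closedBall (z - c) (r' - r) ⊆ Metric.closedBall 0 r' := by
      intro w hw
      have : ‖w - (z - c)‖ ≤ r' - r := by simpa [dist_eq_norm] using hw
      have e : ‖w‖ ≤ ‖w - (z - c)‖ + ‖z - c‖ := by
        simpa using norm_add_le (w - (z - c)) (z - c)
      simp; linarith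
    apply Complex.norm_deriv_le_of_forall_mem_sphere_norm_le h4
    · apply DifferentiableOn.diffContOnCl
      rw [closure_ball _ h4.ne']
      refine hf0d.mono (hsub.trans ?_)
      intro w hw
      have : ‖w‖ ≤ r' := by simpa using hw
      simp; linarith
    · intro w hw
      exact hbc w (hsub (Metric.sphere_subset_closedBall hw))
  have hfz : HasDerivAt f (deriv f z) z :=
    (hf.differentiableAt (Metric.isOpen_ball.mem_nhds hzR)).hasDerivAt
  have e1 : deriv f0 (z - c) = deriv f z := by
    have : HasDerivAt f (deriv f z) (c + (z - c)) := by simpa using hfz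
    have := (this.comp_const_add c (z - c)).sub_const (f c)
    exact this.deriv
  have e2 : logDeriv g z = deriv f z := by
    have hev : g =ᶠ[nhds z] fun w => exp (f w) := by
      filter_upwards [Metric.isOpen_ball.mem_nhds hzR] with w hw using (hfg w hw).symm
    rw [logDeriv_apply, hev.deriv_eq, ← hfg z hzR, hfz.cexp.deriv]
    field_simp
  rw [e2, ← e1]
  refine hder.trans (le_of_eq ?_)
  field_simp

/-- Division of an entire function by its zeros near a point, with a count of those zeros. -/
theorem exists_factorization_closedBall {f : ℂ → ℂ} (hf : Differentiable ℂ f) {c : ℂ} {M m : ℝ}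
    (hM : ∀ z ∈ Metric.closedBall c 6, ‖f z‖ ≤ M) (hm : 0 < m) (hmc : m ≤ ‖f c‖) :
    ∃ (l : Multiset ℂ) (g : ℂ → ℂ), Differentiable ℂ g ∧
      (∀ z, f z = (l.map fun ρ => z - ρ).prod * g z) ∧
      (∀ ρ ∈ l, f ρ = 0 ∧ ‖ρ - c‖ ≤ 2) ∧ (∀ z ∈ Metric.closedBall c 2, g z ≠ 0) ∧
      (2:ℝ) ^ l.card ≤ M / m ∧ (∀ z ∈ Metric.closedBall c 6, ‖g z‖ ≤ M / 4 ^ l.card) ∧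
      m / 2 ^ l.card ≤ ‖g c‖ := by
  have bound : ∀ (l : Multiset ℂ) (g : ℂ → ℂ), Differentiable ℂ g →
      (∀ z, f z = (l.map fun ρ => z - ρ).prod * g z) → (∀ ρ ∈ l, f ρ = 0 ∧ ‖ρ - c‖ ≤ 2) →
      (2:ℝ) ^ l.card ≤ M / m ∧ (∀ z ∈ Metric.closedBall c 6, ‖g z‖ ≤ M / 4 ^ l.card) ∧
      m / 2 ^ l.card ≤ ‖g c‖ := by
    intro l g hg hfg hl
    have hnorm : ∀ z, ‖(l.map fun ρ => z - ρ).prod‖ = (l.map fun ρ => ‖z - ρ‖).prod := by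
      intro z
      clear hfg hl
      induction l using Multiset.induction_on with
      | empty => simp
      | cons a s ih => simp [ih]
    have hconst : ∀ x : ℝ, x ^ l.card = (l.map fun _ => x).prod := by simp
    have hsph : ∀ z ∈ Metric.sphere c 6, ‖g z‖ ≤ M / 4 ^ l.card := by
      intro z hz
      rw [le_div_iff₀ (by positivity)]
      refine le_trans ?_ (hM z (Metric.sphere_subset_closedBall hz))
      rw [hfg z, norm_mul, mul_comm, hnorm]
      refine mul_le_mul_of_nonneg_right ?_ (norm_nonneg _)
      rw [hconst]
      refine Multiset.prod_map_le_prod_map₀ _ _ (fun _ _ => by norm_num) ?_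
      intro ρ hρ
      have h1 := (hl ρ hρ).2
      have h2 : ‖z - c‖ = 6 := by simpa [dist_eq_norm] using hz
      have h3 : ‖z - c‖ ≤ ‖z - ρ‖ + ‖ρ - c‖ := by simpa using norm_add_le (z - ρ) (ρ - c)
      linarith
    have hball : ∀ z ∈ Metric.closedBall c 6, ‖g z‖ ≤ M / 4 ^ l.card := by
      intro z hz
      have h6 : (6:ℝ) ≠ 0 := by norm_num
      refine Complex.norm_le_of_forall_mem_frontier_norm_le Metric.isBounded_ball
        hg.diffContOnCl (U := Metric.ball c 6) ?_ (by rwa [closure_ball _ h6])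
      rwa [frontier_ball _ h6]
    have hc1 : m / 2 ^ l.card ≤ ‖g c‖ := by
      rw [div_le_iff₀ (by positivity)]
      refine hmc.trans ?_
      rw [hfg c, norm_mul, mul_comm, hnorm]
      refine mul_le_mul_of_nonneg_left ?_ (norm_nonneg _)
      rw [hconst]
      refine Multiset.prod_map_le_prod_map₀ _ _ (fun _ _ => norm_nonneg _) ?_
      intro ρ hρ
      rw [norm_sub_rev]
      exact (hl ρ hρ).2
    refine ⟨?_, hball, hc1⟩
    have := hc1.trans (hball c (Metric.mem_closedBall_self (by norm_num)))
    rw [div_le_div_iff₀ (by positivity) (by positivity)] at this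
    rw [le_div_iff₀ hm]
    have h4 : (4:ℝ) ^ l.card = 2 ^ l.card * 2 ^ l.card := by
      rw [← mul_pow]; norm_num
    rw [h4] at this
    have h2 : (0:ℝ) < 2 ^ l.card := by positivity
    nlinarith
  by_contra hcon
  have all : ∀ n : ℕ, ∃ (l : Multiset ℂ) (g : ℂ → ℂ), l.card = n ∧ Differentiable ℂ g ∧
      (∀ z, f z = (l.map fun ρ => z - ρ).prod * g z) ∧ (∀ ρ ∈ l, f ρ = 0 ∧ ‖ρ - c‖ ≤ 2) := by
    intro n
    induction n with
    | zero => exact ⟨0, f, by simp, hf, by simp, by simp⟩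
    | succ n ih =>
      obtain ⟨l, g, hn, hg, hfg, hl⟩ := ih
      by_cases hz : ∀ z ∈ Metric.closedBall c 2, g z ≠ 0
      · exact absurd ⟨l, g, hg, hfg, hl, hz, bound l g hg hfg hl⟩ hcon
      · push Not at hz
        obtain ⟨a, ha, hga⟩ := hz
        refine ⟨a ::ₘ l, dslope g a, by simp [hn], ?_, ?_, ?_⟩
        · rw [← differentiableOn_univ] at hg ⊢
          exact (Complex.differentiableOn_dslope Filter.univ_mem).2 hg
        · intro z
          have := sub_smul_dslope g a z
          rw [hga, sub_zero, smul_eq_mul] at this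
          rw [hfg z, ← this]
          simp
          ring
        · intro ρ hρ
          rcases Multiset.mem_cons.1 hρ with h | h
          · subst h
            exact ⟨by rw [hfg ρ, hga, mul_zero], by simpa [dist_eq_norm] using ha⟩
          · exact hl ρ h
  obtain ⟨n, hn⟩ := pow_unbounded_of_one_lt (M / m) (one_lt_two : (1:ℝ) < 2)
  obtain ⟨l, g, hln, hg, hfg, hl⟩ := all n
  have := (bound l g hg hfg hl).1
  rw [hln] at this
  linarith

/-- The partial fraction expansion of the logarithmic derivative near a point. -/
theorem exists_logDeriv_sub_sum_le :
    ∃ C : ℝ, 0 < C ∧ ∀ (f : ℂ → ℂ) (c : ℂ) (M m : ℝ), Differentiable ℂ f →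
      (∀ z ∈ Metric.closedBall c 6, ‖f z‖ ≤ M) → 0 < m → m ≤ ‖f c‖ →
      ∃ l : Multiset ℂ, (2:ℝ) ^ l.card ≤ M / m ∧ (∀ ρ ∈ l, f ρ = 0) ∧
        (∀ ρ ∈ l, ∃ k : ℂ → ℂ, Differentiable ℂ k ∧ ∀ z, f z = (z - ρ) * k z) ∧
        ∀ z ∈ Metric.closedBall c (19 / 10), f z ≠ 0 →
          ‖logDeriv f z - (l.map fun ρ => (z - ρ)⁻¹).sum‖ ≤ C * (Real.log (M / m) + 1) := by
  obtain ⟨C, hC, hA⟩ := exists_norm_logDeriv_le_of_ne_zero (r := 19 / 10) (R := 2)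
    (by norm_num) (by norm_num)
  refine ⟨C, hC, ?_⟩
  intro f c M m hf hM hm hmc
  obtain ⟨l, g, hg, hfg, hl, hg0, hcard, hgM, hgm⟩ := exists_factorization_closedBall hf hM hm hmc
  refine ⟨l, hcard, fun ρ hρ => (hl ρ hρ).1, ?_, ?_⟩
  · intro ρ hρ
    obtain ⟨l', rfl⟩ := Multiset.exists_cons_of_mem hρ
    refine ⟨fun z => (l'.map fun ρ => z - ρ).prod * g z, ?_, ?_⟩
    · refine Differentiable.mul ?_ hg
      clear hfg hl hcard hgM hgm hρ
      induction l' using Multiset.induction_on with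
      | empty => simp
      | cons a s ih => simp only [Multiset.map_cons, Multiset.prod_cons]; fun_prop
    · intro z
      rw [hfg z]
      simp [mul_assoc]
  · intro z hz hfz
    have hz2 : z ∈ Metric.closedBall c 2 :=
      Metric.closedBall_subset_closedBall (by norm_num) hz
    have hkey : logDeriv f z - (l.map fun ρ => (z - ρ)⁻¹).sum = logDeriv g z := by
      have hfe : f = fun z => (l.map fun ρ => z - ρ).prod * g z := funext hfg
      have hp0 : (l.map fun ρ => z - ρ).prod ≠ 0 := by
        intro h0
        apply hfz
        rw [hfg z, h0, zero_mul]
      have : ∀ s : Multiset ℂ, (s.map fun ρ => z - ρ).prod ≠ 0 →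
          DifferentiableAt ℂ (fun z => (s.map fun ρ => z - ρ).prod) z ∧
          logDeriv (fun z => (s.map fun ρ => z - ρ).prod) z = (s.map fun ρ => (z - ρ)⁻¹).sum := by
        intro s
        induction s using Multiset.induction_on with
        | empty =>
          intro _
          simp
        | cons a s ih =>
          intro h
          simp only [Multiset.map_cons, Multiset.prod_cons, Multiset.sum_cons] at h ⊢
          obtain ⟨i1, i2⟩ := ih (right_ne_zero_of_mul h)
          refine ⟨by fun_prop, ?_⟩
          rw [logDeriv_mul (f := fun z => z - a) z (left_ne_zero_of_mul h) (right_ne_zero_of_mul h)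
            (by fun_prop) i1, i2]
          simp [logDeriv_apply]
      obtain ⟨h1, h2⟩ := this l hp0
      rw [hfe, logDeriv_mul (f := fun z => (l.map fun ρ => z - ρ).prod) z hp0 (hg0 z hz2) h1 (hg z),
        h2]
      ring
    rw [hkey]
    have hn := hA g c (M / 4 ^ l.card) (m / 2 ^ l.card) hg.differentiableOn
      (fun w hw => hg0 w (Metric.ball_subset_closedBall hw))
      (fun w hw => hgM w (Metric.closedBall_subset_closedBall (by norm_num)
        (Metric.ball_subset_closedBall hw))) (by positivity) hgm z hz
    refine hn.trans (mul_le_mul_of_nonneg_left ?_ hC.le)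
    have hM0 : 0 < M := hm.trans_le
      (hmc.trans (hM c (Metric.mem_closedBall_self (by norm_num))))
    have : Real.log (M / 4 ^ l.card / (m / 2 ^ l.card)) ≤ Real.log (M / m) := by
      apply Real.log_le_log (by positivity)
      have h4 : (4:ℝ) ^ l.card = 2 ^ l.card * 2 ^ l.card := by
        rw [← mul_pow]; norm_num
      rw [h4, div_div_div_eq, div_le_div_iff₀ (by positivity) hm]
      have h2 : (1:ℝ) ≤ 2 ^ l.card := one_le_pow₀ (by norm_num)
      have : 0 ≤ M * m * 2 ^ l.card * (2 ^ l.card - 1) := by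
        have : (0:ℝ) ≤ 2 ^ l.card - 1 := by linarith
        positivity
      nlinarith
    linarith

theorem sum_range_zmod_natCast {N : ℕ} [NeZero N] (Φ : ZMod N → ℂ) :
    ∑ k ∈ Finset.range N, Φ (k : ZMod N) = ∑ j, Φ j := by
  refine Finset.sum_bij' (fun k _ => (k : ZMod N)) (fun j _ => j.val) ?_ ?_ ?_ ?_ ?_
  · simp
  · intro j _; simpa using ZMod.val_lt j
  · intro k hk; exact ZMod.val_cast_of_lt (by simpa using hk)
  · intro j _; simp
  · simp

/-- The partial sums of a function on `ZMod N` stay within bounded distance of their mean. -/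
theorem exists_norm_sum_zmod_sub_le {N : ℕ} [NeZero N] (Φ : ZMod N → ℂ) :
    ∃ C : ℝ, 0 < C ∧ ∀ n : ℕ,
      ‖∑ k ∈ Finset.Icc 1 n, Φ (k : ZMod N) - (∑ j, Φ j) / N * n‖ ≤ C := by
  set μ : ℂ := (∑ j, Φ j) / N with hμ
  have hN : (N : ℂ) ≠ 0 := Nat.cast_ne_zero.2 (NeZero.ne N)
  set g : ℕ → ℂ := fun n => ∑ k ∈ Finset.Icc 1 n, Φ (k : ZMod N) - μ * n with hg
  have hstep : ∀ n, g (n + 1) = g n + (Φ ((n + 1 : ℕ) : ZMod N) - μ) := by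
    intro n
    simp only [hg, Finset.sum_Icc_succ_top (Nat.le_add_left 1 n)]
    push_cast
    ring
  have hgN : g N = 0 := by
    have h1 : ∑ k ∈ Finset.Icc 1 N, Φ (k : ZMod N) = ∑ k ∈ Finset.range N, Φ (k : ZMod N) := by
      have e1 := Finset.sum_range_succ (fun k : ℕ => Φ (k : ZMod N)) N
      have e2 := Finset.sum_range_succ' (fun k : ℕ => Φ (k : ZMod N)) N
      have e3 : ∑ k ∈ Finset.Icc 1 N, Φ (k : ZMod N)
          = ∑ k ∈ Finset.range N, Φ ((k + 1 : ℕ) : ZMod N) := by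
        rw [Finset.range_eq_Ico, Finset.sum_Ico_add' (fun k : ℕ => Φ (k : ZMod N)) 0 N 1]
        rfl
      rw [e3]
      rw [e1] at e2
      simpa using e2.symm
    simp only [hg, h1, sum_range_zmod_natCast, hμ]
    field_simp
    ring
  have hper : Function.Periodic g N := by
    intro n
    induction n with
    | zero => simp [hgN]; simp [hg]
    | succ n ih =>
      rw [add_right_comm, hstep, hstep, ih]
      simp
  refine ⟨∑ i ∈ Finset.range N, ‖g i‖ + 1, by positivity, fun n => ?_⟩
  change ‖g n‖ ≤ _
  rw [← hper.map_mod_nat n]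
  have := Finset.single_le_sum (f := fun i => ‖g i‖) (fun i _ => norm_nonneg _)
    (Finset.mem_range.2 (Nat.mod_lt n (NeZero.pos N)))
  linarith

/-- The L-function of a function on `ZMod N` with its pole at `1` removed. -/
def LFunctionRegularized {N : ℕ} [NeZero N] (Φ : ZMod N → ℂ) : ℂ → ℂ :=
  Function.update (fun s => (s - 1) * ZMod.LFunction Φ s) 1 ((∑ j, Φ j) / N)

theorem differentiable_LFunctionRegularized {N : ℕ} [NeZero N] (Φ : ZMod N → ℂ) :
    Differentiable ℂ (LFunctionRegularized Φ) := by
  have hne : ∀ s ≠ 1, DifferentiableAt ℂ (LFunctionRegularized Φ) s := by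
    intro s hs
    have : DifferentiableAt ℂ (fun s => (s - 1) * ZMod.LFunction Φ s) s :=
      (by fun_prop : DifferentiableAt ℂ (fun s : ℂ => s - 1) s).mul
        (ZMod.differentiableAt_LFunction Φ s (Or.inl hs))
    refine this.congr_of_eventuallyEq ?_
    filter_upwards [isOpen_compl_singleton.mem_nhds hs] with z hz
    exact Function.update_of_ne hz _ _
  intro s
  by_cases hs : s = 1
  · subst hs
    refine (analyticAt_of_differentiable_on_punctured_nhds_of_continuousAt ?_ ?_).differentiableAt
    · filter_upwards [self_mem_nhdsWithin] with z hz using hne z hz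
    · exact continuousAt_update_same.2 (by simpa [Finset.sum_div] using ZMod.LFunction_residue_one Φ)
  · exact hne s hs

theorem hasMellin_remainder {N : ℕ} [NeZero N] (Φ : ZMod N → ℂ) :
    ∃ (C : ℝ) (G : ℂ → ℂ), 0 < C ∧ DifferentiableOn ℂ G {s | 0 < s.re} ∧
      (∀ s : ℂ, 0 < s.re → ‖G s‖ ≤ C / s.re) ∧
      ∀ s : ℂ, 1 < s.re → ZMod.LFunction Φ s = (∑ j, Φ j) / N * (s / (s - 1)) + s * G s := by
  obtain ⟨C, hC, hCb⟩ := exists_norm_sum_zmod_sub_le Φ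
  set μ : ℂ := (∑ j, Φ j) / N with hμ
  set S : ℝ → ℂ := fun t => ∑ k ∈ Finset.Icc 1 ⌊t⌋₊, Φ (k : ZMod N) with hS
  set R : ℝ → ℂ := Set.indicator (Set.Ioi 1) (fun t => S t - μ * t) with hR
  have hSm : Measurable S := by
    have : S = (fun n : ℕ => ∑ k ∈ Finset.Icc 1 n, Φ (k : ZMod N)) ∘ fun t : ℝ => ⌊t⌋₊ := rfl
    rw [this]
    exact (measurable_from_top).comp Nat.measurable_floor
  have hRm : Measurable R := by
    refine Measurable.indicator ?_ measurableSet_Ioi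
    exact hSm.sub (by fun_prop)
  have hRb : ∀ t, ‖R t‖ ≤ C + ‖μ‖ := by
    intro t
    by_cases ht : t ∈ Set.Ioi (1:ℝ)
    · rw [hR, Set.indicator_of_mem ht]
      have ht1 : (1:ℝ) < t := ht
      have e : S t - μ * t = (S t - μ * ⌊t⌋₊) + μ * ((⌊t⌋₊ : ℝ) - t : ℝ) := by
        push_cast; ring
      rw [e]
      refine (norm_add_le _ _).trans (add_le_add (hCb _) ?_)
      rw [norm_mul, Complex.norm_real, Real.norm_eq_abs]
      refine mul_le_of_le_one_right (norm_nonneg _) ?_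
      rw [abs_le]
      have h1 := Nat.floor_le (show 0 ≤ t by linarith)
      have h2 := Nat.lt_floor_add_one t
      constructor <;> linarith
    · rw [hR, Set.indicator_of_notMem ht]
      simp
      positivity
  have hRli : MeasureTheory.LocallyIntegrableOn R (Set.Ioi 0) := by
    refine MeasureTheory.LocallyIntegrable.locallyIntegrableOn ?_ _
    refine (MeasureTheory.locallyIntegrable_const (C + ‖μ‖)).mono hRm.aestronglyMeasurable ?_
    refine Eventually.of_forall fun t => (hRb t).trans (Real.le_norm_self _)
  have htop : R =O[atTop] (· ^ (-(0:ℝ))) := by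
    refine Asymptotics.IsBigO.of_bound (C + ‖μ‖) (Eventually.of_forall fun t => ?_)
    simpa using hRb t
  have hbot : ∀ b : ℝ, R =O[nhdsWithin 0 (Set.Ioi 0)] (· ^ (-b)) := by
    intro b
    refine Asymptotics.IsBigO.of_bound 1 ?_
    filter_upwards [nhdsWithin_le_nhds (Iio_mem_nhds (zero_lt_one' ℝ))] with t ht
    have : t ∉ Set.Ioi (1:ℝ) := by simp; exact le_of_lt ht
    rw [hR, Set.indicator_of_notMem this]
    simp
  refine ⟨C + ‖μ‖, fun s => mellin R (-s), by positivity, ?_, ?_, ?_⟩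
  · intro s hs
    have hs : 0 < s.re := hs
    have : DifferentiableAt ℂ (mellin R) (-s) := by
      refine mellin_differentiableAt_of_isBigO_rpow hRli htop (by simpa using hs)
        (hbot ((-s).re - 1)) (by linarith)
    exact (this.comp s differentiableAt_id.neg).differentiableWithinAt
  · intro s hs
    have heq : mellin R (-s) = ∫ t in Set.Ioi (1:ℝ), (t:ℂ) ^ (-s - 1) * R t := by
      rw [mellin]
      simp only [smul_eq_mul]
      refine MeasureTheory.setIntegral_eq_of_subset_of_forall_sdiff_eq_zero measurableSet_Ioi
        (Set.Ioi_subset_Ioi zero_le_one) ?_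
      intro t ht
      rw [hR, Set.indicator_of_notMem ht.2, mul_zero]
    have h_int := integrableOn_Ioi_rpow_of_lt (a := -s.re - 1) (by linarith) (zero_lt_one' ℝ)
    calc ‖mellin R (-s)‖ ≤ ∫ t in Set.Ioi (1:ℝ), t ^ (-s.re - 1) * (C + ‖μ‖) := by
          rw [heq]
          refine MeasureTheory.norm_integral_le_of_norm_le (h_int.mul_const _) ?_
          refine (MeasureTheory.ae_restrict_mem measurableSet_Ioi).mono fun t ht => ?_
          have ht0 : (0:ℝ) < t := zero_lt_one.trans ht
          rw [norm_mul, Complex.norm_cpow_eq_rpow_re_of_pos ht0]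
          simp only [sub_re, neg_re, one_re]
          exact mul_le_mul_of_nonneg_left (hRb t) (by positivity)
      _ = _ := by
          rw [MeasureTheory.integral_mul_const, integral_Ioi_rpow_of_lt (by linarith) zero_lt_one]
          simp
          field_simp
  · intro s hs
    rw [ZMod.LFunction_eq_LSeries Φ hs]
    have hO : (fun n : ℕ ↦ ∑ k ∈ Finset.Icc 1 n, Φ (k : ZMod N)) =O[atTop]
        fun n : ℕ ↦ (n : ℝ) ^ (1:ℝ) := by
      refine Asymptotics.IsBigO.of_bound (C + ‖μ‖) ?_
      filter_upwards [eventually_ge_atTop 1] with n hn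
      have hn1 : (1:ℝ) ≤ n := by exact_mod_cast hn
      have h1 := hCb n
      have e : ∑ k ∈ Finset.Icc 1 n, Φ (k : ZMod N)
        = (∑ k ∈ Finset.Icc 1 n, Φ (k : ZMod N) - μ * n) + μ * n := by ring
      rw [e]
      refine (norm_add_le _ _).trans ?_
      simp only [norm_mul, Real.rpow_one, Real.norm_natCast, Complex.norm_natCast]
      nlinarith
    have hsum := ZMod.LSeriesSummable_of_one_lt_re Φ hs
    rw [LSeries_eq_mul_integral (fun n => Φ (n : ZMod N)) zero_le_one hs hsum hO]
    have hs1 : s - 1 ≠ 0 := by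
      intro h
      have := congrArg Complex.re h
      simp at this
      linarith
    have hi1 : MeasureTheory.IntegrableOn (fun t : ℝ => (t:ℂ) ^ (-s)) (Set.Ioi 1) :=
      integrableOn_Ioi_cpow_of_lt (by simpa using hs) zero_lt_one
    have hconv : MellinConvergent R (-s) :=
      mellinConvergent_of_isBigO_rpow hRli htop (by simp; linarith)
        (hbot ((-s).re - 1)) (by linarith)
    have hi2 : MeasureTheory.IntegrableOn (fun t : ℝ => (t:ℂ) ^ (-s - 1) * R t) (Set.Ioi 1) :=
      MeasureTheory.IntegrableOn.mono_set hconv (Set.Ioi_subset_Ioi zero_le_one)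
    have heq : mellin R (-s) = ∫ t in Set.Ioi (1:ℝ), (t:ℂ) ^ (-s - 1) * R t := by
      rw [mellin]
      simp only [smul_eq_mul]
      refine MeasureTheory.setIntegral_eq_of_subset_of_forall_sdiff_eq_zero measurableSet_Ioi
        (Set.Ioi_subset_Ioi zero_le_one) ?_
      intro t ht
      rw [hR, Set.indicator_of_notMem ht.2, mul_zero]
    have hsplit : ∫ t in Set.Ioi (1:ℝ), S t * (t:ℂ) ^ (-(s + 1))
        = μ * (∫ t in Set.Ioi (1:ℝ), (t:ℂ) ^ (-s)) + mellin R (-s) := by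
      rw [heq, ← MeasureTheory.integral_const_mul, ← MeasureTheory.integral_add (hi1.const_mul μ) hi2]
      refine MeasureTheory.setIntegral_congr_fun measurableSet_Ioi fun t ht => ?_
      have ht0 : (t:ℂ) ≠ 0 := by
        exact_mod_cast (zero_lt_one.trans (show (1:ℝ) < t from ht)).ne'
      simp only [hR, Set.indicator_of_mem ht]
      have : (t:ℂ) ^ (-s) = t ^ (-s - 1) * t := by
        rw [Complex.cpow_sub _ _ ht0]; simp; field_simp
      rw [this, show -(s + 1) = -s - 1 by ring]
      ring
    rw [hsplit, integral_Ioi_cpow_of_lt (by simpa using hs) zero_lt_one]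
    simp only [ofReal_one, one_cpow]
    have : -s + 1 ≠ 0 := by
      intro h; apply hs1; rw [← neg_eq_zero, ← h]; ring
    field_simp
    ring

theorem LFunctionRegularized_eq {N : ℕ} [NeZero N] (Φ : ZMod N → ℂ) {G : ℂ → ℂ}
    (hG : DifferentiableOn ℂ G {s | 0 < s.re})
    (h : ∀ s : ℂ, 1 < s.re → ZMod.LFunction Φ s = (∑ j, Φ j) / N * (s / (s - 1)) + s * G s)
    {s : ℂ} (hs : 0 < s.re) :
    LFunctionRegularized Φ s = (∑ j, Φ j) / N * s + s * (s - 1) * G s := by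
  have hopen : IsOpen {s : ℂ | 0 < s.re} := isOpen_lt continuous_const Complex.continuous_re
  have hconv : Convex ℝ {s : ℂ | 0 < s.re} := convex_halfSpace_re_gt 0
  have h1 : AnalyticOnNhd ℂ (LFunctionRegularized Φ) {s | 0 < s.re} :=
    (differentiable_LFunctionRegularized Φ).differentiableOn.analyticOnNhd hopen
  have h2 : AnalyticOnNhd ℂ (fun s => (∑ j, Φ j) / N * s + s * (s - 1) * G s) {s | 0 < s.re} := by
    refine DifferentiableOn.analyticOnNhd ?_ hopen
    fun_prop
  refine h1.eqOn_of_preconnected_of_eventuallyEq h2 hconv.isPreconnected (z₀ := 2) (by simp) ?_ hs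
  have : {s : ℂ | 1 < s.re} ∈ nhds (2:ℂ) :=
    (isOpen_lt continuous_const Complex.continuous_re).mem_nhds (by simp)
  filter_upwards [this] with z hz
  have hz : 1 < z.re := hz
  have hz1 : z ≠ 1 := by rintro rfl; simp at hz
  rw [LFunctionRegularized, Function.update_of_ne hz1, h z hz]
  have := sub_ne_zero.2 hz1
  field_simp

/-- Polynomial growth of L-functions in the right half-plane. -/
theorem exists_norm_LFunctionRegularized_le {N : ℕ} [NeZero N] (Φ : ZMod N → ℂ) :
    ∃ C : ℝ, 0 < C ∧ ∀ s : ℂ, 1 / 2 ≤ s.re →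
      ‖LFunctionRegularized Φ s‖ ≤ C * (1 + ‖s‖) ^ 2 := by
  obtain ⟨C, G, hC, hGd, hGb, hG⟩ := hasMellin_remainder Φ
  refine ⟨‖(∑ j, Φ j) / (N:ℂ)‖ + 2 * C, by positivity, fun s hs => ?_⟩
  have hs0 : 0 < s.re := by linarith
  rw [LFunctionRegularized_eq Φ hGd hG hs0]
  have h1 : ‖G s‖ ≤ 2 * C := (hGb s hs0).trans (by rw [div_le_iff₀ hs0]; nlinarith)
  have h2 : ‖s - 1‖ ≤ 1 + ‖s‖ := by
    have := norm_sub_le s 1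
    simp at this
    linarith
  have h3 : 0 ≤ ‖s‖ := norm_nonneg _
  calc _ ≤ ‖(∑ j, Φ j) / (N:ℂ)‖ * ‖s‖ + ‖s‖ * ‖s - 1‖ * ‖G s‖ := by
        refine (norm_add_le _ _).trans ?_
        simp only [norm_mul]; rfl
    _ ≤ ‖(∑ j, Φ j) / (N:ℂ)‖ * (1 + ‖s‖) ^ 2 + ((1 + ‖s‖) * (1 + ‖s‖)) * (2 * C) := by
        gcongr
        · nlinarith
        · linarith
    _ = _ := by ring

theorem exists_norm_LFunction_le_of_sum_zero {N : ℕ} [NeZero N] {Φ : ZMod N → ℂ}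
    (hΦ : ∑ j, Φ j = 0) :
    ∃ C : ℝ, 0 < C ∧ ∀ s : ℂ, 1 / 2 ≤ s.re → ‖ZMod.LFunction Φ s‖ ≤ C * ‖s‖ := by
  obtain ⟨C, G, hC, hGd, hGb, hG⟩ := hasMellin_remainder Φ
  refine ⟨2 * C, by positivity, fun s hs => ?_⟩
  have hs0 : 0 < s.re := by linarith
  have h1 : ‖G s‖ ≤ 2 * C := (hGb s hs0).trans (by rw [div_le_iff₀ hs0]; nlinarith)
  have hopen : IsOpen {s : ℂ | 0 < s.re} := isOpen_lt continuous_const Complex.continuous_re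
  have h2 : Set.EqOn (ZMod.LFunction Φ) (fun s => s * G s) {s : ℂ | 0 < s.re} := by
    refine AnalyticOnNhd.eqOn_of_preconnected_of_eventuallyEq
      ((ZMod.differentiable_LFunction_of_sum_zero hΦ).differentiableOn.analyticOnNhd hopen)
      (DifferentiableOn.analyticOnNhd (by fun_prop) hopen)
      (convex_halfSpace_re_gt 0).isPreconnected (z₀ := 2) (by simp) ?_
    have : {s : ℂ | 1 < s.re} ∈ nhds (2:ℂ) :=
      (isOpen_lt continuous_const Complex.continuous_re).mem_nhds (by simp)
    filter_upwards [this] with z hz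
    rw [hG z hz, hΦ]
    simp
  rw [h2 hs0, norm_mul, mul_comm]
  exact mul_le_mul_of_nonneg_right h1 (norm_nonneg _)

theorem norm_Gamma_le_Gamma_re {s : ℂ} (hs : 0 < s.re) : ‖Complex.Gamma s‖ ≤ Real.Gamma s.re := by
  rw [Complex.Gamma_eq_integral hs, Real.Gamma_eq_integral hs, Complex.GammaIntegral]
  refine (MeasureTheory.norm_integral_le_integral_norm _).trans (le_of_eq ?_)
  refine MeasureTheory.setIntegral_congr_fun measurableSet_Ioi fun x hx => ?_
  have hx : 0 < x := hx
  simp only [norm_mul, Complex.norm_cpow_eq_rpow_re_of_pos hx, Complex.norm_real, Real.norm_eq_abs,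
    Real.abs_exp, sub_re, one_re]

theorem norm_Gamma_one_add_mul_I_sq {t : ℝ} (ht : t ≠ 0) :
    ‖Complex.Gamma (1 + t * I)‖ ^ 2 = Real.pi * t / Real.sinh (Real.pi * t) := by
  have h1 : (starRingEnd ℂ) (1 + t * I) = 1 - t * I := by
    simp [sub_eq_add_neg]
  have hsq : ((‖Complex.Gamma (1 + t * I)‖ ^ 2 : ℝ) : ℂ)
      = Complex.Gamma (1 + t * I) * Complex.Gamma (1 - t * I) := by
    rw [← h1, Complex.Gamma_conj, Complex.mul_conj, Complex.normSq_eq_norm_sq]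
  have htI : (t * I : ℂ) ≠ 0 := by simp [ht]
  have h2 : Complex.Gamma (1 + t * I) * Complex.Gamma (1 - t * I)
      = ((Real.pi * t / Real.sinh (Real.pi * t) : ℝ) : ℂ) := by
    rw [add_comm, Complex.Gamma_add_one _ htI, mul_assoc, Complex.Gamma_mul_Gamma_one_sub]
    rw [show (Real.pi * (t * I) : ℂ) = (Real.pi * t : ℂ) * I by ring, Complex.sin_mul_I]
    push_cast
    rcases eq_or_ne (Complex.sinh (Real.pi * t)) 0 with h | h
    · simp [h]
    · field_simp
  rw [h2] at hsq
  exact_mod_cast hsq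

theorem exists_norm_Gamma_vertical_le (k : ℕ) : ∃ C : ℝ, 0 < C ∧ ∀ t : ℝ,
    ‖Complex.Gamma (1 + k + t * I)‖ * Real.exp (Real.pi * |t| / 2)
      ≤ C * (1 + |t|) ^ (k + 1 / 2 : ℝ) := by
  induction k with
  | zero =>
    refine ⟨Real.exp (Real.pi / 2) + 4, by positivity, fun t => ?_⟩
    have hp : 0 < 1 + |t| := by positivity
    have hone : (1:ℝ) ≤ (1 + |t|) ^ (1 / 2 : ℝ) :=
      Real.one_le_rpow (by linarith [abs_nonneg t]) (by norm_num)
    simp only [Nat.cast_zero, add_zero, zero_add]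
    rcases le_total |t| 1 with h | h
    · have h1 : ‖Complex.Gamma (1 + t * I)‖ ≤ 1 := by
        have := norm_Gamma_le_Gamma_re (s := 1 + t * I) (by simp)
        simpa using this
      have h2 : Real.exp (Real.pi * |t| / 2) ≤ Real.exp (Real.pi / 2) := by
        apply Real.exp_le_exp.2
        have := Real.pi_pos
        nlinarith
      calc _ ≤ 1 * Real.exp (Real.pi / 2) := by gcongr
        _ ≤ (Real.exp (Real.pi / 2) + 4) * 1 := by linarith
        _ ≤ _ := by gcongr
    · have ht0 : t ≠ 0 := by
        rintro rfl
        simp at h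
        linarith
      have hsq := norm_Gamma_one_add_mul_I_sq ht0
      have habs : Real.pi * t / Real.sinh (Real.pi * t)
          = Real.pi * |t| / Real.sinh (Real.pi * |t|) := by
        rcases abs_cases t with ⟨e, _⟩ | ⟨e, _⟩ <;> rw [e]
        rw [mul_neg, Real.sinh_neg, neg_div_neg_eq]
      rw [habs] at hsq
      set x := Real.pi * |t| with hx
      have hx3 : 3 < x := by
        have := Real.pi_gt_three
        nlinarith
      have hsinh : Real.exp x / 4 ≤ Real.sinh x := by
        rw [Real.sinh_eq]
        have h1 : Real.exp (-x) ≤ 1 := Real.exp_le_one_iff.2 (by linarith)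
        have h2 : 1 + x ≤ Real.exp x := by linarith [Real.add_one_le_exp x]
        linarith
      have hle : (‖Complex.Gamma (1 + t * I)‖ * Real.exp (x / 2)) ^ 2 ≤ 16 * (1 + |t|) := by
        rw [mul_pow, hsq, ← Real.exp_nat_mul, show ((2:ℕ):ℝ) * (x / 2) = x by push_cast; ring,
          div_mul_eq_mul_div, div_le_iff₀ (by positivity)]
        have h4 : Real.pi ≤ 4 := Real.pi_le_four
        have h5 : x ≤ 4 * (1 + |t|) := by rw [hx]; nlinarith [abs_nonneg t]
        have h6 : 0 < Real.exp x := Real.exp_pos x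
        nlinarith [mul_le_mul_of_nonneg_right h5 h6.le,
          mul_le_mul_of_nonneg_left hsinh (show 0 ≤ 16 * (1 + |t|) by positivity)]
      have h7 : ‖Complex.Gamma (1 + t * I)‖ * Real.exp (x / 2) ≤ 4 * (1 + |t|) ^ (1 / 2 : ℝ) := by
        refine (sq_le_sq₀ (by positivity) (by positivity)).1 (hle.trans (le_of_eq ?_))
        rw [mul_pow, ← Real.rpow_natCast ((1 + |t|) ^ (1 / 2 : ℝ)) 2, ← Real.rpow_mul hp.le]
        norm_num
      calc _ ≤ 4 * (1 + |t|) ^ (1 / 2 : ℝ) := h7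
        _ ≤ _ := by
          gcongr
          linarith [Real.exp_pos (Real.pi / 2)]
  | succ k ih =>
    obtain ⟨C, hC, h⟩ := ih
    refine ⟨(1 + k) * C, by positivity, fun t => ?_⟩
    have hp : 0 < 1 + |t| := by positivity
    have hne : (1 + k + t * I : ℂ) ≠ 0 := by
      intro h0
      have := congrArg Complex.re h0
      simp at this
      have : (0:ℝ) ≤ k := Nat.cast_nonneg k
      linarith
    have e : (1 + ((k + 1 : ℕ) : ℂ) + t * I) = (1 + k + t * I) + 1 := by push_cast; ring
    rw [e, Complex.Gamma_add_one _ hne, norm_mul]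
    have hn : ‖(1 + k + t * I : ℂ)‖ ≤ (1 + k) * (1 + |t|) := by
      calc ‖(1 + k + t * I : ℂ)‖ ≤ ‖(1 + k : ℂ)‖ + ‖(t * I : ℂ)‖ := norm_add_le _ _
        _ = (1 + k) + |t| := by
          congr 1
          · have : (1 + k : ℂ) = ((1 + k : ℕ) : ℂ) := by push_cast; ring
            rw [this, Complex.norm_natCast]; push_cast; ring
          · simp
        _ ≤ _ := by nlinarith [abs_nonneg t, (Nat.cast_nonneg k : (0:ℝ) ≤ k)]
    calc _ = ‖(1 + k + t * I : ℂ)‖ *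
          (‖Complex.Gamma (1 + k + t * I)‖ * Real.exp (Real.pi * |t| / 2)) := by ring
      _ ≤ ((1 + k) * (1 + |t|)) * (C * (1 + |t|) ^ (k + 1 / 2 : ℝ)) := by
        exact mul_le_mul hn (h t) (by positivity) (by positivity)
      _ = (1 + k) * C * ((1 + |t|) ^ (k + 1 / 2 : ℝ) * (1 + |t|) ^ (1:ℝ)) := by
        rw [Real.rpow_one]; ring
      _ = _ := by
        rw [← Real.rpow_add hp]
        congr 2
        push_cast
        ring

theorem exists_norm_LFunction_le_of_one_lt_re {N : ℕ} [NeZero N] (Φ : ZMod N → ℂ) {σ : ℝ}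
    (hσ : 1 < σ) : ∃ C : ℝ, 0 < C ∧ ∀ s : ℂ, σ ≤ s.re → ‖ZMod.LFunction Φ s‖ ≤ C := by
  have hsum := (ZMod.LSeriesSummable_of_one_lt_re Φ (s := (σ:ℂ)) (by simpa using hσ)).norm
  refine ⟨∑' n, ‖LSeries.term (Φ ·) σ n‖ + 1, by positivity, fun s hs => ?_⟩
  rw [ZMod.LFunction_eq_LSeries Φ (hσ.trans_le hs), LSeries]
  have hle : ∀ n, ‖LSeries.term (Φ ·) s n‖ ≤ ‖LSeries.term (Φ ·) σ n‖ :=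
    fun n => LSeries.norm_term_le_of_re_le_re _ (by simpa using hs) n
  have := tsum_of_norm_bounded hsum.hasSum hle
  linarith

/-- The functional equation bounds an L-function to the left by one to the right. -/
theorem norm_LFunction_one_sub_le {N : ℕ} [NeZero N] (Φ : ZMod N → ℂ) (hΦ : Φ 0 = 0) {w : ℂ}
    (hw : 0 < w.re) :
    ‖ZMod.LFunction Φ (1 - w)‖ ≤ (N:ℝ) ^ (w.re - 1) * (2 * Real.pi) ^ (-w.re) *
      (‖Complex.Gamma w‖ * Real.exp (Real.pi * |w.im| / 2)) *
        (‖ZMod.LFunction (ZMod.dft Φ) w‖ + ‖ZMod.LFunction (ZMod.dft fun x => Φ (-x)) w‖) := by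
  have hN : 0 < N := NeZero.pos N
  have hpi := Real.pi_pos
  rw [ZMod.LFunction_one_sub Φ (s := w) (by
    rintro n rfl
    simp at hw
    linarith [(Nat.cast_nonneg n : (0:ℝ) ≤ n)]) (Or.inl hΦ)]
  have e1 : ‖(N:ℂ) ^ (w - 1)‖ = (N:ℝ) ^ (w.re - 1) := by
    rw [Complex.norm_natCast_cpow_of_pos hN]; simp
  have e2 : ‖(2 * Real.pi : ℂ) ^ (-w)‖ = (2 * Real.pi) ^ (-w.re) := by
    have : (2 * Real.pi : ℂ) = ((2 * Real.pi : ℝ) : ℂ) := by push_cast; ring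
    rw [this, Complex.norm_cpow_eq_rpow_re_of_pos (by positivity)]; simp
  have him : ∀ x : ℝ, x * w.im ≤ |x| * |w.im| := fun x => by
    rw [← abs_mul]; exact le_abs_self _
  have e3 : ‖cexp (Real.pi * I * w / 2)‖ ≤ Real.exp (Real.pi * |w.im| / 2) := by
    rw [Complex.norm_exp]
    apply Real.exp_le_exp.2
    have : (Real.pi * I * w / 2 : ℂ).re = -Real.pi * w.im / 2 := by simp
    rw [this]
    have := him (-Real.pi)
    rw [abs_neg, abs_of_pos hpi] at this
    linarith
  have e4 : ‖cexp (-Real.pi * I * w / 2)‖ ≤ Real.exp (Real.pi * |w.im| / 2) := by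
    rw [Complex.norm_exp]
    apply Real.exp_le_exp.2
    have : (-Real.pi * I * w / 2 : ℂ).re = Real.pi * w.im / 2 := by simp
    rw [this]
    have := him Real.pi
    rw [abs_of_pos hpi] at this
    linarith
  rw [norm_mul, norm_mul, norm_mul, e1, e2]
  calc _ ≤ (N:ℝ) ^ (w.re - 1) * (2 * Real.pi) ^ (-w.re) * ‖Complex.Gamma w‖ *
      (Real.exp (Real.pi * |w.im| / 2) * ‖ZMod.LFunction (ZMod.dft Φ) w‖ +
        Real.exp (Real.pi * |w.im| / 2) * ‖ZMod.LFunction (ZMod.dft fun x => Φ (-x)) w‖) := by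
        refine mul_le_mul_of_nonneg_left ?_ (by positivity)
        refine (norm_add_le _ _).trans ?_
        rw [norm_mul, norm_mul]
        gcongr
    _ = _ := by ring

theorem exists_norm_LFunction_exp_growth {N : ℕ} [NeZero N] {Φ : ZMod N → ℂ} (hΦ : Φ 0 = 0)
    (hΦs : ∑ j, Φ j = 0) (a b : ℝ) : ∃ K : ℝ, ∀ s : ℂ, a ≤ s.re → s.re ≤ b →
      ‖ZMod.LFunction Φ s‖ ≤ K * Real.exp (4 * |s.im|) := by
  obtain ⟨C1, hC1, h1⟩ := exists_norm_LFunction_le_of_sum_zero hΦs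
  have hdft : ∀ Ψ : ZMod N → ℂ, Ψ 0 = 0 → ∑ j, ZMod.dft Ψ j = 0 := by
    intro Ψ hΨ
    have := ZMod.dft_apply_zero (ZMod.dft Ψ)
    rw [ZMod.dft_dft] at this
    simp [hΨ] at this
    exact this.symm
  obtain ⟨C2, hC2, h2⟩ := exists_norm_LFunction_le_of_sum_zero (hdft Φ hΦ)
  obtain ⟨C3, hC3, h3⟩ := exists_norm_LFunction_le_of_sum_zero
    (hdft (fun x => Φ (-x)) (by simpa using hΦ))
  have hpi := Real.pi_pos
  have hNp : 0 < (N:ℝ) := by exact_mod_cast NeZero.pos N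
  have hcont : ContinuousOn (fun x : ℝ => (N:ℝ) ^ (x - 1) * (2 * Real.pi) ^ (-x) * Real.Gamma x)
      (Set.Icc (1 / 2) (1 - a)) := by
    intro x hx
    have hx0 : 0 < x := by linarith [hx.1]
    refine ContinuousAt.continuousWithinAt ?_
    refine ContinuousAt.mul (ContinuousAt.mul ?_ ?_) ?_
    · exact ContinuousAt.rpow (by fun_prop) (by fun_prop) (Or.inl hNp.ne')
    · exact ContinuousAt.rpow (by fun_prop) (by fun_prop) (Or.inl (by positivity))
    · refine (Real.differentiableAt_Gamma ?_).continuousAt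
      intro m hm
      have : (0:ℝ) ≤ m := Nat.cast_nonneg m
      linarith
  obtain ⟨C4, hC4⟩ := isCompact_Icc.exists_bound_of_continuousOn hcont
  set A := |a| + |b| + 2 with hA
  have hlin : ∀ s : ℂ, |s.re| ≤ A → ‖s‖ ≤ A * Real.exp |s.im| := by
    intro s hs
    have h5 : 1 + |s.im| ≤ Real.exp |s.im| := by linarith [Real.add_one_le_exp |s.im|]
    have hA2 : 2 ≤ A := by rw [hA]; linarith [abs_nonneg a, abs_nonneg b]
    calc ‖s‖ ≤ |s.re| + |s.im| := Complex.norm_le_abs_re_add_abs_im s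
      _ ≤ A * (1 + |s.im|) := by nlinarith [abs_nonneg s.im]
      _ ≤ _ := by gcongr
  have hA0 : 0 < A := by positivity
  refine ⟨C1 * A + |C4| * (C2 * A + C3 * A), fun s hsa hsb => ?_⟩
  have hexp : Real.exp |s.im| ≤ Real.exp (4 * |s.im|) :=
    Real.exp_le_exp.2 (by linarith [abs_nonneg s.im])
  have hae := abs_nonneg a
  have hbe := abs_nonneg b
  rcases le_total (1 / 2) s.re with hr | hr
  · have : |s.re| ≤ A := by
      rw [abs_le]; constructor <;> linarith [neg_abs_le a, le_abs_self b]
    calc ‖ZMod.LFunction Φ s‖ ≤ C1 * ‖s‖ := h1 s hr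
      _ ≤ C1 * (A * Real.exp (4 * |s.im|)) := by
        gcongr
        exact (hlin s this).trans (by gcongr)
      _ = (C1 * A + 0) * Real.exp (4 * |s.im|) := by ring
      _ ≤ _ := by gcongr; positivity
  · set w := 1 - s with hw
    have hwre : w.re = 1 - s.re := by simp [hw]
    have hwim : |w.im| = |s.im| := by simp [hw]
    have hw1 : 1 / 2 ≤ w.re := by rw [hwre]; linarith
    have hwA : |w.re| ≤ A := by
      rw [hwre, abs_le]; constructor <;> linarith [neg_abs_le a, le_abs_self b]
    have hs : s = 1 - w := by rw [hw]; ring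
    have hfe := norm_LFunction_one_sub_le Φ hΦ (w := w) (by linarith)
    rw [← hs] at hfe
    have hG := norm_Gamma_le_Gamma_re (s := w) (by linarith)
    have h4 := hC4 w.re ⟨hw1, by rw [hwre]; linarith⟩
    have hwn := hlin w hwA
    rw [hwim] at hwn hfe
    calc _ ≤ _ := hfe
      _ = ((N:ℝ) ^ (w.re - 1) * (2 * Real.pi) ^ (-w.re) * ‖Complex.Gamma w‖) *
          Real.exp (Real.pi * |s.im| / 2) *
        (‖ZMod.LFunction (ZMod.dft Φ) w‖ + ‖ZMod.LFunction (ZMod.dft fun x => Φ (-x)) w‖) := by ring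
      _ ≤ |C4| * Real.exp (2 * |s.im|) *
          (C2 * (A * Real.exp |s.im|) + C3 * (A * Real.exp |s.im|)) := by
        refine mul_le_mul (mul_le_mul ?_ ?_ (by positivity) (by positivity)) (add_le_add ?_ ?_)
          (by positivity) (by positivity)
        · refine le_trans ?_ (h4.trans (le_abs_self _))
          refine le_trans ?_ (Real.le_norm_self _)
          gcongr
        · apply Real.exp_le_exp.2
          nlinarith [Real.pi_le_four, abs_nonneg s.im]
        · exact (h2 w hw1).trans (by gcongr)
        · exact (h3 w hw1).trans (by gcongr)
      _ = |C4| * (C2 * A + C3 * A) * (Real.exp (2 * |s.im|) * Real.exp |s.im|) := by ring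
      _ ≤ |C4| * (C2 * A + C3 * A) * Real.exp (4 * |s.im|) := by
        rw [← Real.exp_add]
        refine mul_le_mul_of_nonneg_left (Real.exp_le_exp.2 ?_) (by positivity)
        linarith [abs_nonneg s.im]
      _ ≤ _ := by
        gcongr
        linarith [mul_pos hC1 hA0]

/-- The convexity bound interpolating between an absolutely convergent line on the right and its
reflection on the left. -/
theorem exists_norm_LFunction_convexity {N : ℕ} [NeZero N] {Φ : ZMod N → ℂ} (hΦ : Φ 0 = 0)
    (hΦs : ∑ j, Φ j = 0) {k : ℕ} (hk : 1 ≤ k) {σ : ℝ} (hσ : 1 < σ) :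
    ∃ C : ℝ, 0 < C ∧ ∀ s : ℂ, -(k:ℝ) ≤ s.re → s.re ≤ σ →
      ‖ZMod.LFunction Φ s‖ ≤
        C * (1 + |s.im|) ^ ((k + 1 / 2 : ℝ) * (1 - (s.re + k) / (σ + k))) := by
  obtain ⟨C1, hC1, h1⟩ := exists_norm_LFunction_le_of_one_lt_re Φ hσ
  have hk1 : (1:ℝ) ≤ k := by exact_mod_cast hk
  obtain ⟨C2, hC2, h2⟩ := exists_norm_LFunction_le_of_one_lt_re (ZMod.dft Φ) (one_lt_two)
  obtain ⟨C3, hC3, h3⟩ := exists_norm_LFunction_le_of_one_lt_re (ZMod.dft fun x => Φ (-x))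
    (one_lt_two)
  obtain ⟨C4, hC4, h4⟩ := exists_norm_Gamma_vertical_le k
  obtain ⟨K, hK⟩ := exists_norm_LFunction_exp_growth hΦ hΦs (-k) σ
  have hNp : 0 < (N:ℝ) := by exact_mod_cast NeZero.pos N
  have hpi := Real.pi_pos
  set D := (N:ℝ) ^ ((1 + k : ℝ) - 1) * (2 * Real.pi) ^ (-(1 + k : ℝ)) with hD
  have hD0 : 0 < D := by positivity
  have hleft : ∀ s : ℂ, s.re = -(k:ℝ) →
      ‖ZMod.LFunction Φ s‖ ≤ D * C4 * (C2 + C3) * (1 + |s.im|) ^ (k + 1 / 2 : ℝ) := by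
    intro s hs
    set w := 1 - s with hw
    have hwre : w.re = 1 + k := by simp [hw, hs]
    have hwim : |w.im| = |s.im| := by simp [hw]
    have hsw : s = 1 - w := by rw [hw]; ring
    have hw2 : 2 ≤ w.re := by rw [hwre]; linarith
    have hfe := norm_LFunction_one_sub_le Φ hΦ (w := w) (by linarith)
    have hweq : (1 + k + w.im * I : ℂ) = w := by
      apply Complex.ext <;> simp [hwre]
    have hg := h4 w.im
    rw [hweq] at hg
    rw [hwim] at hg hfe
    rw [← hsw, hwre] at hfe
    calc _ ≤ _ := hfe
      _ ≤ D * (C4 * (1 + |s.im|) ^ (k + 1 / 2 : ℝ)) * (C2 + C3) := by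
        refine mul_le_mul (mul_le_mul_of_nonneg_left hg hD0.le)
          (add_le_add (h2 w hw2) (h3 w hw2)) (by positivity) (by positivity)
      _ = _ := by ring
  obtain ⟨C, hC, h⟩ := polynomial_growth_interpolation (f := ZMod.LFunction Φ)
    (a := -(k:ℝ)) (b := σ) (A := D * C4 * (C2 + C3)) (B := C1) (α := k + 1 / 2) (β := 0) (K := K)
    (c := 4) (by linarith) (ZMod.differentiable_LFunction_of_sum_zero hΦs) (by positivity) le_rfl
    hK hleft (fun s hs => by simpa using h1 s hs.ge)
  refine ⟨C, hC, fun s hs1 hs2 => (h s hs1 hs2).trans (le_of_eq ?_)⟩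
  simp [sub_neg_eq_add]

theorem LFunction_ne_zero_of_GRH {N : ℕ} [NeZero N] {χ : DirichletCharacter ℂ N} (h : GRH χ) {s : ℂ}
    (hs : 1 / 2 < s.re) (hs1 : χ ≠ 1 ∨ s ≠ 1) : χ.LFunction s ≠ 0 := by
  intro h0
  rcases lt_or_ge s.re 1 with h1 | h1
  · have hL : LVal χ s = 0 := by
      rw [LVal, dif_neg (NeZero.ne N)]; exact h0
    have := h s (by linarith) h1 hL
    linarith
  · exact χ.LFunction_ne_zero_of_one_le_re hs1 h1 h0

theorem exists_le_norm_LFunction_of_one_lt_re {N : ℕ} [NeZero N] (χ : DirichletCharacter ℂ N) {σ : ℝ}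
    (hσ : 1 < σ) : ∃ c : ℝ, 0 < c ∧ ∀ s : ℂ, σ ≤ s.re → c ≤ ‖χ.LFunction s‖ := by
  have hmu : ∀ s : ℂ, 1 < s.re → LSeriesSummable
      ((fun n : ℕ => χ n) * (fun n : ℕ => (ArithmeticFunction.moebius n : ℂ))) s := fun s hs =>
    DirichletCharacter.LSeriesSummable_mul χ
      (ArithmeticFunction.LSeriesSummable_moebius_iff.mpr hs)
  have hsum := (hmu σ (by simpa using hσ)).norm
  set g : ℕ → ℂ := (fun n : ℕ => χ n) * (fun n : ℕ => (ArithmeticFunction.moebius n : ℂ)) with hg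
  set B := ∑' n, ‖LSeries.term g σ n‖ + 1 with hB
  have hB0 : 0 < B := by positivity
  refine ⟨B⁻¹, by positivity, fun s hs => ?_⟩
  have hs1 : 1 < s.re := hσ.trans_le hs
  have hle : ∀ n, ‖LSeries.term g s n‖ ≤ ‖LSeries.term g σ n‖ :=
    fun n => LSeries.norm_term_le_of_re_le_re _ (by simpa using hs) n
  have h1 : ‖LSeries g s‖ ≤ B := by
    have := tsum_of_norm_bounded hsum.hasSum hle
    rw [LSeries]
    linarith
  have h2 := DirichletCharacter.LSeries.mul_mu_eq_one χ hs1
  rw [← DirichletCharacter.LFunction_eq_LSeries χ hs1] at h2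
  have h3 := congrArg norm h2
  rw [norm_mul, norm_one] at h3
  rw [inv_le_iff_one_le_mul₀ hB0, ← h3]
  exact mul_le_mul_of_nonneg_left h1 (norm_nonneg _)

theorem log_add_three_pos (t : ℝ) : 1 ≤ Real.log (|t| + 3) := by
  rw [Real.le_log_iff_exp_le (by positivity)]
  have := Real.exp_one_lt_d9
  linarith [abs_nonneg t]

/-- Under GRH the logarithmic derivative grows at most logarithmically on `1 ≤ re s ≤ 3`. -/
theorem exists_norm_logDeriv_LFunction_le {N : ℕ} [NeZero N] {χ : DirichletCharacter ℂ N}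
    (h : GRH χ) : ∃ C : ℝ, 0 < C ∧ ∀ s : ℂ, 1 ≤ s.re → s.re ≤ 3 → 2 ≤ |s.im| →
      ‖logDeriv χ.LFunction s‖ ≤ C * Real.log (|s.im| + 3) := by
  obtain ⟨C1, hC1, h1⟩ := exists_norm_LFunctionRegularized_le (fun j => χ j)
  obtain ⟨c, hc, h2⟩ := exists_le_norm_LFunction_of_one_lt_re χ one_lt_two
  obtain ⟨C3, hC3, h3⟩ := exists_norm_logDeriv_le_of_ne_zero (r := 7 / 6) (R := 4 / 3)
    (by norm_num) (by norm_num)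
  set P := LFunctionRegularized (fun j => χ j) with hP
  have hPne : ∀ z : ℂ, z ≠ 1 → P z = (z - 1) * χ.LFunction z := by
    intro z hz
    rw [hP, LFunctionRegularized, Function.update_of_ne hz]; rfl
  refine ⟨C3 * (|Real.log (C1 * 36 / c)| + 3) + 1, by positivity, ?_⟩
  intro s hs1 hs3 hst
  have hlog1 := log_add_three_pos s.im
  set T := s.im with hT
  set z0 : ℂ := 2 + T * I with hz0
  have hmem : ∀ z ∈ Metric.ball z0 (4 / 3), 1 / 2 < z.re ∧ z ≠ 1 ∧ ‖z‖ ≤ |T| + 4 := by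
    intro z hz
    have hz : ‖z - z0‖ < 4 / 3 := by simpa [dist_eq_norm] using hz
    have e1 := (Complex.abs_re_le_norm (z - z0)).trans hz.le
    have e2 := (Complex.abs_im_le_norm (z - z0)).trans hz.le
    simp [hz0] at e1 e2
    refine ⟨by linarith [(abs_le.1 e1).1], ?_, ?_⟩
    · rintro rfl
      simp at e2
      linarith
    · have : ‖z0‖ ≤ 2 + |T| := by
        refine (norm_add_le _ _).trans ?_
        simp
      have h4 : ‖z‖ ≤ ‖z - z0‖ + ‖z0‖ := by simpa using norm_add_le (z - z0) z0
      linarith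
  have hb := h3 P z0 (C1 * (1 + (|T| + 4)) ^ 2) c
    (differentiable_LFunctionRegularized _).differentiableOn ?_ ?_ hc ?_ s ?_
  · have hs1' : s ≠ 1 := by
      rintro rfl
      simp at hT
      rw [hT] at hst
      simp at hst
      linarith
    have hdL : DifferentiableAt ℂ χ.LFunction s := χ.differentiableAt_LFunction s (Or.inl hs1')
    have hL0 := LFunction_ne_zero_of_GRH h (s := s) (by linarith) (Or.inr hs1')
    have hlogd : logDeriv P s = (s - 1)⁻¹ + logDeriv χ.LFunction s := by
      have hev : P =ᶠ[nhds s] fun z => (z - 1) * χ.LFunction z := by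
        filter_upwards [isOpen_compl_singleton.mem_nhds hs1'] with z hz using hPne z hz
      rw [logDeriv_apply, hev.deriv_eq, hev.eq_of_nhds, ← logDeriv_apply,
        logDeriv_mul (f := fun z => z - 1) s (sub_ne_zero.2 hs1') hL0 (by fun_prop) hdL]
      simp [logDeriv_apply]
    have hinv : ‖(s - 1)⁻¹‖ ≤ 1 := by
      rw [norm_inv]
      apply inv_le_one_of_one_le₀
      have := Complex.abs_im_le_norm (s - 1)
      simp at this
      linarith
    have e : logDeriv χ.LFunction s = logDeriv P s - (s - 1)⁻¹ := by rw [hlogd]; ring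
    rw [e]
    refine (norm_sub_le _ _).trans ?_
    have hMb : Real.log (C1 * (1 + (|T| + 4)) ^ 2 / c) ≤ |Real.log (C1 * 36 / c)| +
        2 * Real.log (|T| + 3) := by
      have : C1 * (1 + (|T| + 4)) ^ 2 / c ≤ (C1 * 36 / c) * (|T| + 3) ^ 2 := by
        rw [div_mul_eq_mul_div, mul_assoc]
        gcongr
        nlinarith [abs_nonneg T]
      calc _ ≤ Real.log ((C1 * 36 / c) * (|T| + 3) ^ 2) := Real.log_le_log (by positivity) this
        _ = Real.log (C1 * 36 / c) + 2 * Real.log (|T| + 3) := by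
          rw [Real.log_mul (by positivity) (by positivity), Real.log_pow]; push_cast; ring
        _ ≤ _ := by gcongr; exact le_abs_self _
    have hA := abs_nonneg (Real.log (C1 * 36 / c))
    calc _ ≤ C3 * (|Real.log (C1 * 36 / c)| + 2 * Real.log (|T| + 3) + 1) + 1 := by
          refine add_le_add (hb.trans ?_) hinv
          gcongr
      _ ≤ C3 * ((|Real.log (C1 * 36 / c)| + 3) * Real.log (|T| + 3)) + 1 * Real.log (|T| + 3) := by
          gcongr ?_ * ?_ + ?_
          · nlinarith
          · linarith
      _ = _ := by ring
  · intro z hz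
    obtain ⟨m1, m2, _⟩ := hmem z hz
    rw [hPne z m2]
    exact mul_ne_zero (sub_ne_zero.2 m2) (LFunction_ne_zero_of_GRH h m1 (Or.inr m2))
  · intro z hz
    obtain ⟨m1, m2, m3⟩ := hmem z hz
    exact (h1 z m1.le).trans (by gcongr)
  · have hz01 : z0 ≠ 1 := by
      intro h0
      have := congrArg Complex.re h0
      simp [hz0] at this
    rw [hPne z0 hz01, norm_mul]
    have e1 : (1:ℝ) ≤ ‖z0 - 1‖ := by
      have := Complex.abs_re_le_norm (z0 - 1)
      simp [hz0] at this
      norm_num at this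
      simpa [hz0] using this
    have e2 := h2 z0 (by simp [hz0])
    nlinarith [norm_nonneg (χ.LFunction z0)]
  · have : s - z0 = ((s.re - 2 : ℝ) : ℂ) := by
      apply Complex.ext <;> simp [hz0, hT]
    rw [Metric.mem_closedBall, dist_eq_norm, this, Complex.norm_real, Real.norm_eq_abs, abs_le]
    constructor <;> linarith

/-- Under GRH an L-function and its inverse are of size `|t|^ε` on `1 ≤ re s ≤ 2`. -/
theorem exists_norm_LFunction_le_rpow {N : ℕ} [NeZero N] {χ : DirichletCharacter ℂ N}
    (h : GRH χ) {ε : ℝ} (hε : 0 < ε) :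
    ∃ C : ℝ, 0 < C ∧ ∀ s : ℂ, 1 ≤ s.re → s.re ≤ 2 → 2 ≤ |s.im| →
      ‖χ.LFunction s‖ ≤ C * (|s.im| + 3) ^ ε ∧ ‖χ.LFunction s‖⁻¹ ≤ C * (|s.im| + 3) ^ ε := by
  obtain ⟨C1, hC1, h1⟩ := exists_norm_logDeriv_LFunction_le h
  set η := min 1 (ε / C1) with hη
  have hη0 : 0 < η := by positivity
  have hη1 : η ≤ 1 := min_le_left _ _
  have hηε : C1 * η ≤ ε := by
    have : η ≤ ε / C1 := min_le_right _ _
    rw [le_div_iff₀ hC1] at this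
    linarith
  obtain ⟨c, hc, h2⟩ := exists_le_norm_LFunction_of_one_lt_re χ (σ := 1 + η) (by linarith)
  obtain ⟨C2, hC2, h3⟩ := exists_norm_LFunction_le_of_one_lt_re (fun j => χ j) (σ := 1 + η)
    (by linarith)
  refine ⟨C2 + c⁻¹, by positivity, fun s hs1 hs2 hst => ?_⟩
  have hlog1 := log_add_three_pos s.im
  set K := C1 * Real.log (|s.im| + 3) with hK
  have hpos : 0 < |s.im| + 3 := by positivity
  have hexp : Real.exp (K * η) ≤ (|s.im| + 3) ^ ε := by
    rw [Real.rpow_def_of_pos hpos]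
    apply Real.exp_le_exp.2
    rw [hK]
    nlinarith
  have hs1' : ∀ x : ℝ, s + x ≠ 1 := by
    intro x h0
    have := congrArg Complex.im h0
    simp at this
    rw [this] at hst
    simp at hst
    linarith
  have hder : ∀ x : ℝ, 0 ≤ x → HasDerivAt (fun x : ℝ => χ.LFunction (s + x))
      (deriv χ.LFunction (s + x)) x := by
    intro x hx
    have hd := (χ.differentiableAt_LFunction (s + x) (Or.inl (hs1' x))).hasDerivAt
    have := (hd.comp_const_add s (x:ℂ)).comp_ofReal
    exact this
  have hbd : ∀ x : ℝ, 0 ≤ x → x ≤ η →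
      ‖deriv χ.LFunction (s + x)‖ ≤ K * ‖χ.LFunction (s + x)‖ := by
    intro x hx0 hx1
    have hb := h1 (s + x) (by simp; linarith) (by simp; linarith) (by simpa using hst)
    have hL0 := LFunction_ne_zero_of_GRH h (s := s + x) (by simp; linarith) (Or.inr (hs1' x))
    rw [logDeriv_apply, norm_div, div_le_iff₀ (norm_pos_iff.2 hL0)] at hb
    simpa [hK] using hb
  have up : ‖χ.LFunction (s + η)‖ ≤ ‖χ.LFunction s‖ * Real.exp (K * η) := by
    have := norm_le_gronwallBound_of_norm_deriv_right_le (f := fun x : ℝ => χ.LFunction (s + x))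
      (f' := fun x : ℝ => deriv χ.LFunction (s + x)) (δ := ‖χ.LFunction s‖) (K := K) (ε := 0)
      (a := 0) (b := η) (fun x hx => (hder x hx.1).continuousAt.continuousWithinAt)
      (fun x hx => (hder x hx.1).hasDerivWithinAt) (by simp)
      (fun x hx => by simpa using hbd x hx.1 hx.2.le) η ⟨hη0.le, le_rfl⟩
    simpa [gronwallBound_ε0] using this
  have down : ‖χ.LFunction s‖ ≤ ‖χ.LFunction (s + η)‖ * Real.exp (K * η) := by
    have hder' : ∀ x : ℝ, x ≤ η → HasDerivAt (fun x : ℝ => χ.LFunction (s + (η - x : ℝ)))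
        (-deriv χ.LFunction (s + (η - x : ℝ))) x := by
      intro x hx
      have h5 := (hder (η - x) (by linarith)).scomp x ((hasDerivAt_id x).const_sub η)
      simpa [Function.comp_def] using h5
    have := norm_le_gronwallBound_of_norm_deriv_right_le
      (f := fun x : ℝ => χ.LFunction (s + (η - x : ℝ)))
      (f' := fun x : ℝ => -deriv χ.LFunction (s + (η - x : ℝ)))
      (δ := ‖χ.LFunction (s + η)‖) (K := K) (ε := 0)
      (a := 0) (b := η) (fun x hx => (hder' x hx.2).continuousAt.continuousWithinAt)
      (fun x hx => (hder' x hx.2.le).hasDerivWithinAt) (by simp)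
      (fun x hx => by
        rw [norm_neg, add_zero]
        exact hbd (η - x) (by linarith [hx.2]) (by linarith [hx.1])) η ⟨hη0.le, le_rfl⟩
    simpa [gronwallBound_ε0] using this
  have hle : ‖χ.LFunction (s + η)‖ ≤ C2 := h3 (s + η) (by simp; linarith)
  have hge : c ≤ ‖χ.LFunction (s + η)‖ := h2 (s + η) (by simp; linarith)
  have hL0 : 0 < ‖χ.LFunction s‖ := norm_pos_iff.2
    (LFunction_ne_zero_of_GRH h (s := s) (by linarith) (Or.inr (by simpa using hs1' 0)))
  constructor
  · calc _ ≤ _ := down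
      _ ≤ C2 * (|s.im| + 3) ^ ε := by gcongr
      _ ≤ _ := by gcongr; linarith [inv_pos.2 hc]
  · calc ‖χ.LFunction s‖⁻¹ ≤ c⁻¹ * Real.exp (K * η) := by
          rw [inv_le_iff_one_le_mul₀ hL0, inv_mul_eq_div, div_mul_eq_mul_div, one_le_div hc]
          calc c ≤ _ := hge.trans up
            _ = _ := by ring
      _ ≤ c⁻¹ * (|s.im| + 3) ^ ε := by gcongr
      _ ≤ _ := by gcongr; linarith

lemma chiNeg4_natCast_of_mod_one {n : ℕ} (h : n % 4 = 1) : chiNeg4 (n : ZMod 4) = 1 := by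
  simp [chiNeg4, MulChar.ringHomComp_apply, ZMod.χ₄_nat_one_mod_four h]

lemma chiNeg4_natCast_of_mod_three {n : ℕ} (h : n % 4 = 3) : chiNeg4 (n : ZMod 4) = -1 := by
  simp [chiNeg4, MulChar.ringHomComp_apply, ZMod.χ₄_nat_three_mod_four h]

lemma chiNeg4_two : chiNeg4 ((2 : ℕ) : ZMod 4) = 0 := by
  have h : ZMod.χ₄ ((2 : ℕ) : ZMod 4) = 0 := by decide
  rw [chiNeg4, MulChar.ringHomComp_apply, h]; simp

lemma mulChiNeg4_natCast {q : ℕ} (χ : DirichletCharacter ℂ q) (n : ℕ) :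
    mulChiNeg4 χ (n : ZMod (4 * q)) = χ (n : ZMod q) * chiNeg4 (n : ZMod 4) := by
  by_cases h : IsUnit (n : ZMod (4 * q))
  · rw [mulChiNeg4, MulChar.mul_apply]
    obtain ⟨u, hu⟩ := h
    rw [← hu, DirichletCharacter.changeLevel_eq_cast_of_dvd,
      DirichletCharacter.changeLevel_eq_cast_of_dvd, hu, ZMod.cast_natCast (dvd_mul_left q 4),
      ZMod.cast_natCast (dvd_mul_right 4 q)]
  · rw [MulChar.map_nonunit _ h]
    rw [ZMod.isUnit_iff_coprime, Nat.coprime_mul_iff_right, not_and_or] at h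
    rcases h with h | h
    · rw [MulChar.map_nonunit chiNeg4 (by rwa [ZMod.isUnit_iff_coprime]), mul_zero]
    · rw [MulChar.map_nonunit χ (by rwa [ZMod.isUnit_iff_coprime]), zero_mul]

/-- All prime factors of `n ≠ 0` are congruent to `3` modulo `4`. -/
def OnlyThreeModFour (n : ℕ) : Prop := n ≠ 0 ∧ ∀ p : ℕ, p.Prime → p ∣ n → p % 4 = 3

lemma onlyThreeModFour_mul {m n : ℕ} :
    OnlyThreeModFour (m * n) ↔ OnlyThreeModFour m ∧ OnlyThreeModFour n := by
  constructor
  · rintro ⟨h, h'⟩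
    exact ⟨⟨left_ne_zero_of_mul h, fun p hp hd ↦ h' p hp (hd.mul_right _)⟩,
      ⟨right_ne_zero_of_mul h, fun p hp hd ↦ h' p hp (hd.mul_left _)⟩⟩
  · rintro ⟨⟨h1, h2⟩, ⟨h3, h4⟩⟩
    exact ⟨mul_ne_zero h1 h3, fun p hp hd ↦ (hp.dvd_mul.1 hd).elim (h2 p hp) (h4 p hp)⟩

lemma onlyThreeModFour_one : OnlyThreeModFour 1 :=
  ⟨one_ne_zero, fun _ hp h ↦ absurd (Nat.dvd_one.1 h) hp.one_lt.ne'⟩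

lemma onlyThreeModFour_prime {p : ℕ} (hp : p.Prime) : OnlyThreeModFour p ↔ p % 4 = 3 := by
  refine ⟨fun h ↦ h.2 p hp dvd_rfl, fun h ↦ ⟨hp.ne_zero, fun r hr hd ↦ ?_⟩⟩
  rw [(Nat.prime_dvd_prime_iff_eq hr hp).1 hd, h]

/-- The restriction of a character to the integers composed of primes congruent to `3` modulo
`4`. -/
def threeTwist {q : ℕ} (ξ : DirichletCharacter ℂ q) (n : ℕ) : ℂ :=
  if OnlyThreeModFour n then ξ (n : ZMod q) else 0

/-- The Dirichlet summand of `threeTwist`, as a multiplicative homomorphism. -/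
def threeSummandHom {q : ℕ} (ξ : DirichletCharacter ℂ q) {s : ℂ} (hs : s ≠ 0) : ℕ →*₀ ℂ where
  toFun n := threeTwist ξ n * (n : ℂ) ^ (-s)
  map_zero' := by simp [hs]
  map_one' := by simp [threeTwist, onlyThreeModFour_one]
  map_mul' m n := by
    have : threeTwist ξ (m * n) = threeTwist ξ m * threeTwist ξ n := by
      by_cases h1 : OnlyThreeModFour m <;> by_cases h2 : OnlyThreeModFour n <;>
        simp [threeTwist, onlyThreeModFour_mul, h1, h2]
    rw [this, Nat.cast_mul, Complex.natCast_mul_natCast_cpow]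
    ring

lemma norm_threeTwist_le {q : ℕ} (ξ : DirichletCharacter ℂ q) (n : ℕ) : ‖threeTwist ξ n‖ ≤ 1 := by
  unfold threeTwist; split_ifs
  · exact ξ.norm_le_one _
  · simp

/-- The Dirichlet series attached to `threeTwist ξ`. -/
def threeSeries {q : ℕ} (ξ : DirichletCharacter ℂ q) (s : ℂ) : ℂ := LSeries (threeTwist ξ) s

lemma summable_norm_threeSummandHom {q : ℕ} (ξ : DirichletCharacter ℂ q) {s : ℂ} (hs : 1 < s.re) :
    Summable (fun n : ℕ ↦ ‖threeSummandHom ξ (ne_zero_of_one_lt_re hs) n‖) := by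
  refine (summable_riemannZetaSummand hs).of_nonneg_of_le (fun _ ↦ by positivity) fun n ↦ ?_
  change ‖threeTwist ξ n * (n : ℂ) ^ (-s)‖ ≤ ‖(n : ℂ) ^ (-s)‖
  rw [norm_mul]
  exact mul_le_of_le_one_left (norm_nonneg _) (norm_threeTwist_le ξ n)

lemma tsum_threeSummandHom {q : ℕ} (ξ : DirichletCharacter ℂ q) {s : ℂ} (hs : 1 < s.re) :
    ∑' n : ℕ, threeSummandHom ξ (ne_zero_of_one_lt_re hs) n = threeSeries ξ s := by
  rw [threeSeries, LSeries]
  refine tsum_congr fun n ↦ ?_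
  rw [LSeries.term_of_ne_zero' (ne_zero_of_one_lt_re hs), div_eq_mul_inv, ← Complex.cpow_neg]
  rfl

lemma threeSeries_ne_zero {q : ℕ} (ξ : DirichletCharacter ℂ q) {s : ℂ} (hs : 1 < s.re) :
    threeSeries ξ s ≠ 0 := by
  rw [← tsum_threeSummandHom ξ hs,
    ← EulerProduct.exp_tsum_primes_log_eq_tsum (summable_norm_threeSummandHom ξ hs)]
  exact Complex.exp_ne_zero _

lemma abscissa_threeTwist_le {q : ℕ} (ξ : DirichletCharacter ℂ q) :
    LSeries.abscissaOfAbsConv (threeTwist ξ) ≤ 1 :=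
  LSeries.abscissaOfAbsConv_le_of_le_const ⟨1, fun n _ ↦ norm_threeTwist_le ξ n⟩

lemma differentiableOn_threeSeries {q : ℕ} (ξ : DirichletCharacter ℂ q) :
    DifferentiableOn ℂ (threeSeries ξ) {s | 1 < s.re} := by
  refine (LSeries_differentiableOn (threeTwist ξ)).mono fun s hs ↦ ?_
  exact lt_of_le_of_lt (abscissa_threeTwist_le ξ) (by exact_mod_cast hs)

lemma threeSeries_hasProd {q : ℕ} (ξ : DirichletCharacter ℂ q) {s : ℂ} (hs : 1 < s.re) :
    HasProd (fun p : Nat.Primes ↦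
      (1 - if (p : ℕ) % 4 = 3 then ξ ((p : ℕ) : ZMod q) * ((p : ℕ) : ℂ) ^ (-s) else 0)⁻¹)
      (threeSeries ξ s) := by
  rw [← tsum_threeSummandHom ξ hs]
  convert EulerProduct.eulerProduct_completely_multiplicative_hasProd
    (summable_norm_threeSummandHom ξ hs) using 1
  funext p
  congr 1
  change _ = 1 - threeTwist ξ p * ((p : ℕ) : ℂ) ^ (-s)
  rw [threeTwist, onlyThreeModFour_prime p.2]
  split_ifs <;> simp

lemma norm_character_mul_cpow_lt_one {q : ℕ} (ξ : DirichletCharacter ℂ q) {s : ℂ} (hs : 0 < s.re)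
    {p : ℕ} (hp : 1 < p) : ‖ξ (p : ZMod q) * (p : ℂ) ^ (-s)‖ < 1 := by
  rw [norm_mul, Complex.norm_natCast_cpow_of_pos (by omega)]
  calc _ ≤ 1 * (p : ℝ) ^ (-s).re := by gcongr; exact ξ.norm_le_one _
    _ < 1 := by
      rw [one_mul]
      exact Real.rpow_lt_one_of_one_lt_of_neg (by exact_mod_cast hp) (by simpa using hs)

lemma one_sub_ne_zero_of_norm_lt_one {z : ℂ} (h : ‖z‖ < 1) : 1 - z ≠ 0 := by
  intro h'
  rw [← sub_eq_zero.1 h'] at h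
  simp at h

lemma hasProd_two_factor (z : ℂ) :
    HasProd (fun p : Nat.Primes ↦ if (p : ℕ) = 2 then z else 1) z := by
  have h := hasProd_single (f := fun p : Nat.Primes ↦ if (p : ℕ) = 2 then z else 1)
    ⟨2, Nat.prime_two⟩ fun p hp ↦ if_neg fun h ↦ hp (Subtype.ext h)
  simpa using h

/-- The square of the series over integers composed of primes `3` modulo `4`. -/
lemma threeSeries_sq_mul {q : ℕ} (ξ : DirichletCharacter ℂ q) {s : ℂ} (hs : 1 < s.re) :
    threeSeries ξ s ^ 2 * LSeries (fun n : ℕ ↦ mulChiNeg4 ξ (n : ZMod (4 * q))) s =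
      LSeries (fun n : ℕ ↦ ξ (n : ZMod q)) s *
        (1 - ξ ((2 : ℕ) : ZMod q) * ((2 : ℕ) : ℂ) ^ (-s)) * threeSeries (ξ ^ 2) (2 * s) := by
  have h2 : 1 < (2 * s).re := by simp; linarith
  have A := threeSeries_hasProd ξ hs
  have B := DirichletCharacter.LSeries_eulerProduct_hasProd (mulChiNeg4 ξ) hs
  have C := DirichletCharacter.LSeries_eulerProduct_hasProd ξ hs
  have D := threeSeries_hasProd (ξ ^ 2) h2
  have E := hasProd_two_factor (1 - ξ ((2 : ℕ) : ZMod q) * ((2 : ℕ) : ℂ) ^ (-s))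
  have L := (A.mul A).mul B
  have R := (C.mul E).mul D
  rw [← sq] at L
  refine L.unique ?_
  convert R using 1
  funext p
  have hX := one_sub_ne_zero_of_norm_lt_one
    (norm_character_mul_cpow_lt_one ξ (by linarith : 0 < s.re) p.2.one_lt)
  have hX2 : (ξ ^ 2) ((p : ℕ) : ZMod q) * ((p : ℕ) : ℂ) ^ (-(2 * s)) =
      (ξ ((p : ℕ) : ZMod q) * ((p : ℕ) : ℂ) ^ (-s)) ^ 2 := by
    rw [MulChar.pow_apply' _ two_ne_zero, mul_pow, ← Complex.cpow_nat_mul]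
    congr 2; push_cast; ring
  have hX' : 1 + ξ ((p : ℕ) : ZMod q) * ((p : ℕ) : ℂ) ^ (-s) ≠ 0 := by
    rw [← sub_neg_eq_add]
    refine one_sub_ne_zero_of_norm_lt_one ?_
    rw [norm_neg]
    exact norm_character_mul_cpow_lt_one ξ (by linarith : 0 < s.re) p.2.one_lt
  rw [hX2, mulChiNeg4_natCast]
  rcases p.2.eq_two_or_odd with hp | hp
  · have h3 : ¬ ((p : ℕ) % 4 = 3) := by omega
    have hz : chiNeg4 ((p : ℕ) : ZMod 4) = 0 := by rw [hp]; exact chiNeg4_two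
    simp only [if_neg h3, hz, if_pos hp, mul_zero, zero_mul, sub_zero, inv_one, mul_one]
    rw [hp] at hX ⊢
    exact (inv_mul_cancel₀ hX).symm
  · have hp2 : ¬ ((p : ℕ) = 2) := by omega
    rcases (by omega : (p : ℕ) % 4 = 1 ∨ (p : ℕ) % 4 = 3) with h | h
    · have h3 : ¬ ((p : ℕ) % 4 = 3) := by omega
      simp [h3, hp2, chiNeg4_natCast_of_mod_one h]
    · simp only [h, if_true, hp2, if_false, chiNeg4_natCast_of_mod_three h, mul_one]
      set X := ξ ((p : ℕ) : ZMod q) * ((p : ℕ) : ℂ) ^ (-s)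
      have e1 : 1 - ξ ((p : ℕ) : ZMod q) * -1 * ((p : ℕ) : ℂ) ^ (-s) = 1 + X := by ring
      have e2 : (1 - X ^ 2) = (1 - X) * (1 + X) := by ring
      rw [e1, e2]
      field_simp

lemma isSum2Sq_iff {n : ℕ} :
    IsSum2Sq n ↔ ∀ p ∈ n.primeFactors, p % 4 = 3 → Even (padicValNat p n) :=
  Nat.eq_sq_add_sq_iff

lemma isSum2Sq_mul_of_coprime {m n : ℕ} (h : m.Coprime n) (hm : m ≠ 0) (hn : n ≠ 0) :
    IsSum2Sq (m * n) ↔ IsSum2Sq m ∧ IsSum2Sq n := by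
  simp only [isSum2Sq_iff]
  rw [h.primeFactors_mul]
  have key1 : ∀ p ∈ m.primeFactors, padicValNat p (m * n) = padicValNat p m := by
    intro p hp
    have hp' := Nat.prime_of_mem_primeFactors hp
    have : Fact p.Prime := ⟨hp'⟩
    rw [padicValNat.mul hm hn, padicValNat.eq_zero_of_not_dvd (n := n), add_zero]
    intro hd
    exact hp'.one_lt.ne' (Nat.eq_one_of_dvd_coprimes h (Nat.dvd_of_mem_primeFactors hp) hd)
  have key2 : ∀ p ∈ n.primeFactors, padicValNat p (m * n) = padicValNat p n := by
    intro p hp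
    have hp' := Nat.prime_of_mem_primeFactors hp
    have : Fact p.Prime := ⟨hp'⟩
    rw [padicValNat.mul hm hn, padicValNat.eq_zero_of_not_dvd (n := m), zero_add]
    intro hd
    exact hp'.one_lt.ne' (Nat.eq_one_of_dvd_coprimes h hd (Nat.dvd_of_mem_primeFactors hp))
  constructor
  · intro H
    refine ⟨fun p hp h3 ↦ ?_, fun p hp h3 ↦ ?_⟩
    · rw [← key1 p hp]; exact H p (Finset.mem_union_left _ hp) h3
    · rw [← key2 p hp]; exact H p (Finset.mem_union_right _ hp) h3
  · rintro ⟨H1, H2⟩ p hp h3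
    rcases Finset.mem_union.1 hp with hp | hp
    · rw [key1 p hp]; exact H1 p hp h3
    · rw [key2 p hp]; exact H2 p hp h3

lemma isSum2Sq_prime_pow {p : ℕ} (hp : p.Prime) (e : ℕ) :
    IsSum2Sq (p ^ e) ↔ (p % 4 = 3 → Even e) := by
  have : Fact p.Prime := ⟨hp⟩
  rw [isSum2Sq_iff]
  rcases Nat.eq_zero_or_pos e with rfl | he
  · simp
  · rw [Nat.primeFactors_prime_pow he.ne' hp]
    simp

lemma norm_STwist_le {q : ℕ} (χ : DirichletCharacter ℂ q) (n : ℕ) : ‖STwist χ n‖ ≤ 1 := by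
  unfold STwist; split_ifs
  · exact χ.norm_le_one _
  · simp

lemma LSeriesSummable_STwist {q : ℕ} (χ : DirichletCharacter ℂ q) {s : ℂ} (hs : 1 < s.re) :
    LSeriesSummable (STwist χ) s :=
  LSeriesSummable_of_bounded_of_one_lt_re (m := 1) (fun n _ ↦ norm_STwist_le χ n) hs

lemma differentiableOn_LSeries_STwist {q : ℕ} (χ : DirichletCharacter ℂ q) :
    DifferentiableOn ℂ (LSeries (STwist χ)) {s | 1 < s.re} := by
  refine (LSeries_differentiableOn (STwist χ)).mono fun s hs ↦ ?_
  exact lt_of_le_of_lt (LSeries.abscissaOfAbsConv_le_of_le_const ⟨1, fun n _ ↦ norm_STwist_le χ n⟩)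
    (by exact_mod_cast hs)

lemma LSeries_STwist_hasProd {q : ℕ} (χ : DirichletCharacter ℂ q) {s : ℂ} (hs : 1 < s.re) :
    HasProd (fun p : Nat.Primes ↦
      if (p : ℕ) % 4 = 3 then (1 - (χ ((p : ℕ) : ZMod q) * ((p : ℕ) : ℂ) ^ (-s)) ^ 2)⁻¹
      else (1 - χ ((p : ℕ) : ZMod q) * ((p : ℕ) : ℂ) ^ (-s))⁻¹) (LSeries (STwist χ) s) := by
  have hs0 := ne_zero_of_one_lt_re hs
  have hterm (n : ℕ) : LSeries.term (STwist χ) s n = STwist χ n * (n : ℂ) ^ (-s) := by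
    rw [LSeries.term_of_ne_zero' hs0, div_eq_mul_inv, ← Complex.cpow_neg]
  have hone : STwist χ 1 = 1 := by
    rw [STwist, if_pos ⟨1, 0, by norm_num⟩]; simp
  have hmul {m n : ℕ} (h : m.Coprime n) : LSeries.term (STwist χ) s (m * n) =
      LSeries.term (STwist χ) s m * LSeries.term (STwist χ) s n := by
    rcases eq_or_ne m 0 with rfl | hm
    · simp
    rcases eq_or_ne n 0 with rfl | hn
    · simp
    have : STwist χ (m * n) = STwist χ m * STwist χ n := by
      by_cases h1 : IsSum2Sq m <;> by_cases h2 : IsSum2Sq n <;>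
        simp [STwist, isSum2Sq_mul_of_coprime h hm hn, h1, h2]
    rw [hterm, hterm, hterm, this, Nat.cast_mul, Complex.natCast_mul_natCast_cpow]
    ring
  rw [LSeries]
  convert EulerProduct.eulerProduct_hasProd (f := LSeries.term (STwist χ) s)
    (by rw [hterm, hone]; simp) hmul (LSeriesSummable_STwist χ hs).norm (LSeries.term_zero _ _)
    using 1
  funext p
  set X := χ ((p : ℕ) : ZMod q) * ((p : ℕ) : ℂ) ^ (-s) with hX
  have hXl : ‖X‖ < 1 := norm_character_mul_cpow_lt_one χ (by linarith) p.2.one_lt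
  have hpow (e : ℕ) : LSeries.term (STwist χ) s ((p : ℕ) ^ e) =
      if ((p : ℕ) % 4 = 3 → Even e) then X ^ e else 0 := by
    rw [hterm, STwist, isSum2Sq_prime_pow p.2]
    split_ifs
    · rw [hX, mul_pow, Nat.cast_pow, map_pow, ← Complex.cpow_nat_mul, Nat.cast_pow,
        ← Complex.natCast_cpow_natCast_mul, mul_comm (e : ℂ)]
    · simp
  simp only [hpow]
  split_ifs with h3
  · have h2 : ‖X ^ 2‖ < 1 := by rw [norm_pow]; exact pow_lt_one₀ (norm_nonneg _) hXl two_ne_zero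
    have hs2 : HasSum (fun k : ℕ ↦ X ^ (2 * k)) (1 - X ^ 2)⁻¹ := by
      simpa only [pow_mul] using hasSum_geometric_of_norm_lt_one h2
    have := HasSum.even_add_odd (f := fun e : ℕ ↦ if ((p : ℕ) % 4 = 3 → Even e) then X ^ e else 0)
      (m := (1 - X ^ 2)⁻¹) (m' := 0)
      (by simpa using hs2) (by simp [h3])
    rw [this.tsum_eq, add_zero]
  · simp only [h3, false_imp_iff, if_true]
    rw [tsum_geometric_of_norm_lt_one hXl]

/-- The square of the Dirichlet series of the twisted indicator function of sums of two
squares. -/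
lemma LSeries_STwist_sq_mul {q : ℕ} (χ : DirichletCharacter ℂ q) {s : ℂ} (hs : 1 < s.re) :
    LSeries (STwist χ) s ^ 2 * (1 - χ ((2 : ℕ) : ZMod q) * ((2 : ℕ) : ℂ) ^ (-s)) =
      LSeries (fun n : ℕ ↦ χ (n : ZMod q)) s *
        LSeries (fun n : ℕ ↦ mulChiNeg4 χ (n : ZMod (4 * q))) s *
        threeSeries (χ ^ 2) (2 * s) := by
  have h2 : 1 < (2 * s).re := by simp; linarith
  have A := LSeries_STwist_hasProd χ hs
  have B := DirichletCharacter.LSeries_eulerProduct_hasProd (mulChiNeg4 χ) hs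
  have C := DirichletCharacter.LSeries_eulerProduct_hasProd χ hs
  have D := threeSeries_hasProd (χ ^ 2) h2
  have E := hasProd_two_factor (1 - χ ((2 : ℕ) : ZMod q) * ((2 : ℕ) : ℂ) ^ (-s))
  have L := (A.mul A).mul E
  have R := (C.mul B).mul D
  rw [← sq] at L
  refine L.unique ?_
  convert R using 1
  funext p
  have hXl := norm_character_mul_cpow_lt_one χ (by linarith : 0 < s.re) p.2.one_lt
  have hX := one_sub_ne_zero_of_norm_lt_one hXl
  have hX2 : (χ ^ 2) ((p : ℕ) : ZMod q) * ((p : ℕ) : ℂ) ^ (-(2 * s)) =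
      (χ ((p : ℕ) : ZMod q) * ((p : ℕ) : ℂ) ^ (-s)) ^ 2 := by
    rw [MulChar.pow_apply' _ two_ne_zero, mul_pow, ← Complex.cpow_nat_mul]
    congr 2; push_cast; ring
  have hX' : 1 + χ ((p : ℕ) : ZMod q) * ((p : ℕ) : ℂ) ^ (-s) ≠ 0 := by
    rw [← sub_neg_eq_add]
    exact one_sub_ne_zero_of_norm_lt_one (by rwa [norm_neg])
  rw [hX2, mulChiNeg4_natCast]
  rcases p.2.eq_two_or_odd with hp | hp
  · have h3 : ¬ ((p : ℕ) % 4 = 3) := by omega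
    have hz : chiNeg4 ((p : ℕ) : ZMod 4) = 0 := by rw [hp]; exact chiNeg4_two
    simp only [if_neg h3, hz, if_pos hp, mul_zero, zero_mul, sub_zero, inv_one, mul_one]
    rw [hp] at hX ⊢
    rw [mul_assoc, inv_mul_cancel₀ hX, mul_one]
  · have hp2 : ¬ ((p : ℕ) = 2) := by omega
    rcases (by omega : (p : ℕ) % 4 = 1 ∨ (p : ℕ) % 4 = 3) with h | h
    · have h3 : ¬ ((p : ℕ) % 4 = 3) := by omega
      simp [h3, hp2, chiNeg4_natCast_of_mod_one h]
    · simp only [h, if_true, hp2, if_false, chiNeg4_natCast_of_mod_three h, mul_one]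
      set X := χ ((p : ℕ) : ZMod q) * ((p : ℕ) : ℂ) ^ (-s)
      have e1 : 1 - χ ((p : ℕ) : ZMod q) * -1 * ((p : ℕ) : ℂ) ^ (-s) = 1 + X := by ring
      have e2 : (1 - X ^ 2) = (1 - X) * (1 + X) := by ring
      rw [e1, e2]
      field_simp

/-- A function holomorphic and non-vanishing near `1 ≤ re s`, whose growth on `1 ≤ re s ≤ 3 / 2` is
subpolynomial and whose logarithmic derivative is at most logarithmic there. -/
structure IsTame (b : ℂ → ℂ) : Prop where
  diff : ∃ U : Set ℂ, IsOpen U ∧ {s : ℂ | 1 ≤ s.re} ⊆ U ∧ DifferentiableOn ℂ b U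
  ne_zero : ∀ s : ℂ, 1 ≤ s.re → b s ≠ 0
  logDeriv_le : ∃ C : ℝ, 0 < C ∧ ∀ s : ℂ, 1 ≤ s.re → s.re ≤ 3 / 2 →
    ‖logDeriv b s‖ ≤ C * Real.log (|s.im| + 3)
  growth : ∀ ε : ℝ, 0 < ε → ∃ C : ℝ, 0 < C ∧ ∀ s : ℂ, 1 ≤ s.re → s.re ≤ 3 / 2 →
    ‖b s‖ ≤ C * (|s.im| + 3) ^ ε ∧ ‖b s‖⁻¹ ≤ C * (|s.im| + 3) ^ ε

lemma IsTame.differentiableAt {b : ℂ → ℂ} (h : IsTame b) {s : ℂ} (hs : 1 ≤ s.re) :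
    DifferentiableAt ℂ b s := by
  obtain ⟨U, hU, hsub, hd⟩ := h.diff
  exact hd.differentiableAt (hU.mem_nhds (hsub hs))

lemma IsTame.mul {b c : ℂ → ℂ} (hb : IsTame b) (hc : IsTame c) :
    IsTame (fun s ↦ b s * c s) := by
  refine ⟨?_, fun s hs ↦ mul_ne_zero (hb.ne_zero s hs) (hc.ne_zero s hs), ?_, fun ε hε ↦ ?_⟩
  · obtain ⟨U, hU, hsub, hd⟩ := hb.diff
    obtain ⟨V, hV, hsub', hd'⟩ := hc.diff
    exact ⟨U ∩ V, hU.inter hV, Set.subset_inter hsub hsub',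
      (hd.mono Set.inter_subset_left).mul (hd'.mono Set.inter_subset_right)⟩
  · obtain ⟨C, hC, h⟩ := hb.logDeriv_le
    obtain ⟨C', hC', h'⟩ := hc.logDeriv_le
    refine ⟨C + C', by positivity, fun s h1 h2 ↦ ?_⟩
    rw [logDeriv_mul s (hb.ne_zero s h1) (hc.ne_zero s h1) (hb.differentiableAt h1)
      (hc.differentiableAt h1), add_mul]
    exact (norm_add_le _ _).trans (add_le_add (h s h1 h2) (h' s h1 h2))
  · obtain ⟨C, hC, h⟩ := hb.growth (ε / 2) (by positivity)
    obtain ⟨C', hC', h'⟩ := hc.growth (ε / 2) (by positivity)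
    refine ⟨C * C', by positivity, fun s h1 h2 ↦ ?_⟩
    have e : (|s.im| + 3) ^ ε = (|s.im| + 3) ^ (ε / 2) * (|s.im| + 3) ^ (ε / 2) := by
      rw [← Real.rpow_add (by positivity)]; ring_nf
    rw [norm_mul, mul_inv, e, mul_mul_mul_comm]
    exact ⟨mul_le_mul (h s h1 h2).1 (h' s h1 h2).1 (by positivity) (by positivity),
      mul_le_mul (h s h1 h2).2 (h' s h1 h2).2 (by positivity) (by positivity)⟩

lemma IsTame.inv {b : ℂ → ℂ} (hb : IsTame b) : IsTame (fun s ↦ (b s)⁻¹) := by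
  refine ⟨?_, fun s hs ↦ inv_ne_zero (hb.ne_zero s hs), ?_, fun ε hε ↦ ?_⟩
  · obtain ⟨U, hU, hsub, hd⟩ := hb.diff
    have hV : IsOpen (U ∩ b ⁻¹' {0}ᶜ) := hd.continuousOn.isOpen_inter_preimage hU
      isOpen_compl_singleton
    exact ⟨_, hV, fun s hs ↦ ⟨hsub hs, hb.ne_zero s hs⟩,
      (hd.mono Set.inter_subset_left).inv fun s hs ↦ hs.2⟩
  · obtain ⟨C, hC, h⟩ := hb.logDeriv_le
    refine ⟨C, hC, fun s h1 h2 ↦ ?_⟩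
    have : logDeriv (fun s ↦ (b s)⁻¹) s = - logDeriv b s := by
      have h0 := hb.ne_zero s h1
      rw [logDeriv_apply, logDeriv_apply]
      have hd : deriv (fun s ↦ (b s)⁻¹) s = - deriv b s / b s ^ 2 :=
        deriv_fun_inv'' (hb.differentiableAt h1) h0
      rw [hd]
      field_simp
    rw [this, norm_neg]
    exact h s h1 h2
  · obtain ⟨C, hC, h⟩ := hb.growth ε hε
    refine ⟨C, hC, fun s h1 h2 ↦ ?_⟩
    rw [norm_inv, inv_inv]
    exact ⟨(h s h1 h2).2, (h s h1 h2).1⟩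

lemma isTame_of_bounded {b : ℂ → ℂ} {m M : ℝ} (hd : DifferentiableOn ℂ b {s | 3 / 4 < s.re})
    (hm : 0 < m) (h : ∀ s : ℂ, 3 / 4 < s.re → m ≤ ‖b s‖ ∧ ‖b s‖ ≤ M) : IsTame b := by
  have h0 : ∀ s : ℂ, 3 / 4 < s.re → b s ≠ 0 := fun s hs h' ↦ by
    have := (h s hs).1
    rw [h', norm_zero] at this
    linarith
  have hmM : m ≤ M := (h 1 (by norm_num)).1.trans (h 1 (by norm_num)).2
  have hM : 0 < M := hm.trans_le hmM
  refine ⟨⟨_, isOpen_lt continuous_const Complex.continuous_re, fun s hs ↦ ?_, hd⟩,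
    fun s hs ↦ h0 s (by linarith), ?_, fun ε hε ↦ ?_⟩
  · simp only [Set.mem_ofPred_eq] at hs ⊢; linarith
  · obtain ⟨C, hC, hlog⟩ := exists_norm_logDeriv_le_of_ne_zero (r := 1 / 8) (R := 1 / 4)
      (by norm_num) (by norm_num)
    have hball : ∀ s : ℂ, 1 ≤ s.re → ∀ z ∈ Metric.ball s (1 / 4), 3 / 4 < z.re := by
      intro s hs z hz
      have hz : ‖z - s‖ < 1 / 4 := by simpa [dist_eq_norm] using hz
      have := (abs_le.1 ((Complex.abs_re_le_norm (z - s)).trans hz.le)).1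
      have h2 := (abs_lt.1 ((Complex.abs_re_le_norm (z - s)).trans_lt hz)).1
      simp at h2
      linarith
    refine ⟨C * (Real.log (M / m) + 1), ?_, fun s h1 h2 ↦ ?_⟩
    · have : 0 ≤ Real.log (M / m) := Real.log_nonneg (by rwa [one_le_div hm])
      positivity
    · have hl : 0 ≤ Real.log (M / m) := Real.log_nonneg (by rwa [one_le_div hm])
      refine (hlog b s M m (hd.mono fun z hz ↦ hball s h1 z hz) (fun z hz ↦ h0 z (hball s h1 z hz))
        (fun z hz ↦ (h z (hball s h1 z hz)).2) hm (h s (by linarith)).1 s (by simp)).trans ?_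
      exact le_mul_of_one_le_right (by positivity) (log_add_three_pos _)
  · refine ⟨M + m⁻¹, by positivity, fun s h1 h2 ↦ ?_⟩
    have hp : 1 ≤ (|s.im| + 3) ^ ε := Real.one_le_rpow (by linarith [abs_nonneg s.im]) hε.le
    have hb := h s (by linarith)
    refine ⟨?_, ?_⟩
    · exact (hb.2.trans (le_add_of_nonneg_right (by positivity))).trans
        (le_mul_of_one_le_right (by positivity) hp)
    · exact ((inv_anti₀ hm hb.1).trans (le_add_of_nonneg_left hM.le)).trans
        (le_mul_of_one_le_right (by positivity) hp)

lemma isTame_of_large {b : ℂ → ℂ} (hd : DifferentiableOn ℂ b {s | 0 < s.re}) (h0 : ∀ s : ℂ, 1 ≤ s.re → b s ≠ 0)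
    (hlog : ∃ C : ℝ, 0 < C ∧ ∀ s : ℂ, 1 ≤ s.re → s.re ≤ 3 / 2 → 2 ≤ |s.im| →
      ‖logDeriv b s‖ ≤ C * Real.log (|s.im| + 3))
    (hgr : ∀ ε : ℝ, 0 < ε → ∃ C : ℝ, 0 < C ∧ ∀ s : ℂ, 1 ≤ s.re → s.re ≤ 3 / 2 → 2 ≤ |s.im| →
      ‖b s‖ ≤ C * (|s.im| + 3) ^ ε ∧ ‖b s‖⁻¹ ≤ C * (|s.im| + 3) ^ ε) : IsTame b := by
  set K : Set ℂ := Set.Icc 1 (3 / 2) ×ℂ Set.Icc (-2) 2 with hK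
  have hKc : IsCompact K := isCompact_Icc.reProdIm isCompact_Icc
  have hKm : ∀ s : ℂ, 1 ≤ s.re → s.re ≤ 3 / 2 → ¬ 2 ≤ |s.im| → s ∈ K := fun s h1 h2 h3 ↦ by
    push Not at h3
    exact ⟨⟨h1, h2⟩, abs_le.1 h3.le⟩
  have hopen : IsOpen {s : ℂ | 0 < s.re} := isOpen_lt continuous_const Complex.continuous_re
  have hsub : K ⊆ {s : ℂ | 0 < s.re} := fun s hs ↦ zero_lt_one.trans_le hs.1.1
  have hd' : ContinuousOn (deriv b) K := (hd.deriv hopen).continuousOn.mono hsub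
  have hc : ContinuousOn b K := hd.continuousOn.mono hsub
  have hne : ∀ s ∈ K, b s ≠ 0 := fun s hs ↦ h0 s hs.1.1
  obtain ⟨M1, hM1⟩ := hKc.exists_bound_of_continuousOn (f := logDeriv b)
    (hd'.div hc hne)
  obtain ⟨M2, hM2⟩ := hKc.exists_bound_of_continuousOn (f := b) hc
  obtain ⟨M3, hM3⟩ := hKc.exists_bound_of_continuousOn (f := fun s ↦ (b s)⁻¹)
    (hc.inv₀ hne)
  refine ⟨⟨_, hopen, fun s hs ↦ lt_of_lt_of_le zero_lt_one (Set.mem_ofPred_eq ▸ hs), hd⟩, h0, ?_, fun ε hε ↦ ?_⟩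
  · obtain ⟨C, hC, h⟩ := hlog
    refine ⟨C + |M1|, by positivity, fun s h1 h2 ↦ ?_⟩
    have hl := log_add_three_pos s.im
    by_cases h3 : 2 ≤ |s.im|
    · refine (h s h1 h2 h3).trans ?_
      gcongr
      exact le_add_of_nonneg_right (abs_nonneg _)
    · calc _ ≤ M1 := hM1 s (hKm s h1 h2 h3)
        _ ≤ (C + |M1|) * 1 := by linarith [le_abs_self M1]
        _ ≤ _ := by gcongr
  · obtain ⟨C, hC, h⟩ := hgr ε hε
    refine ⟨C + |M2| + |M3|, by positivity, fun s h1 h2 ↦ ?_⟩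
    have hp : 1 ≤ (|s.im| + 3) ^ ε := Real.one_le_rpow (by linarith [abs_nonneg s.im]) hε.le
    by_cases h3 : 2 ≤ |s.im|
    · have hle : C * (|s.im| + 3) ^ ε ≤ (C + |M2| + |M3|) * (|s.im| + 3) ^ ε := by
        gcongr
        linarith [abs_nonneg M2, abs_nonneg M3]
      exact ⟨(h s h1 h2 h3).1.trans hle, (h s h1 h2 h3).2.trans hle⟩
    · have hle : |M2| + |M3| ≤ (C + |M2| + |M3|) * (|s.im| + 3) ^ ε := by
        refine le_trans ?_ (le_mul_of_one_le_right (by positivity) hp)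
        linarith
      constructor
      · linarith [hM2 s (hKm s h1 h2 h3), le_abs_self M2, abs_nonneg M3]
      · have := hM3 s (hKm s h1 h2 h3)
        rw [norm_inv] at this
        linarith [le_abs_self M3, abs_nonneg M2]

/-- The `L`-function of a Dirichlet character with its possible pole at `1` removed. -/
lemma exists_isTame_LFunction {N : ℕ} [NeZero N] {χ : DirichletCharacter ℂ N} (h : GRH χ) :
    ∃ R : ℂ → ℂ, IsTame R ∧
      ∀ s ≠ 1, R s = ((s - 1) / (s + 1)) ^ (if χ = 1 then 1 else 0) * χ.LFunction s := by
  have him : ∀ s : ℂ, 2 ≤ |s.im| → s ≠ 1 := by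
    rintro s hs rfl
    norm_num at hs
  by_cases hχ : χ = 1
  · set P := LFunctionRegularized (fun j ↦ χ j) with hP
    have hPne : ∀ z : ℂ, z ≠ 1 → P z = (z - 1) * χ.LFunction z := by
      intro z hz
      rw [hP, LFunctionRegularized, Function.update_of_ne hz]; rfl
    have hPd : Differentiable ℂ P := differentiable_LFunctionRegularized _
    have hp1 : ∀ s : ℂ, 0 < s.re → s + 1 ≠ 0 := fun s hs h' ↦ by
      have := congrArg Complex.re h'
      simp at this
      linarith
    have hRd : DifferentiableOn ℂ (fun s ↦ P s / (s + 1)) {s | 0 < s.re} :=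
      hPd.differentiableOn.div (by fun_prop) fun s hs ↦ hp1 s hs
    refine ⟨fun s ↦ P s / (s + 1), isTame_of_large hRd ?_ ?_ ?_, fun s hs ↦ ?_⟩
    · intro s hs
      refine div_ne_zero ?_ (hp1 s (by linarith))
      by_cases hs1 : s = 1
      · rw [hs1, hP, LFunctionRegularized, Function.update_self, hχ,
          MulChar.sum_one_eq_card_units]
        exact div_ne_zero (by exact_mod_cast Fintype.card_ne_zero) (NeZero.ne _)
      · rw [hPne s hs1]
        exact mul_ne_zero (sub_ne_zero.2 hs1)
          (LFunction_ne_zero_of_GRH h (by linarith) (Or.inr hs1))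
    · obtain ⟨C, hC, hb⟩ := exists_norm_logDeriv_LFunction_le h
      refine ⟨C + 2, by positivity, fun s h1 h2 h3 ↦ ?_⟩
      have hs1 := him s h3
      have hL0 := LFunction_ne_zero_of_GRH h (s := s) (by linarith) (Or.inr hs1)
      have hs2 := hp1 s (by linarith)
      have hlogd : logDeriv (fun s ↦ P s / (s + 1)) s =
          (s - 1)⁻¹ + logDeriv χ.LFunction s - (s + 1)⁻¹ := by
        have hev : P =ᶠ[nhds s] fun z => (z - 1) * χ.LFunction z := by
          filter_upwards [isOpen_compl_singleton.mem_nhds hs1] with z hz using hPne z hz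
        have hP0 : P s ≠ 0 := by
          rw [hPne s hs1]; exact mul_ne_zero (sub_ne_zero.2 hs1) hL0
        rw [logDeriv_div (f := P) (g := fun s ↦ s + 1) s hP0 hs2 hPd.differentiableAt (by fun_prop),
          logDeriv_apply P, hev.deriv_eq, hev.eq_of_nhds, ← logDeriv_apply,
          logDeriv_mul (f := fun z => z - 1) s (sub_ne_zero.2 hs1) hL0 (by fun_prop)
            (χ.differentiableAt_LFunction s (Or.inl hs1))]
        simp [logDeriv_apply]
      have hinv : ‖(s - 1)⁻¹‖ ≤ 1 := by
        rw [norm_inv]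
        apply inv_le_one_of_one_le₀
        have := Complex.abs_im_le_norm (s - 1)
        simp at this
        linarith
      have hinv' : ‖(s + 1)⁻¹‖ ≤ 1 := by
        rw [norm_inv]
        apply inv_le_one_of_one_le₀
        have := Complex.abs_im_le_norm (s + 1)
        simp at this
        linarith
      rw [hlogd]
      refine (norm_sub_le _ _).trans ?_
      have := norm_add_le (s - 1)⁻¹ (logDeriv χ.LFunction s)
      have := hb s h1 (by linarith) h3
      nlinarith [log_add_three_pos s.im]
    · intro ε hε
      obtain ⟨C, hC, hb⟩ := exists_norm_LFunction_le_rpow h (ε := ε) hε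
      refine ⟨3 * C, by positivity, fun s h1 h2 h3 ↦ ?_⟩
      have hs1 := him s h3
      have hs2 := hp1 s (by linarith)
      have e : P s / (s + 1) = ((s - 1) / (s + 1)) * χ.LFunction s := by
        rw [hPne s hs1]; ring
      have hn1 : ‖s - 1‖ ≤ ‖s + 1‖ := by
        rw [← sq_le_sq₀ (norm_nonneg _) (norm_nonneg _), ← Complex.normSq_eq_norm_sq,
          ← Complex.normSq_eq_norm_sq, Complex.normSq_apply, Complex.normSq_apply]
        simp
        nlinarith
      have hn3 : 1 ≤ ‖s - 1‖ := by
        have := Complex.abs_im_le_norm (s - 1)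
        simp at this
        linarith
      have hn2 : ‖s + 1‖ ≤ 3 * ‖s - 1‖ := by
        have : s + 1 = (s - 1) + 2 := by ring
        rw [this]
        refine (norm_add_le _ _).trans ?_
        norm_num
        linarith
      have hpos : 0 < ‖s + 1‖ := norm_pos_iff.2 hs2
      obtain ⟨hb1, hb2⟩ := hb s h1 (by linarith) h3
      simp only [e]
      rw [norm_mul, norm_div, mul_inv, inv_div, mul_assoc]
      constructor
      · have : ‖s - 1‖ / ‖s + 1‖ ≤ 3 := by rw [div_le_iff₀ hpos]; linarith
        exact mul_le_mul this hb1 (norm_nonneg _) (by norm_num)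
      · have : ‖s + 1‖ / ‖s - 1‖ ≤ 3 := by rw [div_le_iff₀ (by linarith)]; linarith
        exact mul_le_mul this hb2 (by positivity) (by norm_num)
    · simp only [hχ, if_true, pow_one]
      rw [hPne s hs, hχ]; ring
  · have hd : Differentiable ℂ χ.LFunction := DirichletCharacter.differentiable_LFunction hχ
    refine ⟨χ.LFunction, isTame_of_large hd.differentiableOn ?_ ?_ ?_, fun s hs ↦ by simp [hχ]⟩
    · exact fun s hs ↦ LFunction_ne_zero_of_GRH h (by linarith) (Or.inl hχ)
    · obtain ⟨C, hC, hb⟩ := exists_norm_logDeriv_LFunction_le h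
      exact ⟨C, hC, fun s h1 h2 h3 ↦ hb s h1 (by linarith) h3⟩
    · intro ε hε
      obtain ⟨C, hC, hb⟩ := exists_norm_LFunction_le_rpow h (ε := ε) hε
      exact ⟨C, hC, fun s h1 h2 h3 ↦ hb s h1 (by linarith) h3⟩


lemma isTame_one_sub_mul_cpow {c : ℂ} (hc : ‖c‖ ≤ 1) {κ : ℝ} (hκ : 0 < κ) :
    IsTame (fun s ↦ 1 - c * ((2 : ℕ) : ℂ) ^ (-(κ * s))) := by
  have hx : (2 : ℝ) ^ (-(κ * (3 / 4))) < 1 :=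
    Real.rpow_lt_one_of_one_lt_of_neg (by norm_num) (by nlinarith)
  have hle : ∀ s : ℂ, 3 / 4 < s.re → ‖c * ((2 : ℕ) : ℂ) ^ (-(κ * s))‖ ≤ (2 : ℝ) ^ (-(κ * (3 / 4))) := by
    intro s hs
    rw [norm_mul, Complex.norm_natCast_cpow_of_pos two_pos]
    calc _ ≤ 1 * ((2 : ℕ) : ℝ) ^ (-(κ * s)).re := by gcongr
      _ ≤ _ := by
        rw [one_mul]
        refine Real.rpow_le_rpow_of_exponent_le (by norm_num) ?_
        simp
        nlinarith
  refine isTame_of_bounded (m := 1 - (2 : ℝ) ^ (-(κ * (3 / 4))))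
    (M := 1 + (2 : ℝ) ^ (-(κ * (3 / 4)))) ?_ (by linarith) fun s hs ↦ ⟨?_, ?_⟩
  · refine Differentiable.differentiableOn ?_
    refine (differentiable_const _).sub ((differentiable_const _).mul ?_)
    exact Differentiable.const_cpow (by fun_prop) (Or.inl (by norm_num))
  · have := norm_sub_norm_le (1 : ℂ) (c * ((2 : ℕ) : ℂ) ^ (-(κ * s)))
    rw [norm_one] at this
    exact (sub_le_sub_left (hle s hs) 1).trans this
  · have := norm_sub_le (1 : ℂ) (c * ((2 : ℕ) : ℂ) ^ (-(κ * s)))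
    rw [norm_one] at this
    exact this.trans (add_le_add_right (hle s hs) 1)

lemma exists_norm_threeSeries_bounds {q : ℕ} (ξ : DirichletCharacter ℂ q) {σ : ℝ} (hσ : 1 < σ) :
    ∃ m M : ℝ, 0 < m ∧ 0 < M ∧ ∀ s : ℂ, σ ≤ s.re →
      m ≤ ‖threeSeries ξ s‖ ∧ ‖threeSeries ξ s‖ ≤ M := by
  have hσ' : 1 < ((σ : ℂ)).re := by simpa using hσ
  have hsum := summable_riemannZetaSummand hσ'
  have hσ0 : (σ : ℂ) ≠ 0 := ne_zero_of_one_lt_re hσ'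
  set u : ℕ → ℝ := fun n ↦ ‖riemannZetaSummandHom hσ0 n‖ with hu
  have hle : ∀ (s : ℂ) (hs : σ ≤ s.re) (n : ℕ),
      ‖threeSummandHom ξ (ne_zero_of_one_lt_re (hσ.trans_le hs)) n‖ ≤ u n := by
    intro s hs n
    change ‖threeTwist ξ n * (n : ℂ) ^ (-s)‖ ≤ ‖(n : ℂ) ^ (-(σ : ℂ))‖
    rw [norm_mul]
    rcases Nat.eq_zero_or_pos n with rfl | hn
    · simp [threeTwist, OnlyThreeModFour]
    refine (mul_le_of_le_one_left (norm_nonneg _) (norm_threeTwist_le ξ n)).trans ?_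
    rw [Complex.norm_natCast_cpow_of_pos hn, Complex.norm_natCast_cpow_of_pos hn]
    exact Real.rpow_le_rpow_of_exponent_le (by exact_mod_cast hn) (by simpa using hs)
  have hu0 : ∀ n, 0 ≤ u n := fun n ↦ norm_nonneg _
  have hup : ∀ p : Nat.Primes, u p ≤ 1 / 2 := by
    intro p
    change ‖((p : ℕ) : ℂ) ^ (-(σ : ℂ))‖ ≤ 1 / 2
    rw [Complex.norm_natCast_cpow_of_pos p.2.pos]
    have h2 : (2 : ℝ) ≤ ((p : ℕ) : ℝ) := by exact_mod_cast p.2.two_le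
    calc ((p : ℕ) : ℝ) ^ (-(σ : ℂ)).re ≤ ((p : ℕ) : ℝ) ^ (-1 : ℝ) :=
          Real.rpow_le_rpow_of_exponent_le (by linarith) (by simp; linarith)
      _ ≤ 1 / 2 := by
        rw [Real.rpow_neg_one, one_div]
        exact inv_anti₀ two_pos h2
  have hsp : Summable (fun p : Nat.Primes ↦ 3 / 2 * u p) :=
    (hsum.subtype _).mul_left _
  set B := ∑' p : Nat.Primes, 3 / 2 * u p with hB
  set B' := ∑' n, u n with hB'
  refine ⟨Real.exp (-B), B' + 1, Real.exp_pos _, ?_, fun s hs ↦ ?_⟩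
  · have : 0 ≤ B' := tsum_nonneg hu0
    positivity
  have hs1 : 1 < s.re := hσ.trans_le hs
  constructor
  · rw [← tsum_threeSummandHom ξ hs1,
      ← EulerProduct.exp_tsum_primes_log_eq_tsum (summable_norm_threeSummandHom ξ hs1),
      Complex.norm_exp]
    refine Real.exp_le_exp.2 ?_
    have : ‖∑' p : Nat.Primes,
        -Complex.log (1 - threeSummandHom ξ (ne_zero_of_one_lt_re hs1) p)‖ ≤ B := by
      refine tsum_of_norm_bounded hsp.hasSum fun p ↦ ?_
      rw [norm_neg, sub_eq_add_neg]
      refine (Complex.norm_log_one_add_half_le_self ?_).trans ?_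
      · rw [norm_neg]; exact (hle s hs p).trans (hup p)
      · rw [norm_neg]; gcongr; exact hle s hs p
    linarith [(abs_le.1 ((Complex.abs_re_le_norm _).trans this)).1]
  · rw [← tsum_threeSummandHom ξ hs1]
    refine (tsum_of_norm_bounded hsum.hasSum (hle s hs)).trans ?_
    linarith

lemma isTame_threeSeries_two_mul {q : ℕ} (ξ : DirichletCharacter ℂ q) :
    IsTame (fun s ↦ threeSeries ξ (2 * s)) := by
  obtain ⟨m, M, hm, hM, h⟩ := exists_norm_threeSeries_bounds ξ (σ := 3 / 2) (by norm_num)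
  refine isTame_of_bounded (m := m) (M := M) ?_ hm fun s hs ↦ h _ (by simp; linarith)
  refine (differentiableOn_threeSeries ξ).comp (by fun_prop) fun s hs ↦ ?_
  simp only [Set.mem_ofPred_eq, Complex.mul_re] at hs ⊢
  simp
  linarith

/-- The factor relating the Dirichlet series of sums of two squares to the product of two
`L`-functions. -/
def sqFactor {q : ℕ} (χ : DirichletCharacter ℂ q) (s : ℂ) : ℂ :=
  threeSeries (χ ^ 2) (2 * s) / (1 - χ ((2 : ℕ) : ZMod q) * ((2 : ℕ) : ℂ) ^ (-s))

theorem exists_sqFactor_sq_eq {q : ℕ} [NeZero q] (χ : DirichletCharacter ℂ q)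
    (h1 : GRH (χ ^ 2)) (h2 : GRH (mulChiNeg4 (χ ^ 2))) :
    ∃ b : ℂ → ℂ, IsTame b ∧ ∀ s : ℂ, 1 / 2 < s.re →
      sqFactor χ s ^ 2 * ((2 * s - 1) / (2 * s + 1)) ^ (if χ ^ 2 = 1 then 1 else 0) =
        ((2 * s - 1) / (2 * s + 1)) ^ (if mulChiNeg4 (χ ^ 2) = 1 then 1 else 0) * b (2 * s) := by
  have : NeZero (4 * q) := ⟨mul_ne_zero (by norm_num) (NeZero.ne q)⟩
  obtain ⟨R1, hR1, e1⟩ := exists_isTame_LFunction h1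
  obtain ⟨R2, hR2, e2⟩ := exists_isTame_LFunction h2
  have hE := isTame_one_sub_mul_cpow ((χ ^ 2).norm_le_one ((2 : ℕ) : ZMod q)) one_pos
  have hE2 := isTame_one_sub_mul_cpow (χ.norm_le_one ((2 : ℕ) : ZMod q)) (half_pos one_pos)
  have hT := isTame_threeSeries_two_mul ((χ ^ 2) ^ 2)
  refine ⟨_, ((hR1.mul hR2.inv).mul (hE.mul hT)).mul (hE2.mul hE2).inv, fun s hs ↦ ?_⟩
  have hw : 1 < (2 * s).re := by simp; linarith
  have hw1 : 2 * s ≠ 1 := fun h' ↦ by rw [h'] at hw; simp at hw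
  have key := threeSeries_sq_mul (χ ^ 2) hw
  rw [← DirichletCharacter.LFunction_eq_LSeries _ hw,
    ← DirichletCharacter.LFunction_eq_LSeries _ hw] at key
  have hne1 : (2 * s - 1) / (2 * s + 1) ≠ 0 := by
    refine div_ne_zero (sub_ne_zero.2 hw1) fun h' ↦ ?_
    have := congrArg Complex.re h'
    simp at this
    linarith
  have hL2 : (mulChiNeg4 (χ ^ 2)).LFunction (2 * s) ≠ 0 :=
    LFunction_ne_zero_of_GRH h2 (by linarith) (Or.inr hw1)
  have hEz : 1 - χ ((2 : ℕ) : ZMod q) * ((2 : ℕ) : ℂ) ^ (-s) ≠ 0 :=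
    one_sub_ne_zero_of_norm_lt_one (norm_character_mul_cpow_lt_one χ (by linarith) one_lt_two)
  have a1 : (((1 / 2 : ℝ) : ℂ) * (2 * s)) = s := by push_cast; ring
  have a2 : (((1 : ℝ) : ℂ) * (2 * s)) = 2 * s := by push_cast; ring
  rw [sqFactor, e1 _ hw1, e2 _ hw1, a1, a2]
  have hne2 : ∀ k : ℕ, ((2 * s - 1) / (2 * s + 1)) ^ k ≠ 0 := fun k ↦ pow_ne_zero k hne1
  set X := (2 * s - 1) / (2 * s + 1)
  set E := 1 - χ ((2 : ℕ) : ZMod q) * ((2 : ℕ) : ℂ) ^ (-s)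
  rw [div_pow, eq_div_of_mul_eq hL2 key]
  have := hne2 (if χ ^ 2 = 1 then 1 else 0)
  have := hne2 (if mulChiNeg4 (χ ^ 2) = 1 then 1 else 0)
  field_simp

lemma LVal_eq_LFunction {N : ℕ} [h : NeZero N] (χ : DirichletCharacter ℂ N) (s : ℂ) :
    LVal χ s = χ.LFunction s := by
  rw [LVal, dif_neg h.ne]

/-- The product `L(s, χ) L(s, χχ₋₄)`. -/
def pairL {q : ℕ} (χ : DirichletCharacter ℂ q) (s : ℂ) : ℂ := LVal χ s * LVal (mulChiNeg4 χ) s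

lemma exists_bounds_LFunction {N : ℕ} [NeZero N] {χ : DirichletCharacter ℂ N} (hχ : χ ≠ 1) :
    ∃ C : ℝ, 0 < C ∧
      (∀ s : ℂ, 3 / 8 ≤ s.re → s.re ≤ 1 → ‖χ.LFunction s‖ ≤ C * (1 + |s.im|) ^ (31 / 64 : ℝ)) ∧
      (∀ s : ℂ, -5 ≤ s.re → ‖χ.LFunction s‖ ≤ C * (1 + |s.im|) ^ (11 / 2 : ℝ)) ∧
      (∀ s : ℂ, 1 / 2 ≤ s.re → ‖χ.LFunction s‖ ≤ C * ‖s‖) := by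
  have h0 : χ (0 : ZMod N) = 0 := by
    refine MulChar.map_nonunit _ fun h ↦ hχ ?_
    have hz : (0 : ZMod N) = 1 := isUnit_zero_iff.1 h
    have : Subsingleton (ZMod N) := subsingleton_of_zero_eq_one hz
    ext u
    simp [Subsingleton.elim (u : ZMod N) 1]
  have hsum : ∑ j, χ j = 0 := MulChar.sum_eq_zero_of_ne_one hχ
  obtain ⟨C1, hC1, h1⟩ := exists_norm_LFunction_convexity (Φ := fun j ↦ χ j) h0 hsum (k := 1)
    le_rfl (σ := 65 / 64) (by norm_num)
  obtain ⟨C2, hC2, h2⟩ := exists_norm_LFunction_convexity (Φ := fun j ↦ χ j) h0 hsum (k := 5)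
    (by norm_num) (σ := 2) (by norm_num)
  obtain ⟨C3, hC3, h3⟩ := exists_norm_LFunction_le_of_one_lt_re (fun j ↦ χ j) one_lt_two
  obtain ⟨C4, hC4, h4⟩ := exists_norm_LFunction_le_of_sum_zero hsum
  refine ⟨C1 + C2 + C3 + C4, by positivity, fun s hs1 hs2 ↦ ?_, fun s hs ↦ ?_, fun s hs ↦ ?_⟩
  · refine (h1 s (by norm_num; linarith) (by linarith)).trans ?_
    have hb : 1 ≤ 1 + |s.im| := by linarith [abs_nonneg s.im]
    refine mul_le_mul (by linarith) (Real.rpow_le_rpow_of_exponent_le hb ?_) (by positivity)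
      (by positivity)
    norm_num
    linarith
  · have hb : 1 ≤ 1 + |s.im| := by linarith [abs_nonneg s.im]
    rcases le_total s.re 2 with hs2 | hs2
    · refine (h2 s (by norm_num; linarith) hs2).trans ?_
      refine mul_le_mul (by linarith) (Real.rpow_le_rpow_of_exponent_le hb ?_) (by positivity)
        (by positivity)
      norm_num
      linarith
    · refine (h3 s hs2).trans ?_
      refine le_trans (by linarith : C3 ≤ C1 + C2 + C3 + C4) (le_mul_of_one_le_right (by positivity) ?_)
      exact Real.one_le_rpow hb (by norm_num)
  · refine (h4 s hs).trans ?_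
    gcongr
    linarith

/-- The analytic input on `L(s, χ) L(s, χχ₋₄)` used below. -/
structure PairLBounds (Λ : ℂ → ℂ) : Prop where
  diff : Differentiable ℂ Λ
  ne_zero : ∀ s : ℂ, 1 / 2 < s.re → Λ s ≠ 0
  convexity : ∃ C : ℝ, 0 < C ∧
    ∀ s : ℂ, 3 / 8 ≤ s.re → s.re ≤ 1 → ‖Λ s‖ ≤ C * (1 + |s.im|) ^ (31 / 32 : ℝ)
  poly : ∃ C : ℝ, 0 < C ∧ ∀ s : ℂ, -5 ≤ s.re → ‖Λ s‖ ≤ C * (1 + |s.im|) ^ (11 : ℝ)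
  lower : ∃ c : ℝ, 0 < c ∧ ∀ s : ℂ, 2 ≤ s.re → c ≤ ‖Λ s‖
  quad : ∃ C : ℝ, 0 < C ∧ ∀ s : ℂ, 1 / 2 ≤ s.re → ‖Λ s‖ ≤ C * ‖s‖ ^ 2

lemma pairLBounds {q : ℕ} [NeZero q] {χ : DirichletCharacter ℂ q} (h1 : χ ≠ 1)
    (h2 : mulChiNeg4 χ ≠ 1) (g1 : GRH χ) (g2 : GRH (mulChiNeg4 χ)) : PairLBounds (pairL χ) := by
  have : NeZero (4 * q) := ⟨mul_ne_zero (by norm_num) (NeZero.ne q)⟩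
  have e : pairL χ = fun s ↦ χ.LFunction s * (mulChiNeg4 χ).LFunction s := by
    funext s; rw [pairL, LVal_eq_LFunction, LVal_eq_LFunction]
  obtain ⟨C, hC, a1, a2, a3⟩ := exists_bounds_LFunction h1
  obtain ⟨D, hD, b1, b2, b3⟩ := exists_bounds_LFunction h2
  obtain ⟨c, hc, c1⟩ := exists_le_norm_LFunction_of_one_lt_re χ one_lt_two
  obtain ⟨d, hd, d1⟩ := exists_le_norm_LFunction_of_one_lt_re (mulChiNeg4 χ) one_lt_two
  have hrp : ∀ (s : ℂ) (x y : ℝ), x = y + y → (1 + |s.im|) ^ x = (1 + |s.im|) ^ y *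
      (1 + |s.im|) ^ y := fun s x y h ↦ by rw [← Real.rpow_add (by positivity), h]
  rw [e]
  refine ⟨?_, ?_, ⟨C * D, by positivity, ?_⟩, ⟨C * D, by positivity, ?_⟩,
    ⟨c * d, by positivity, ?_⟩, ⟨C * D, by positivity, ?_⟩⟩
  · exact (DirichletCharacter.differentiable_LFunction h1).mul
      (DirichletCharacter.differentiable_LFunction h2)
  · exact fun s hs ↦ mul_ne_zero (LFunction_ne_zero_of_GRH g1 hs (Or.inl h1))
      (LFunction_ne_zero_of_GRH g2 hs (Or.inl h2))
  · intro s hs hs'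
    rw [norm_mul, hrp s (31 / 32) (31 / 64) (by norm_num), mul_mul_mul_comm]
    exact mul_le_mul (a1 s hs hs') (b1 s hs hs') (norm_nonneg _) (by positivity)
  · intro s hs
    rw [norm_mul, hrp s 11 (11 / 2) (by norm_num), mul_mul_mul_comm]
    exact mul_le_mul (a2 s hs) (b2 s hs) (norm_nonneg _) (by positivity)
  · intro s hs
    rw [norm_mul]
    exact mul_le_mul (c1 s hs) (d1 s hs) hd.le (norm_nonneg _)
  · intro s hs
    rw [norm_mul, sq, mul_mul_mul_comm]
    exact mul_le_mul (a3 s hs) (b3 s hs) (norm_nonneg _) (by positivity)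

/-- The half plane `1 / 2 < re s`. -/
def halfPlane : Set ℂ := {s | 1 / 2 < s.re}

lemma isOpen_halfPlane : IsOpen halfPlane := isOpen_lt continuous_const Complex.continuous_re

lemma convex_halfPlane : Convex ℝ halfPlane := convex_halfSpace_re_gt _

lemma differentiableOn_sqFactor {q : ℕ} (χ : DirichletCharacter ℂ q) :
    DifferentiableOn ℂ (sqFactor χ) halfPlane := by
  refine DifferentiableOn.div ?_ ?_ fun s hs ↦ ?_
  · refine (differentiableOn_threeSeries _).comp (by fun_prop) fun s hs ↦ ?_
    simp only [halfPlane, Set.mem_ofPred_eq] at hs ⊢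
    simp
    linarith
  · refine Differentiable.differentiableOn ?_
    refine (differentiable_const _).sub ((differentiable_const _).mul ?_)
    exact Differentiable.const_cpow (by fun_prop) (Or.inl (by norm_num))
  · simp only [halfPlane, Set.mem_ofPred_eq] at hs
    exact one_sub_ne_zero_of_norm_lt_one (norm_character_mul_cpow_lt_one χ (by linarith) one_lt_two)

lemma sqFactor_ne_zero {q : ℕ} (χ : DirichletCharacter ℂ q) {s : ℂ} (hs : 1 / 2 < s.re) :
    sqFactor χ s ≠ 0 := by
  refine div_ne_zero (threeSeries_ne_zero _ ?_) ?_
  · simp; linarith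
  · exact one_sub_ne_zero_of_norm_lt_one (norm_character_mul_cpow_lt_one χ (by linarith) one_lt_two)

/-- The Dirichlet series of sums of two squares twisted by `χ` continues to `1 / 2 < re s`. -/
theorem exists_continuation {q : ℕ} [NeZero q] {χ : DirichletCharacter ℂ q}
    (h : PairLBounds (pairL χ)) :
    ∃ f : ℂ → ℂ, DifferentiableOn ℂ f halfPlane ∧
      (∀ s ∈ halfPlane, f s ^ 2 = pairL χ s * sqFactor χ s) ∧
      ∀ s : ℂ, 1 < s.re → f s = LSeries (STwist χ) s := by
  have : NeZero (4 * q) := ⟨mul_ne_zero (by norm_num) (NeZero.ne q)⟩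
  obtain ⟨g, hg, hge⟩ := exists_holomorphic_log isOpen_halfPlane convex_halfPlane
    ⟨1, by simp [halfPlane]; norm_num⟩ (g := fun s ↦ pairL χ s * sqFactor χ s)
    (h.diff.differentiableOn.mul (differentiableOn_sqFactor χ))
    fun z hz ↦ mul_ne_zero (h.ne_zero z hz) (sqFactor_ne_zero χ hz)
  set f : ℂ → ℂ := fun s ↦ exp (g s / 2) with hf
  have hfd : DifferentiableOn ℂ f halfPlane := (hg.div_const 2).cexp
  have hf2 : ∀ s ∈ halfPlane, f s ^ 2 = pairL χ s * sqFactor χ s := by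
    intro s hs
    rw [hf, ← hge s hs, sq]
    simp only
    rw [← Complex.exp_add]
    ring_nf
  have hsub : {s : ℂ | 1 < s.re} ⊆ halfPlane := fun s hs ↦ by
    simp only [halfPlane, Set.mem_ofPred_eq] at hs ⊢; linarith
  have hsq : ∀ s : ℂ, 1 < s.re → LSeries (STwist χ) s ^ 2 = f s ^ 2 := by
    intro s hs
    have key := LSeries_STwist_sq_mul χ hs
    rw [← DirichletCharacter.LFunction_eq_LSeries _ hs,
      ← DirichletCharacter.LFunction_eq_LSeries _ hs] at key
    have hE : 1 - χ ((2 : ℕ) : ZMod q) * ((2 : ℕ) : ℂ) ^ (-s) ≠ 0 :=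
      one_sub_ne_zero_of_norm_lt_one (norm_character_mul_cpow_lt_one χ (by linarith) one_lt_two)
    rw [hf2 s (hsub hs), sqFactor, pairL, LVal_eq_LFunction, LVal_eq_LFunction, ← mul_div_assoc,
      ← key, mul_div_cancel_right₀ _ hE]
  have hconv : IsPreconnected {s : ℂ | 1 < s.re} := (convex_halfSpace_re_gt 1).isPreconnected
  rcases hconv.eq_or_eq_neg_of_sq_eq (differentiableOn_LSeries_STwist χ).continuousOn
    (hfd.continuousOn.mono hsub) (fun s hs ↦ hsq s hs)
    (fun {s} _ ↦ Complex.exp_ne_zero _) with h' | h'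
  · exact ⟨f, hfd, hf2, fun s hs ↦ (h' hs).symm⟩
  · refine ⟨fun s ↦ - f s, hfd.neg, fun s hs ↦ by rw [neg_sq, hf2 s hs], fun s hs ↦ (h' hs).symm⟩

/-- A quarter-power identity for the continued Dirichlet series. -/
lemma exists_pow_four_eq {q : ℕ} [NeZero q] {χ : DirichletCharacter ℂ q}
    (h1 : GRH (χ ^ 2)) (h2 : GRH (mulChiNeg4 (χ ^ 2))) {f : ℂ → ℂ}
    (hf : ∀ s ∈ halfPlane, f s ^ 2 = pairL χ s * sqFactor χ s) :
    ∃ (b : ℂ → ℂ) (e₁ e₂ : ℕ), e₁ ≤ 1 ∧ e₂ ≤ 1 ∧ (χ ^ 2 ≠ 1 → e₁ = 0) ∧ IsTame b ∧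
      ∀ s ∈ halfPlane, f s ^ 4 * ((2 * s - 1) / (2 * s + 1)) ^ e₁ =
        pairL χ s ^ 2 * ((2 * s - 1) / (2 * s + 1)) ^ e₂ * b (2 * s) := by
  obtain ⟨b, hb, hbe⟩ := exists_sqFactor_sq_eq χ h1 h2
  refine ⟨b, if χ ^ 2 = 1 then 1 else 0, if mulChiNeg4 (χ ^ 2) = 1 then 1 else 0,
    by split_ifs <;> norm_num, by split_ifs <;> norm_num, fun h ↦ if_neg h, hb, fun s hs ↦ ?_⟩
  have e : f s ^ 4 = pairL χ s ^ 2 * sqFactor χ s ^ 2 := by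
    rw [← mul_pow, ← hf s hs]; ring
  rw [e, mul_assoc, hbe s hs, mul_assoc]

lemma one_le_log_add_three (T : ℝ) : 1 ≤ Real.log (|T| + 3) := log_add_three_pos T

/-- Each zero in a factorization costs only a bounded factor. -/
lemma norm_mul_inv_sub_le {g k : ℂ → ℂ} {ρ s : ℂ} {M : ℝ} (hk : Differentiable ℂ k)
    (hgk : ∀ z, g z = (z - ρ) * k z) (hM : ∀ z ∈ Metric.closedBall s (1 / 8), ‖g z‖ ≤ M) :
    ‖g s‖ * ‖s - ρ‖⁻¹ ≤ 16 * M := by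
  have hM0 : 0 ≤ M := (norm_nonneg _).trans (hM s (by simp))
  rcases le_or_gt (1 / 16) ‖s - ρ‖ with h | h
  · have h1 : ‖s - ρ‖⁻¹ ≤ 16 := by
      rw [inv_le_comm₀ (by linarith) (by norm_num)]; linarith
    calc ‖g s‖ * ‖s - ρ‖⁻¹ ≤ M * 16 :=
          mul_le_mul (hM s (by simp)) h1 (by positivity) hM0
      _ = 16 * M := mul_comm _ _
  · have hks : ‖k s‖ ≤ 16 * M := by
      refine Complex.norm_le_of_forall_mem_frontier_norm_le (U := Metric.ball s (1 / 8))
        Metric.isBounded_ball hk.diffContOnCl (fun z hz ↦ ?_)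
        (subset_closure (Metric.mem_ball_self (by norm_num)))
      rw [frontier_ball _ (by norm_num)] at hz
      have hz' : ‖z - s‖ = 1 / 8 := by simpa [dist_eq_norm] using hz
      have h2 : 1 / 16 ≤ ‖z - ρ‖ := by
        have := norm_sub_le_norm_add (z - ρ) (s - ρ)
        have h3 : ‖(z - ρ) - (s - ρ)‖ ≤ ‖z - ρ‖ + ‖s - ρ‖ := norm_sub_le _ _
        rw [sub_sub_sub_cancel_right, hz'] at h3
        linarith
      have h4 := hM z (Metric.sphere_subset_closedBall hz)
      rw [hgk, norm_mul] at h4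
      nlinarith [norm_nonneg (k z)]
    rw [hgk, norm_mul]
    rcases eq_or_ne ‖s - ρ‖ 0 with h0 | h0
    · rw [h0]; simp; positivity
    · rw [mul_comm ‖s - ρ‖, mul_assoc, mul_inv_cancel₀ h0, mul_one]; exact hks

lemma exists_logDeriv_sq_mul_le {Λ : ℂ → ℂ} (h : PairLBounds Λ) :
    ∃ C : ℝ, 0 < C ∧ ∀ T : ℝ, ∃ l : Multiset ℂ, (l.card : ℝ) ≤ C * Real.log (|T| + 3) ∧
      (∀ ρ ∈ l, ρ.re ≤ 1 / 2) ∧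
      ∀ s : ℂ, 1 / 2 < s.re → s.re ≤ 5 / 8 → |s.im - T| ≤ 1 →
        ‖Λ s‖ ≤ C * (|T| + 3) ^ (31 / 32 : ℝ) ∧
        ‖Λ s‖ * ‖logDeriv Λ s‖ ^ 2 ≤ C * (|T| + 3) ^ (31 / 32 : ℝ) * Real.log (|T| + 3) ^ 2 *
          (1 + (l.map fun ρ ↦ ‖s - ρ‖⁻¹).sum) := by
  obtain ⟨C0, hC0, h0⟩ := exists_logDeriv_sub_sum_le
  obtain ⟨C1, hC1, h1⟩ := h.convexity
  obtain ⟨C2, hC2, h2⟩ := h.poly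
  obtain ⟨c, hc, h3⟩ := h.lower
  set A : ℝ := |Real.log (C2 * 3 ^ (11 : ℝ) / c)| + 11 with hA
  have hA11 : 11 ≤ A := by rw [hA]; linarith [abs_nonneg (Real.log (C2 * 3 ^ (11 : ℝ) / c))]
  set B : ℝ := C0 * (A + 1) with hB
  have hB0 : 0 < B := by positivity
  refine ⟨2 * A + C1 + 2 * B ^ 2 * C1 + 64 * A * C1, by positivity, fun T ↦ ?_⟩
  have hL := one_le_log_add_three T
  set L := Real.log (|T| + 3) with hLdef
  have hT0 := abs_nonneg T
  set P : ℝ := (|T| + 3) ^ (31 / 32 : ℝ) with hP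
  have hP0 : 0 < P := by positivity
  set M : ℝ := C2 * (3 * (|T| + 3)) ^ (11 : ℝ) with hM
  have hlogM : Real.log (M / c) ≤ A * L := by
    have e : M / c = (C2 * 3 ^ (11 : ℝ) / c) * (|T| + 3) ^ (11 : ℝ) := by
      rw [hM, Real.mul_rpow (by norm_num) (by positivity)]; ring
    rw [e, Real.log_mul (by positivity) (by positivity), Real.log_rpow (by positivity), hA, add_mul]
    have := le_abs_self (Real.log (C2 * 3 ^ (11 : ℝ) / c))
    nlinarith [abs_nonneg (Real.log (C2 * 3 ^ (11 : ℝ) / c))]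
  obtain ⟨l, hl1, hl2, hl3, hl4⟩ := h0 Λ (2 + T * I) M c h.diff
    (fun z hz ↦ by
      have hz' : ‖z - (2 + T * I)‖ ≤ 6 := by simpa [dist_eq_norm] using hz
      have r1 := (Complex.abs_re_le_norm _).trans hz'
      have r2 := (Complex.abs_im_le_norm _).trans hz'
      simp at r1 r2
      have r3 := abs_le.1 r1
      refine (h2 z (by linarith)).trans ?_
      have : |z.im| ≤ |T| + 6 := by
        have := abs_add_le (z.im - T) T
        rw [sub_add_cancel] at this; linarith
      rw [hM]
      gcongr
      linarith) hc (h3 _ (by simp))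
  have hcard : (l.card : ℝ) ≤ 2 * A * L := by
    have hMc : 0 < M / c := by positivity
    have := Real.log_le_log (by positivity) hl1
    rw [Real.log_pow] at this
    have hlog2 := Real.log_two_gt_d9
    have hcn : (0 : ℝ) ≤ l.card := by positivity
    nlinarith
  refine ⟨l, hcard.trans (by gcongr; nlinarith [mul_pos (pow_pos hB0 2) hC1, mul_pos (show 0 < A by linarith) hC1]),
    fun ρ hρ ↦ ?_, fun s hs1 hs2 hsT ↦ ?_⟩
  · by_contra! hcon
    exact h.ne_zero ρ hcon (hl2 ρ hρ)
  · have hsT' := abs_le.1 hsT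
    have himb : |s.im| ≤ |T| + 1 := by
      have := abs_add_le (s.im - T) T
      rw [sub_add_cancel] at this; linarith
    have hloc : ∀ z ∈ Metric.closedBall s (1 / 8), ‖Λ z‖ ≤ C1 * P := by
      intro z hz
      have hz' : ‖z - s‖ ≤ 1 / 8 := by simpa [dist_eq_norm] using hz
      have r1 := (Complex.abs_re_le_norm _).trans hz'
      have r2 := (Complex.abs_im_le_norm _).trans hz'
      simp only [Complex.sub_re, Complex.sub_im] at r1 r2
      have r3 := abs_le.1 r1
      have := abs_add_le (z.im - s.im) s.im
      rw [sub_add_cancel] at this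
      refine (h1 z (by linarith) (by linarith)).trans ?_
      rw [hP]
      refine mul_le_mul_of_nonneg_left ?_ hC1.le
      exact Real.rpow_le_rpow (by positivity) (by linarith) (by norm_num)
    have hΛs : ‖Λ s‖ ≤ C1 * P := hloc s (by simp)
    set S : ℝ := (l.map fun ρ ↦ ‖s - ρ‖⁻¹).sum with hS
    have hS0 : 0 ≤ S := Multiset.sum_nonneg fun x hx ↦ by
      obtain ⟨ρ, _, rfl⟩ := Multiset.mem_map.1 hx
      positivity
    have hSL : ‖Λ s‖ * S ≤ (l.card : ℝ) * (16 * (C1 * P)) := by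
      rw [hS, ← Multiset.sum_map_mul_left]
      have := Multiset.sum_le_card_nsmul (l.map fun ρ ↦ ‖Λ s‖ * ‖s - ρ‖⁻¹) (16 * (C1 * P))
        (fun x hx ↦ by
          obtain ⟨ρ, hρ, rfl⟩ := Multiset.mem_map.1 hx
          obtain ⟨k, hk1, hk2⟩ := hl3 ρ hρ
          exact norm_mul_inv_sub_le hk1 hk2 hloc)
      simpa [nsmul_eq_mul] using this
    have hld : ‖logDeriv Λ s‖ ≤ B * L + S := by
      have hsb : s ∈ Metric.closedBall (2 + T * I : ℂ) (19 / 10) := by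
        rw [Metric.mem_closedBall, dist_eq_norm]
        refine abs_le_of_sq_le_sq' ?_ (by norm_num) |>.2
        rw [← Complex.normSq_eq_norm_sq, Complex.normSq_apply]
        simp
        nlinarith
      have := hl4 s hsb (h.ne_zero s hs1)
      have h5 : ‖(l.map fun ρ ↦ (s - ρ)⁻¹).sum‖ ≤ S := by
        refine (norm_multiset_sum_le _).trans (le_of_eq ?_)
        rw [hS, Multiset.map_map]
        simp
      have h6 : ‖logDeriv Λ s‖ ≤ ‖logDeriv Λ s - (l.map fun ρ ↦ (s - ρ)⁻¹).sum‖ +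
          ‖(l.map fun ρ ↦ (s - ρ)⁻¹).sum‖ := norm_le_norm_sub_add _ _
      have h7 : C0 * (Real.log (M / c) + 1) ≤ B * L := by
        rw [hB, mul_assoc]
        gcongr
        nlinarith
      linarith
    refine ⟨hΛs.trans ?_, ?_⟩
    · gcongr
      nlinarith [mul_pos (pow_pos hB0 2) hC1, mul_pos (show 0 < A by linarith) hC1]
    · have hsq : ‖logDeriv Λ s‖ ^ 2 ≤ 2 * (B * L) ^ 2 + 2 * S ^ 2 := by
        have : ‖logDeriv Λ s‖ ^ 2 ≤ (B * L + S) ^ 2 := by gcongr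
        nlinarith [sq_nonneg (B * L - S)]
      have hAC : 0 < A * C1 * P := by positivity
      calc ‖Λ s‖ * ‖logDeriv Λ s‖ ^ 2 ≤ ‖Λ s‖ * (2 * (B * L) ^ 2 + 2 * S ^ 2) := by gcongr
        _ = 2 * (B * L) ^ 2 * ‖Λ s‖ + 2 * S * (‖Λ s‖ * S) := by ring
        _ ≤ 2 * (B * L) ^ 2 * (C1 * P) + 2 * S * ((2 * A * L) * (16 * (C1 * P))) := by
            have := hSL.trans (mul_le_mul_of_nonneg_right hcard (by positivity))
            gcongr
        _ ≤ 2 * (B * L) ^ 2 * (C1 * P) + 2 * S * ((2 * A * L) * (16 * (C1 * P))) * L := by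
            have : 2 * S * ((2 * A * L) * (16 * (C1 * P))) ≤
                2 * S * ((2 * A * L) * (16 * (C1 * P))) * L :=
              le_mul_of_one_le_right (by positivity) hL
            linarith
        _ = (2 * B ^ 2 * C1 + 64 * A * C1 * S) * (P * L ^ 2) := by ring
        _ ≤ ((2 * A + C1 + 2 * B ^ 2 * C1 + 64 * A * C1) * (1 + S)) * (P * L ^ 2) := by
            refine mul_le_mul_of_nonneg_right ?_ (by positivity)
            have h8 : 0 ≤ (2 * A + C1 + 64 * (A * C1)) + (2 * A + C1 + 2 * B ^ 2 * C1) * S := by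
              positivity
            linarith
        _ = _ := by ring

/-- The Möbius map `s ↦ (2s - 1) / (2s + 1)`. -/
def moebius (s : ℂ) : ℂ := (2 * s - 1) / (2 * s + 1)

lemma moebius_denominators {s : ℂ} (hs : s ∈ halfPlane) : 2 * s - 1 ≠ 0 ∧ 2 * s + 1 ≠ 0 := by
  simp only [halfPlane, Set.mem_ofPred_eq] at hs
  constructor <;> intro h <;> have := congrArg Complex.re h <;> simp at this <;> linarith

lemma moebius_ne_zero {s : ℂ} (hs : s ∈ halfPlane) : moebius s ≠ 0 :=
  div_ne_zero (moebius_denominators hs).1 (moebius_denominators hs).2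

lemma differentiableAt_moebius {s : ℂ} (hs : s ∈ halfPlane) : DifferentiableAt ℂ moebius s :=
  DifferentiableAt.div (by fun_prop) (by fun_prop) (moebius_denominators hs).2

lemma norm_moebius_le {s : ℂ} (hs : s ∈ halfPlane) : ‖moebius s‖ ≤ 1 := by
  rw [moebius, norm_div]
  refine div_le_one_of_le₀ ?_ (norm_nonneg _)
  refine abs_le_of_sq_le_sq' ?_ (norm_nonneg _) |>.2
  rw [← Complex.normSq_eq_norm_sq, ← Complex.normSq_eq_norm_sq, Complex.normSq_apply,
    Complex.normSq_apply]
  simp only [halfPlane, Set.mem_ofPred_eq] at hs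
  simp
  nlinarith

lemma le_norm_two_mul_sub_one {r : ℝ} {s : ℂ} (h : r ≤ |s.im|) : 2 * r ≤ ‖2 * s - 1‖ := by
  refine le_trans ?_ (Complex.abs_im_le_norm _)
  simp [abs_mul]; linarith

lemma two_le_norm_two_mul_add_one {s : ℂ} (hs : s ∈ halfPlane) : 2 ≤ ‖2 * s + 1‖ := by
  refine le_trans ?_ ((le_abs_self _).trans (Complex.abs_re_le_norm _))
  simp only [halfPlane, Set.mem_ofPred_eq] at hs
  simp; linarith

lemma norm_inv_moebius_le {r : ℝ} (hr : 0 < r) {s : ℂ} (hs : s ∈ halfPlane) (h : r ≤ |s.im|) :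
    ‖moebius s‖⁻¹ ≤ 1 + 1 / r := by
  have h1 := le_norm_two_mul_sub_one h
  have h0 : 0 < ‖2 * s - 1‖ := by linarith
  rw [moebius, norm_div, inv_div, div_le_iff₀ h0]
  have h2 : ‖2 * s + 1‖ ≤ ‖2 * s - 1‖ + 2 := by
    have := norm_add_le (2 * s - 1) 2
    rw [show 2 * s - 1 + 2 = 2 * s + 1 by ring] at this
    simpa using this
  have h3 : 2 ≤ 1 / r * ‖2 * s - 1‖ := by
    rw [div_mul_eq_mul_div, one_mul, le_div_iff₀ hr]; exact h1
  linarith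

lemma norm_logDeriv_moebius_le {r : ℝ} (hr : 0 < r) {s : ℂ} (hs : s ∈ halfPlane)
    (h : r ≤ |s.im|) : ‖logDeriv moebius s‖ ≤ 1 / r + 1 := by
  obtain ⟨h1, h2⟩ := moebius_denominators hs
  have e : logDeriv moebius s = 2 / (2 * s - 1) - 2 / (2 * s + 1) := by
    have : moebius = fun z ↦ (2 * z - 1) / (2 * z + 1) := rfl
    rw [this, logDeriv_div s h1 h2 (by fun_prop) (by fun_prop), logDeriv_apply, logDeriv_apply]
    have d1 : deriv (fun z : ℂ ↦ 2 * z - 1) s = 2 := by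
      simpa using (((hasDerivAt_id s).const_mul 2).sub_const 1).deriv
    have d2 : deriv (fun z : ℂ ↦ 2 * z + 1) s = 2 := by
      simpa using (((hasDerivAt_id s).const_mul 2).add_const 1).deriv
    rw [d1, d2]
  rw [e]
  refine (norm_sub_le _ _).trans (add_le_add ?_ ?_)
  · rw [norm_div, Complex.norm_ofNat, div_le_div_iff₀ (norm_pos_iff.2 h1) hr]
    linarith [le_norm_two_mul_sub_one h]
  · rw [norm_div, Complex.norm_ofNat]
    exact div_le_one_of_le₀ (two_le_norm_two_mul_add_one hs) (norm_nonneg _)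

/-- `f` is a square root of `Λ` up to harmless factors and a possible singularity at `1 / 2`. -/
structure IsQuarterRoot (Λ b f : ℂ → ℂ) (e₁ e₂ : ℕ) : Prop where
  bounds : PairLBounds Λ
  tame : IsTame b
  le₁ : e₁ ≤ 1
  le₂ : e₂ ≤ 1
  diff : DifferentiableOn ℂ f halfPlane
  eq : ∀ s ∈ halfPlane, f s ^ 4 * moebius s ^ e₁ = Λ s ^ 2 * moebius s ^ e₂ * b (2 * s)

namespace IsQuarterRoot

variable {Λ b f : ℂ → ℂ} {e₁ e₂ : ℕ}

lemma two_mul_re {s : ℂ} (hs : s ∈ halfPlane) : 1 ≤ (2 * s).re := by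
  simp only [halfPlane, Set.mem_ofPred_eq] at hs
  simp; linarith

lemma ne_zero (h : IsQuarterRoot Λ b f e₁ e₂) {s : ℂ} (hs : s ∈ halfPlane) : f s ≠ 0 := by
  intro h0
  have := h.eq s hs
  rw [h0, zero_pow (by norm_num), zero_mul] at this
  exact mul_ne_zero (mul_ne_zero (pow_ne_zero _ (h.bounds.ne_zero s hs))
    (pow_ne_zero _ (moebius_ne_zero hs))) (h.tame.ne_zero _ (two_mul_re hs)) this.symm

lemma logDeriv_eq (h : IsQuarterRoot Λ b f e₁ e₂) {s : ℂ} (hs : s ∈ halfPlane) :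
    logDeriv f s = logDeriv Λ s / 2 + (e₂ - e₁) / 4 * logDeriv moebius s +
      logDeriv b (2 * s) / 2 := by
  have hnhds := isOpen_halfPlane.mem_nhds hs
  have hm := differentiableAt_moebius hs
  have hm0 := moebius_ne_zero hs
  have hfd := h.diff.differentiableAt hnhds
  have hΛd := h.bounds.diff s
  have hbd : DifferentiableAt ℂ b (2 * s) := h.tame.differentiableAt (two_mul_re hs)
  have hb2 : DifferentiableAt ℂ (fun z ↦ b (2 * z)) s :=
    DifferentiableAt.comp (g := b) (f := fun z ↦ 2 * z) s hbd (by fun_prop)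
  have hev : (fun z ↦ f z ^ 4 * moebius z ^ e₁) =ᶠ[nhds s]
      fun z ↦ Λ z ^ 2 * moebius z ^ e₂ * b (2 * z) := by
    filter_upwards [hnhds] with z hz using h.eq z hz
  have e0 : logDeriv (fun z ↦ f z ^ 4 * moebius z ^ e₁) s =
      logDeriv (fun z ↦ Λ z ^ 2 * moebius z ^ e₂ * b (2 * z)) s := by
    rw [logDeriv_apply, logDeriv_apply, hev.deriv_eq, h.eq s hs]
  have eb : logDeriv (fun z ↦ b (2 * z)) s = 2 * logDeriv b (2 * s) := by
    have hd := (hbd.hasDerivAt.comp s (h := fun z ↦ 2 * z) ((hasDerivAt_id s).const_mul 2)).deriv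
    rw [logDeriv_apply, logDeriv_apply]
    simp only [Function.comp_def, mul_one] at hd
    rw [hd]
    ring
  have hf0 := h.ne_zero hs
  have hΛ0 := h.bounds.ne_zero s hs
  have g1 := logDeriv_mul (f := fun z ↦ f z ^ 4) (g := fun z ↦ moebius z ^ e₁) s
    (pow_ne_zero _ hf0) (pow_ne_zero _ hm0) (hfd.pow _) (hm.pow _)
  have g2 := logDeriv_mul (f := fun z ↦ Λ z ^ 2 * moebius z ^ e₂) (g := fun z ↦ b (2 * z)) s
    (mul_ne_zero (pow_ne_zero _ hΛ0) (pow_ne_zero _ hm0)) (h.tame.ne_zero _ (two_mul_re hs))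
    ((hΛd.pow _).mul (hm.pow _)) hb2
  have g3 := logDeriv_mul (f := fun z ↦ Λ z ^ 2) (g := fun z ↦ moebius z ^ e₂) s
    (pow_ne_zero _ hΛ0) (pow_ne_zero _ hm0) (hΛd.pow _) (hm.pow _)
  rw [g1, g2, g3, logDeriv_fun_pow hfd, logDeriv_fun_pow hm, logDeriv_fun_pow hΛd,
    logDeriv_fun_pow hm, eb] at e0
  push_cast at e0
  linear_combination e0 / 4

lemma exists_norm_sq_le (h : IsQuarterRoot Λ b f e₁ e₂) {r : ℝ} (hr : 0 < r) :
    ∃ C : ℝ, 0 < C ∧ ∀ s : ℂ, 1 / 2 < s.re → s.re ≤ 5 / 8 → r ≤ |s.im| →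
      ‖f s‖ ^ 2 ≤ C * (|s.im| + 3) ^ (1 / 128 : ℝ) * ‖Λ s‖ ∧
      ‖logDeriv f s‖ ≤ ‖logDeriv Λ s‖ / 2 + C * Real.log (|s.im| + 3) := by
  obtain ⟨C1, hC1, h1⟩ := h.tame.growth (1 / 64) (by norm_num)
  obtain ⟨C2, hC2, h2⟩ := h.tame.logDeriv_le
  have hkey : ∀ s : ℂ, |(2 * s).im| + 3 ≤ 2 * (|s.im| + 3) := fun s ↦ by
    simp [abs_mul]
    linarith
  refine ⟨(2 * C1 * (1 + 1 / r)) ^ (1 / 2 : ℝ) + (1 / r + 1 + 2 * C2), by positivity,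
    fun s hs1 hs2 hs3 ↦ ?_⟩
  have hs : s ∈ halfPlane := hs1
  have hre1 := two_mul_re hs
  have hre2 : (2 * s).re ≤ 3 / 2 := by simp; linarith
  have hP0 : 0 < |s.im| + 3 := by positivity
  constructor
  · have hb := (h1 _ hre1 hre2).1
    have hb' : ‖b (2 * s)‖ ≤ 2 * C1 * (|s.im| + 3) ^ (1 / 64 : ℝ) := by
      refine hb.trans ?_
      have : (|(2 * s).im| + 3) ^ (1 / 64 : ℝ) ≤ 2 * (|s.im| + 3) ^ (1 / 64 : ℝ) := by
        refine (Real.rpow_le_rpow (by positivity) (hkey s) (by norm_num)).trans ?_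
        rw [Real.mul_rpow (by norm_num) hP0.le]
        gcongr
        calc (2 : ℝ) ^ (1 / 64 : ℝ) ≤ 2 ^ (1 : ℝ) :=
              Real.rpow_le_rpow_of_exponent_le (by norm_num) (by norm_num)
          _ = 2 := by simp
      calc C1 * (|(2 * s).im| + 3) ^ (1 / 64 : ℝ) ≤ C1 * (2 * (|s.im| + 3) ^ (1 / 64 : ℝ)) := by
            gcongr
        _ = _ := by ring
    have hmpos : 0 < ‖moebius s‖ := norm_pos_iff.2 (moebius_ne_zero hs)
    have hm1 : (‖moebius s‖ ^ e₁)⁻¹ ≤ 1 + 1 / r := by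
      have : 0 < 1 / r := by positivity
      have h' := h.le₁
      interval_cases e₁
      · simp; positivity
      · simpa using norm_inv_moebius_le hr hs hs3
    have hm2 : ‖moebius s‖ ^ e₂ ≤ 1 := pow_le_one₀ (norm_nonneg _) (norm_moebius_le hs)
    have h4 : (‖f s‖ ^ 2) ^ 2 ≤
        ((2 * C1 * (1 + 1 / r)) ^ (1 / 2 : ℝ) * (|s.im| + 3) ^ (1 / 128 : ℝ) * ‖Λ s‖) ^ 2 := by
      have e4 := congrArg norm (h.eq s hs)
      rw [norm_mul, norm_mul, norm_mul, norm_pow, norm_pow, norm_pow, norm_pow] at e4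
      have e5 : ‖f s‖ ^ 4 = ‖Λ s‖ ^ 2 * ‖moebius s‖ ^ e₂ * ‖b (2 * s)‖ * (‖moebius s‖ ^ e₁)⁻¹ := by
        rw [← e4, mul_inv_cancel_right₀ (pow_ne_zero _ hmpos.ne')]
      rw [← pow_mul, e5, mul_pow, mul_pow, ← Real.rpow_natCast (_ ^ (1 / 2 : ℝ)),
        ← Real.rpow_natCast (_ ^ (1 / 128 : ℝ)), ← Real.rpow_mul (by positivity),
        ← Real.rpow_mul (by positivity)]
      norm_num
      calc ‖Λ s‖ ^ 2 * ‖moebius s‖ ^ e₂ * ‖b (2 * s)‖ * (‖moebius s‖ ^ e₁)⁻¹ ≤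
          ‖Λ s‖ ^ 2 * 1 * (2 * C1 * (|s.im| + 3) ^ (1 / 64 : ℝ)) * (1 + 1 / r) := by gcongr
        _ = _ := by rw [one_div r]; ring
    have h5 := abs_le_of_sq_le_sq' h4 (by positivity) |>.2
    refine h5.trans ?_
    gcongr
    have : 0 < 1 / r + 1 + 2 * C2 := by positivity
    linarith
  · have hL := one_le_log_add_three s.im
    have hlog : Real.log (|(2 * s).im| + 3) ≤ 2 * Real.log (|s.im| + 3) := by
      refine (Real.log_le_log (by positivity) (hkey s)).trans ?_
      rw [Real.log_mul (by norm_num) hP0.ne']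
      have : Real.log 2 ≤ 1 := by linarith [Real.log_two_lt_d9]
      linarith
    have hbl := (h2 _ hre1 hre2).trans (mul_le_mul_of_nonneg_left hlog hC2.le)
    rw [h.logDeriv_eq hs]
    have hcoef : ‖((e₂ : ℂ) - e₁) / 4‖ ≤ 1 := by
      have a1 := h.le₁
      have a2 := h.le₂
      interval_cases e₁ <;> interval_cases e₂ <;> norm_num
    have t1 : ‖((e₂ : ℂ) - e₁) / 4 * logDeriv moebius s‖ ≤ 1 / r + 1 := by
      rw [norm_mul]
      have := norm_logDeriv_moebius_le hr hs hs3
      calc _ ≤ 1 * (1 / r + 1) := by gcongr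
        _ = _ := one_mul _
    have t2 := norm_add₃_le (a := logDeriv Λ s / 2)
      (b := ((e₂ : ℂ) - e₁) / 4 * logDeriv moebius s) (c := logDeriv b (2 * s) / 2)
    rw [norm_div, norm_div _ (2 : ℂ), Complex.norm_ofNat] at t2
    have t3 : 0 < (2 * C1 * (1 + 1 / r)) ^ (1 / 2 : ℝ) := by positivity
    have t4 : (1 / r + 1) ≤ (1 / r + 1) * Real.log (|s.im| + 3) :=
      le_mul_of_one_le_right (by positivity) hL
    nlinarith

lemma exists_norm_deriv_sq_le (h : IsQuarterRoot Λ b f e₁ e₂) {r : ℝ} (hr : 0 < r) :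
    ∃ C : ℝ, 0 < C ∧ ∀ T : ℝ, ∃ l : Multiset ℂ, (l.card : ℝ) ≤ C * Real.log (|T| + 3) ∧
      (∀ ρ ∈ l, ρ.re ≤ 1 / 2) ∧
      ∀ s : ℂ, 1 / 2 < s.re → s.re ≤ 5 / 8 → |s.im - T| ≤ 1 → r ≤ |s.im| →
        ‖f s‖ ^ 2 ≤ C * (|T| + 3) ^ (63 / 64 : ℝ) ∧
        ‖deriv f s‖ ^ 2 ≤ C * (|T| + 3) ^ (63 / 64 : ℝ) *
          (1 + (l.map fun ρ ↦ ‖s - ρ‖⁻¹).sum) := by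
  obtain ⟨C1, hC1, h1⟩ := exists_logDeriv_sq_mul_le h.bounds
  obtain ⟨C2, hC2, h2⟩ := h.exists_norm_sq_le hr
  set K : ℝ := 256 with hK
  refine ⟨C1 + 2 * C2 * C1 + C1 * C2 * K ^ 2 + 16 * C2 ^ 3 * C1 * K ^ 2, by positivity, fun T ↦ ?_⟩
  obtain ⟨l, hl1, hl2, hl3⟩ := h1 T
  set L := Real.log (|T| + 3) with hLdef
  have hL : 1 ≤ L := one_le_log_add_three T
  set P : ℝ := |T| + 3 with hPdef
  have hP3 : 3 ≤ P := by rw [hPdef]; linarith [abs_nonneg T]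
  have hLP : L ≤ K * P ^ (1 / 256 : ℝ) := by
    have := Real.log_le_rpow_div (x := P) (by linarith) (ε := 1 / 256) (by norm_num)
    rw [hLdef]; refine this.trans (le_of_eq ?_); rw [hK]; ring
  have hL2P : L ^ 2 ≤ K ^ 2 * P ^ (1 / 128 : ℝ) := by
    calc L ^ 2 ≤ (K * P ^ (1 / 256 : ℝ)) ^ 2 := by gcongr
      _ = _ := by
        rw [mul_pow, ← Real.rpow_natCast (P ^ (1 / 256 : ℝ)), ← Real.rpow_mul (by linarith)]
        norm_num
  refine ⟨l, hl1.trans ?_, hl2, fun s hs1 hs2 hsT hs3 ↦ ?_⟩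
  · have : 0 < 2 * C2 * C1 + C1 * C2 * K ^ 2 + 16 * C2 ^ 3 * C1 * K ^ 2 := by positivity
    gcongr
    linarith
  obtain ⟨a1, a2⟩ := hl3 s hs1 hs2 hsT
  obtain ⟨b1, b2⟩ := h2 s hs1 hs2 hs3
  have him : |s.im| + 3 ≤ 2 * P := by
    have := abs_add_le (s.im - T) T
    rw [sub_add_cancel] at this
    rw [hPdef]; linarith [abs_nonneg T]
  have him2 : (|s.im| + 3) ^ (1 / 128 : ℝ) ≤ 2 * P ^ (1 / 128 : ℝ) := by
    refine (Real.rpow_le_rpow (by positivity) him (by norm_num)).trans ?_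
    rw [Real.mul_rpow (by norm_num) (by linarith)]
    gcongr
    calc (2 : ℝ) ^ (1 / 128 : ℝ) ≤ 2 ^ (1 : ℝ) :=
          Real.rpow_le_rpow_of_exponent_le (by norm_num) (by norm_num)
      _ = 2 := by simp
  have hlogs : Real.log (|s.im| + 3) ≤ 2 * L := by
    refine (Real.log_le_log (by positivity) him).trans ?_
    rw [Real.log_mul (by norm_num) (by linarith)]
    have : Real.log 2 ≤ 1 := by linarith [Real.log_two_lt_d9]
    rw [hLdef]; linarith
  set Q : ℝ := P ^ (1 / 128 : ℝ) with hQ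
  set R : ℝ := P ^ (31 / 32 : ℝ) with hR
  have hQ1 : 1 ≤ Q := Real.one_le_rpow (by linarith) (by norm_num)
  have hR0 : 0 < R := by positivity
  have hQQR : Q * Q * R = P ^ (63 / 64 : ℝ) := by
    rw [hQ, hR, ← Real.rpow_add (by linarith), ← Real.rpow_add (by linarith)]; norm_num
  set S : ℝ := (l.map fun ρ ↦ ‖s - ρ‖⁻¹).sum with hS
  have hS0 : 0 ≤ S := Multiset.sum_nonneg fun x hx ↦ by
    obtain ⟨ρ, _, rfl⟩ := Multiset.mem_map.1 hx
    positivity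
  have hfs : ‖f s‖ ^ 2 ≤ 2 * C2 * Q * ‖Λ s‖ := by
    refine b1.trans ?_
    calc _ ≤ C2 * (2 * Q) * ‖Λ s‖ := by gcongr
      _ = _ := by ring
  have hld : ‖logDeriv f s‖ ≤ ‖logDeriv Λ s‖ / 2 + 2 * C2 * L := by
    refine b2.trans ?_
    have := mul_le_mul_of_nonneg_left hlogs hC2.le
    linarith
  have hrest : 0 < C1 + C1 * C2 * K ^ 2 + 16 * C2 ^ 3 * C1 * K ^ 2 := by positivity
  rw [← hQQR]
  constructor
  · calc ‖f s‖ ^ 2 ≤ 2 * C2 * Q * (C1 * R) := hfs.trans (by gcongr)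
      _ ≤ 2 * C2 * Q * (C1 * R) * Q := le_mul_of_one_le_right (by positivity) hQ1
      _ = (2 * C2 * C1) * (Q * Q * R) := by ring
      _ ≤ _ := by
        gcongr
        linarith
  · have hdf : deriv f s = logDeriv f s * f s := by
      rw [logDeriv_apply, div_mul_cancel₀ _ (h.ne_zero hs1)]
    have hsq : ‖logDeriv f s‖ ^ 2 ≤ ‖logDeriv Λ s‖ ^ 2 / 2 + 8 * C2 ^ 2 * L ^ 2 := by
      have : ‖logDeriv f s‖ ^ 2 ≤ (‖logDeriv Λ s‖ / 2 + 2 * C2 * L) ^ 2 := by gcongr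
      nlinarith [sq_nonneg (‖logDeriv Λ s‖ / 2 - 2 * C2 * L)]
    rw [hdf, norm_mul, mul_pow]
    calc ‖logDeriv f s‖ ^ 2 * ‖f s‖ ^ 2 ≤
        (‖logDeriv Λ s‖ ^ 2 / 2 + 8 * C2 ^ 2 * L ^ 2) * (2 * C2 * Q * ‖Λ s‖) := by gcongr
      _ = C2 * Q * (‖Λ s‖ * ‖logDeriv Λ s‖ ^ 2) + 16 * C2 ^ 3 * L ^ 2 * Q * ‖Λ s‖ := by ring
      _ ≤ C2 * Q * (C1 * R * L ^ 2 * (1 + S)) + 16 * C2 ^ 3 * L ^ 2 * Q * (C1 * R) := by gcongr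
      _ ≤ C2 * Q * (C1 * R * (K ^ 2 * Q) * (1 + S)) +
          16 * C2 ^ 3 * (K ^ 2 * Q) * Q * (C1 * R) := by gcongr
      _ = (C1 * C2 * K ^ 2 * (1 + S) + 16 * C2 ^ 3 * C1 * K ^ 2) * (Q * Q * R) := by ring
      _ ≤ ((C1 + 2 * C2 * C1 + C1 * C2 * K ^ 2 + 16 * C2 ^ 3 * C1 * K ^ 2) * (1 + S)) *
          (Q * Q * R) := by
        refine mul_le_mul_of_nonneg_right ?_ (by positivity)
        have h8 : 0 ≤ (C1 + 2 * C2 * C1) + (C1 + 2 * C2 * C1 + 16 * C2 ^ 3 * C1 * K ^ 2) * S := by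
          positivity
        linarith
      _ = _ := by ring

end IsQuarterRoot

lemma exists_lintegral_abs_rpow : ∃ K : ℝ, 0 < K ∧
    ∫⁻ x in Set.Icc (-1 : ℝ) 1, ENNReal.ofReal (|x| ^ (-(3 / 4) : ℝ)) ≤ ENNReal.ofReal K := by
  have h1 : IntervalIntegrable (fun x : ℝ ↦ |x| ^ (-(3 / 4) : ℝ)) MeasureTheory.volume 0 1 := by
    refine (intervalIntegral.intervalIntegrable_rpow' (r := -(3 / 4)) (by norm_num)).congr ?_
    intro x hx
    rw [Set.uIoc_of_le zero_le_one] at hx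
    simp only
    rw [abs_of_pos hx.1]
  have h2 : IntervalIntegrable (fun x : ℝ ↦ |x| ^ (-(3 / 4) : ℝ)) MeasureTheory.volume (-1) 0 := by
    have := ((IntervalIntegrable.iff_comp_neg (by simp)).1 h1).symm
    simpa [abs_neg] using this
  have h3 := (intervalIntegrable_iff_integrableOn_Icc_of_le (by norm_num)).1 (h2.trans h1)
  have h4 := h3.lintegral_lt_top
  refine ⟨_ + 1, ?_, ((ENNReal.ofReal_toReal h4.ne).symm.le).trans
    (ENNReal.ofReal_le_ofReal (le_add_of_nonneg_right zero_le_one))⟩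
  positivity

lemma inv_norm_le_rpow_mul {δ t γ x : ℝ} (hδ : 0 < δ) (hx : δ ≤ x) (ht : t ≠ γ) :
    ‖(x + (t - γ) * I : ℂ)‖⁻¹ ≤ δ ^ (-(1 / 4) : ℝ) * |t - γ| ^ (-(3 / 4) : ℝ) := by
  have h0 : 0 < |t - γ| := abs_pos.2 (sub_ne_zero.2 ht)
  set N := ‖(x + (t - γ) * I : ℂ)‖ with hN
  have h1 : δ ≤ N := by
    refine (hx.trans (le_abs_self x)).trans ?_
    have := Complex.abs_re_le_norm (x + (t - γ) * I : ℂ)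
    simpa using this
  have h2 : |t - γ| ≤ N := by
    have := Complex.abs_im_le_norm (x + (t - γ) * I : ℂ)
    simpa using this
  have hN0 : 0 < N := by linarith
  calc N⁻¹ = N ^ (-(1 / 4) : ℝ) * N ^ (-(3 / 4) : ℝ) := by
        rw [← Real.rpow_add hN0]; norm_num [Real.rpow_neg_one]
    _ ≤ _ := by
      gcongr ?_ * ?_
      · exact Real.rpow_le_rpow_of_nonpos hδ h1 (by norm_num)
      · exact Real.rpow_le_rpow_of_nonpos h0 h2 (by norm_num)

lemma exists_lintegral_inv_norm_le : ∃ K : ℝ, 0 < K ∧ ∀ (ρ : ℂ) (δ T : ℝ), ρ.re ≤ 1 / 2 → 0 < δ →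
    δ ≤ 1 → ∫⁻ t in Set.Icc T (T + 1), ENNReal.ofReal ‖((1 / 2 + δ : ℝ) + t * I : ℂ) - ρ‖⁻¹ ≤
      ENNReal.ofReal (K * δ ^ (-(1 / 4) : ℝ)) := by
  obtain ⟨K, hK, hKi⟩ := exists_lintegral_abs_rpow
  refine ⟨K + 1, by positivity, fun ρ δ T hρ hδ hδ1 ↦ ?_⟩
  have hd : 1 ≤ δ ^ (-(1 / 4) : ℝ) := Real.one_le_rpow_of_pos_of_le_one_of_nonpos hδ hδ1 (by norm_num)
  set g : ℝ → ENNReal := (Set.Icc (-1 : ℝ) 1).indicator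
    fun x ↦ ENNReal.ofReal (|x| ^ (-(3 / 4) : ℝ)) with hg
  have hgm : Measurable g := by
    refine Measurable.indicator ?_ measurableSet_Icc
    exact (((measurable_norm (α := ℝ)).pow_const _)).ennreal_ofReal
  have hgi : ∫⁻ x, g x ≤ ENNReal.ofReal K := by
    rw [hg, MeasureTheory.lintegral_indicator measurableSet_Icc]; exact hKi
  have hae : ∀ᵐ t : ℝ, t ≠ ρ.im := by
    have : (MeasureTheory.volume : MeasureTheory.Measure ℝ) {ρ.im} = 0 := Real.volume_singleton
    exact MeasureTheory.compl_mem_ae_iff.2 this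
  calc ∫⁻ t in Set.Icc T (T + 1), ENNReal.ofReal ‖((1 / 2 + δ : ℝ) + t * I : ℂ) - ρ‖⁻¹
      ≤ ∫⁻ t in Set.Icc T (T + 1), ENNReal.ofReal (δ ^ (-(1 / 4) : ℝ)) * (g (t - ρ.im) + 1) := by
        refine MeasureTheory.lintegral_mono_ae ?_
        filter_upwards [MeasureTheory.ae_restrict_of_ae hae] with t ht
        have e : ((1 / 2 + δ : ℝ) + t * I : ℂ) - ρ = ((1 / 2 + δ - ρ.re : ℝ) : ℂ) + (t - ρ.im) * I := by
          apply Complex.ext <;> simp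
        have hb := inv_norm_le_rpow_mul hδ (by linarith : δ ≤ 1 / 2 + δ - ρ.re) ht
        rw [e]
        rcases le_or_gt |t - ρ.im| 1 with h1 | h1
        · have : g (t - ρ.im) = ENNReal.ofReal (|t - ρ.im| ^ (-(3 / 4) : ℝ)) :=
            Set.indicator_of_mem (show t - ρ.im ∈ Set.Icc (-1 : ℝ) 1 from abs_le.1 h1) _
          rw [this, mul_add, ← ENNReal.ofReal_mul (by positivity)]
          exact (ENNReal.ofReal_le_ofReal hb).trans le_self_add
        · refine le_trans ?_ (mul_le_mul_right (le_add_self : 1 ≤ g (t - ρ.im) + 1) _)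
          rw [mul_one]
          refine ENNReal.ofReal_le_ofReal (hb.trans ?_)
          refine mul_le_of_le_one_right (by positivity) ?_
          exact Real.rpow_le_one_of_one_le_of_nonpos h1.le (by norm_num)
    _ = ENNReal.ofReal (δ ^ (-(1 / 4) : ℝ)) * ∫⁻ t in Set.Icc T (T + 1), (g (t - ρ.im) + 1) := by
        rw [MeasureTheory.lintegral_const_mul]
        exact (hgm.comp (measurable_id.sub_const _)).add_const _
    _ ≤ ENNReal.ofReal (δ ^ (-(1 / 4) : ℝ)) * (ENNReal.ofReal K + 1) := by
        gcongr
        rw [MeasureTheory.lintegral_add_right _ measurable_const]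
        gcongr
        · refine (MeasureTheory.setLIntegral_le_lintegral _ _).trans ?_
          rw [MeasureTheory.lintegral_sub_right_eq_self (fun x ↦ g x)]
          exact hgi
        · simp
    _ = ENNReal.ofReal ((K + 1) * δ ^ (-(1 / 4) : ℝ)) := by
        rw [ENNReal.ofReal_mul (by positivity), ENNReal.ofReal_add hK.le zero_le_one,
          ENNReal.ofReal_one, mul_comm]

lemma lintegral_one_add_sum_inv_le {K δ T : ℝ} (hK : 0 ≤ K)
    (h : ∀ ρ : ℂ, ρ.re ≤ 1 / 2 →
      ∫⁻ t in Set.Icc T (T + 1), ENNReal.ofReal ‖((1 / 2 + δ : ℝ) + t * I : ℂ) - ρ‖⁻¹ ≤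
        ENNReal.ofReal K) (l : Multiset ℂ) (hl : ∀ ρ ∈ l, ρ.re ≤ 1 / 2) :
    ∫⁻ t in Set.Icc T (T + 1), ENNReal.ofReal
      (1 + (l.map fun ρ ↦ ‖((1 / 2 + δ : ℝ) + t * I : ℂ) - ρ‖⁻¹).sum) ≤
        ENNReal.ofReal (1 + l.card * K) := by
  induction l using Multiset.induction_on with
  | empty => simp
  | cons a l ih =>
    have hs : ∀ t : ℝ, 0 ≤ (l.map fun ρ ↦ ‖((1 / 2 + δ : ℝ) + t * I : ℂ) - ρ‖⁻¹).sum := fun t ↦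
      Multiset.sum_nonneg fun x hx ↦ by
        obtain ⟨ρ, _, rfl⟩ := Multiset.mem_map.1 hx
        positivity
    calc _ = ∫⁻ t in Set.Icc T (T + 1), (ENNReal.ofReal ‖((1 / 2 + δ : ℝ) + t * I : ℂ) - a‖⁻¹ +
          ENNReal.ofReal (1 + (l.map fun ρ ↦ ‖((1 / 2 + δ : ℝ) + t * I : ℂ) - ρ‖⁻¹).sum)) := by
          refine MeasureTheory.lintegral_congr fun t ↦ ?_
          rw [← ENNReal.ofReal_add (by positivity) (by have := hs t; linarith),
            Multiset.map_cons, Multiset.sum_cons, add_left_comm]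
      _ = _ + _ := by
          refine MeasureTheory.lintegral_add_left ?_ _
          refine Measurable.ennreal_ofReal (Measurable.inv (Measurable.norm ?_))
          fun_prop
      _ ≤ ENNReal.ofReal K + ENNReal.ofReal (1 + l.card * K) :=
          add_le_add (h a (hl a (by simp))) (ih fun ρ hρ ↦ hl ρ (by simp [hρ]))
      _ = _ := by
          rw [← ENNReal.ofReal_add hK (by positivity), Multiset.card_cons]
          push_cast
          ring_nf

lemma summable_abs_intCast_add_three_rpow {p : ℝ} (hp : 1 < p) :
    Summable fun n : ℤ ↦ (|(n : ℝ)| + 3) ^ (-p) := by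
  refine Summable.of_norm_bounded_eventually (Real.summable_abs_int_rpow hp) ?_
  have : ∀ᶠ n : ℤ in cofinite, n ≠ 0 := (Set.finite_singleton (0 : ℤ)).compl_mem_cofinite
  filter_upwards [this] with n hn
  have hn' : 0 < |(n : ℝ)| := abs_pos.2 (by exact_mod_cast hn)
  rw [Real.norm_of_nonneg (by positivity)]
  exact Real.rpow_le_rpow_of_nonpos hn' (by linarith) (by linarith)

namespace IsQuarterRoot

variable {Λ b f : ℂ → ℂ} {e₁ e₂ : ℕ}

lemma exists_lintegral_deriv_div_le (h : IsQuarterRoot Λ b f e₁ e₂) {r : ℝ} (hr : 0 < r) :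
    ∃ C : ℝ, 0 < C ∧ ∀ δ : ℝ, 0 < δ → δ ≤ 1 / 8 →
      ∫⁻ t in {t : ℝ | r ≤ |t|},
        ENNReal.ofReal (‖deriv (fun s ↦ f s / s) ((1 / 2 + δ : ℝ) + t * I)‖ ^ 2) ≤
          ENNReal.ofReal (C * δ ^ (-(1 / 4) : ℝ)) := by
  obtain ⟨C, hC, hf⟩ := h.exists_norm_deriv_sq_le hr
  obtain ⟨K, hK, hKi⟩ := exists_lintegral_inv_norm_le
  have hsum := summable_abs_intCast_add_three_rpow (p := 129 / 128) (by norm_num)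
  set Z := ∑' n : ℤ, (|(n : ℝ)| + 3) ^ (-(129 / 128) : ℝ) with hZ
  have hZ0 : 0 < Z := hsum.tsum_pos (fun n ↦ by positivity) 0 (by positivity)
  set B : ℝ := 810 * C * (1 + C * (128 * K)) with hB
  refine ⟨B * Z, by positivity, fun δ hδ hδ8 ↦ ?_⟩
  have hd : 1 ≤ δ ^ (-(1 / 4) : ℝ) :=
    Real.one_le_rpow_of_pos_of_le_one_of_nonpos hδ (by linarith) (by norm_num)
  set F : ℝ → ENNReal := fun t ↦
    ENNReal.ofReal (‖deriv (fun s ↦ f s / s) ((1 / 2 + δ : ℝ) + t * I)‖ ^ 2) with hF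
  have hAm : MeasurableSet {t : ℝ | r ≤ |t|} :=
    measurableSet_le measurable_const (measurable_norm (α := ℝ))
  have hstrip : ∀ n : ℤ, ∫⁻ t in {t : ℝ | r ≤ |t|} ∩ Set.Icc (n : ℝ) (n + 1), F t ≤
      ENNReal.ofReal (B * δ ^ (-(1 / 4) : ℝ) * (|(n : ℝ)| + 3) ^ (-(129 / 128) : ℝ)) := by
    intro n
    obtain ⟨l, hl1, hl2, hl3⟩ := hf n
    set P : ℝ := |(n : ℝ)| + 3 with hP
    have hP3 : 3 ≤ P := by rw [hP]; linarith [abs_nonneg (n : ℝ)]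
    have hpt : ∀ t ∈ {t : ℝ | r ≤ |t|} ∩ Set.Icc (n : ℝ) (n + 1), F t ≤
        ENNReal.ofReal (810 * C * P ^ (63 / 64 - 2 : ℝ)) * ENNReal.ofReal
        (1 + (l.map fun ρ ↦ ‖((1 / 2 + δ : ℝ) + t * I : ℂ) - ρ‖⁻¹).sum) := by
      rintro t ⟨ht1, ht2, ht3⟩
      rw [hF, ← ENNReal.ofReal_mul (by positivity)]
      refine ENNReal.ofReal_le_ofReal ?_
      set s : ℂ := (1 / 2 + δ : ℝ) + t * I with hs
      have hsre : s.re = 1 / 2 + δ := by simp [hs]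
      have hsim : s.im = t := by simp [hs]
      obtain ⟨a1, a2⟩ := hl3 s (by rw [hsre]; linarith) (by rw [hsre]; linarith)
        (by rw [hsim, abs_le]; constructor <;> linarith) (by rw [hsim]; exact ht1)
      set S := (l.map fun ρ ↦ ‖s - ρ‖⁻¹).sum with hS
      have hS0 : 0 ≤ S := Multiset.sum_nonneg fun x hx ↦ by
        obtain ⟨ρ, _, rfl⟩ := Multiset.mem_map.1 hx
        positivity
      have hs12 : 1 / 2 ≤ ‖s‖ := by
        have := (le_abs_self _).trans (Complex.abs_re_le_norm s)
        rw [hsre] at this; linarith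
      have hsP : P ≤ 9 * ‖s‖ := by
        have := Complex.abs_im_le_norm s
        rw [hsim] at this
        have h2 : |(n : ℝ)| ≤ |t| + 1 := by
          have := abs_add_le (n - t) t
          rw [sub_add_cancel] at this
          have h3 : |(n : ℝ) - t| ≤ 1 := by rw [abs_le]; constructor <;> linarith
          linarith
        rw [hP]; linarith
      have hsmem : s ∈ halfPlane := by
        simp only [halfPlane, Set.mem_ofPred_eq]; rw [hsre]; linarith
      have hs0 : s ≠ 0 := norm_pos_iff.1 (by linarith)
      have hsn : 0 < ‖s‖ := by linarith
      have hfd := h.diff.differentiableAt (isOpen_halfPlane.mem_nhds hsmem)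
      have hder : deriv (fun s ↦ f s / s) s = deriv f s / s - f s / s ^ 2 := by
        rw [deriv_fun_div hfd differentiableAt_fun_id hs0]
        simp
        field_simp
      rw [hder]
      have i1 : ‖s‖⁻¹ ≤ 9 / P := by
        rw [inv_eq_one_div, div_le_div_iff₀ hsn (by linarith)]; linarith
      have i2 : ‖s‖⁻¹ ≤ 2 := by
        rw [inv_le_comm₀ hsn (by norm_num)]; linarith
      have e1 : ‖deriv f s / s - f s / s ^ 2‖ ^ 2 ≤
          2 * (‖deriv f s‖ ^ 2 * ‖s‖⁻¹ ^ 2) + 2 * (‖f s‖ ^ 2 * (‖s‖⁻¹ ^ 2 * ‖s‖⁻¹ ^ 2)) := by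
        have t1 := norm_sub_le (deriv f s / s) (f s / s ^ 2)
        have t2 : ‖deriv f s / s - f s / s ^ 2‖ ^ 2 ≤ (‖deriv f s / s‖ + ‖f s / s ^ 2‖) ^ 2 := by
          gcongr
        have t3 : ‖deriv f s / s‖ = ‖deriv f s‖ * ‖s‖⁻¹ := by rw [norm_div, div_eq_mul_inv]
        have t4 : ‖f s / s ^ 2‖ = ‖f s‖ * ‖s‖⁻¹ ^ 2 := by
          rw [norm_div, norm_pow, div_eq_mul_inv, inv_pow]
        rw [t3, t4] at t2
        nlinarith [sq_nonneg (‖deriv f s‖ * ‖s‖⁻¹ - ‖f s‖ * ‖s‖⁻¹ ^ 2)]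
      calc _ ≤ _ := e1
        _ ≤ 2 * ((C * P ^ (63 / 64 : ℝ) * (1 + S)) * (9 / P) ^ 2) +
            2 * ((C * P ^ (63 / 64 : ℝ)) * ((9 / P) ^ 2 * 2 ^ 2)) := by gcongr
        _ = 162 * C * (P ^ (63 / 64 : ℝ) / P ^ 2) * (1 + S) +
            648 * C * (P ^ (63 / 64 : ℝ) / P ^ 2) * 1 := by ring
        _ ≤ 162 * C * (P ^ (63 / 64 : ℝ) / P ^ 2) * (1 + S) +
            648 * C * (P ^ (63 / 64 : ℝ) / P ^ 2) * (1 + S) := by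
            gcongr
            linarith
        _ = 810 * C * P ^ (63 / 64 - 2 : ℝ) * (1 + S) := by
            rw [Real.rpow_sub (by linarith) _ 2, Real.rpow_two]; ring
    have hlog : Real.log P ≤ 128 * P ^ (1 / 128 : ℝ) := by
      have := Real.log_le_rpow_div (x := P) (by linarith) (ε := 1 / 128) (by norm_num)
      refine this.trans (le_of_eq ?_); ring
    have hP1 : 1 ≤ P ^ (1 / 128 : ℝ) := Real.one_le_rpow (by linarith) (by norm_num)
    calc ∫⁻ t in {t : ℝ | r ≤ |t|} ∩ Set.Icc (n : ℝ) (n + 1), F t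
        ≤ ∫⁻ t in {t : ℝ | r ≤ |t|} ∩ Set.Icc (n : ℝ) (n + 1),
          ENNReal.ofReal (810 * C * P ^ (63 / 64 - 2 : ℝ)) * ENNReal.ofReal
          (1 + (l.map fun ρ ↦ ‖((1 / 2 + δ : ℝ) + t * I : ℂ) - ρ‖⁻¹).sum) :=
          MeasureTheory.setLIntegral_mono' (hAm.inter measurableSet_Icc) hpt
      _ ≤ ∫⁻ t in Set.Icc (n : ℝ) (n + 1),
          ENNReal.ofReal (810 * C * P ^ (63 / 64 - 2 : ℝ)) * ENNReal.ofReal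
          (1 + (l.map fun ρ ↦ ‖((1 / 2 + δ : ℝ) + t * I : ℂ) - ρ‖⁻¹).sum) :=
          MeasureTheory.lintegral_mono_set Set.inter_subset_right
      _ = ENNReal.ofReal (810 * C * P ^ (63 / 64 - 2 : ℝ)) * ∫⁻ t in Set.Icc (n : ℝ) (n + 1),
          ENNReal.ofReal
          (1 + (l.map fun ρ ↦ ‖((1 / 2 + δ : ℝ) + t * I : ℂ) - ρ‖⁻¹).sum) :=
          MeasureTheory.lintegral_const_mul' _ _ ENNReal.ofReal_ne_top
      _ ≤ ENNReal.ofReal (810 * C * P ^ (63 / 64 - 2 : ℝ)) *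
          ENNReal.ofReal (1 + l.card * (K * δ ^ (-(1 / 4) : ℝ))) := by
          gcongr
          exact lintegral_one_add_sum_inv_le (by positivity)
            (fun ρ hρ ↦ hKi ρ δ n hρ hδ (by linarith)) l hl2
      _ ≤ _ := by
          rw [← ENNReal.ofReal_mul (by positivity)]
          refine ENNReal.ofReal_le_ofReal ?_
          set D := δ ^ (-(1 / 4) : ℝ) with hD
          calc 810 * C * P ^ (63 / 64 - 2 : ℝ) * (1 + l.card * (K * D)) ≤
              810 * C * P ^ (63 / 64 - 2 : ℝ) * (1 * (D * P ^ (1 / 128 : ℝ)) +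
                (C * (128 * P ^ (1 / 128 : ℝ))) * (K * D)) := by
                gcongr
                · rw [one_mul]; nlinarith
                · exact hl1.trans (by gcongr)
            _ = B * D * (P ^ (63 / 64 - 2 : ℝ) * P ^ (1 / 128 : ℝ)) := by rw [hB]; ring
            _ = _ := by
                rw [← Real.rpow_add (by linarith)]; norm_num
  have hcover : {t : ℝ | r ≤ |t|} ⊆ ⋃ n : ℤ, {t : ℝ | r ≤ |t|} ∩ Set.Icc (n : ℝ) (n + 1) := by
    rw [← Set.inter_iUnion, iUnion_Icc_intCast, Set.inter_univ]
  calc ∫⁻ t in {t : ℝ | r ≤ |t|}, F t ≤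
      ∫⁻ t in ⋃ n : ℤ, {t : ℝ | r ≤ |t|} ∩ Set.Icc (n : ℝ) (n + 1), F t :=
        MeasureTheory.lintegral_mono_set hcover
    _ ≤ ∑' n : ℤ, ∫⁻ t in {t : ℝ | r ≤ |t|} ∩ Set.Icc (n : ℝ) (n + 1), F t :=
        MeasureTheory.lintegral_iUnion_le _ _
    _ ≤ ∑' n : ℤ,
        ENNReal.ofReal (B * δ ^ (-(1 / 4) : ℝ) * (|(n : ℝ)| + 3) ^ (-(129 / 128) : ℝ)) :=
        ENNReal.tsum_le_tsum hstrip
    _ = ENNReal.ofReal (B * Z * δ ^ (-(1 / 4) : ℝ)) := by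
        rw [← ENNReal.ofReal_tsum_of_nonneg (fun n ↦ by positivity) (hsum.mul_left _), tsum_mul_left]
        rw [← hZ, mul_right_comm]

end IsQuarterRoot

lemma exists_eq_const_mul_of_pow_four_eq {V : Set ℂ} (hV : IsOpen V) (hc : Convex ℝ V)
    (hne : V.Nonempty) {f g : ℂ → ℂ} (hf : DifferentiableOn ℂ f V) (hg : DifferentiableOn ℂ g V)
    (hg0 : ∀ z ∈ V, g z ≠ 0) (h : ∀ z ∈ V, f z ^ 4 = g z ^ 4) :
    ∃ c : ℂ, c ≠ 0 ∧ ∀ z ∈ V, f z = c * g z := by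
  obtain ⟨z₀, hz₀⟩ := hne
  have hQ : DifferentiableOn ℂ (fun z ↦ f z / g z) V := hf.div hg hg0
  have hQ4 : ∀ z ∈ V, (f z / g z) ^ 4 = 1 := fun z hz ↦ by
    rw [div_pow, h z hz, div_self (pow_ne_zero _ (hg0 z hz))]
  have hQ0 : ∀ z ∈ V, f z / g z ≠ 0 := fun z hz h0 ↦ by
    have := hQ4 z hz
    rw [h0] at this
    norm_num at this
  have hd : V.EqOn (deriv fun z ↦ f z / g z) 0 := fun z hz ↦ by
    have hda := hQ.differentiableAt (hV.mem_nhds hz)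
    have e1 := (hda.hasDerivAt.pow 4).deriv
    have e2 : (fun z ↦ f z / g z) ^ 4 =ᶠ[nhds z] fun _ ↦ (1 : ℂ) := by
      filter_upwards [hV.mem_nhds hz] with y hy using hQ4 y hy
    rw [e2.deriv_eq, deriv_const] at e1
    have := mul_eq_zero.1 e1.symm
    rcases this with h1 | h1
    · exact absurd h1 (mul_ne_zero (by norm_num) (pow_ne_zero _ (hQ0 z hz)))
    · exact h1
  refine ⟨f z₀ / g z₀, hQ0 z₀ hz₀, fun z hz ↦ ?_⟩
  rw [hV.is_const_of_deriv_eq_zero hc.isPreconnected hQ hd hz₀ hz, div_mul_cancel₀ _ (hg0 z hz)]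

namespace IsQuarterRoot

variable {Λ b f : ℂ → ℂ} {e₁ e₂ : ℕ}

lemma exists_order (h : IsQuarterRoot Λ b f e₁ e₂) : ∃ (m : ℕ) (l : ℂ → ℂ),
    AnalyticAt ℂ l (1 / 2) ∧ l (1 / 2) ≠ 0 ∧
      ∀ᶠ z in nhds (1 / 2 : ℂ), Λ z = (z - 1 / 2) ^ m * l z := by
  have hA : AnalyticAt ℂ Λ (1 / 2) := h.bounds.diff.analyticAt _
  refine (hA.exists_eventuallyEq_pow_smul_nonzero_iff).2 fun h0 ↦ ?_
  obtain ⟨ε, hε, hball⟩ := Metric.eventually_nhds_iff_ball.1 h0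
  refine h.bounds.ne_zero (1 / 2 + (ε / 2 : ℝ)) ?_ (hball _ ?_)
  · simp; positivity
  · rw [Metric.mem_ball, dist_eq_norm, add_sub_cancel_left, Complex.norm_real,
      Real.norm_of_nonneg (by positivity)]
    linarith

lemma exists_local_pow_four (h : IsQuarterRoot Λ b f e₁ e₂) : ∃ (m : ℕ) (B : ℂ → ℂ) (r : ℝ),
    0 < r ∧ DifferentiableOn ℂ B (Metric.ball (1 / 2) r) ∧
      (∀ s ∈ Metric.ball (1 / 2 : ℂ) r, B s ≠ 0) ∧
      ∀ s ∈ Metric.ball (1 / 2 : ℂ) r, s ∈ halfPlane →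
        (f s / s) ^ 4 * (s - 1 / 2) ^ e₁ = (s - 1 / 2) ^ (2 * m + e₂) * B s := by
  obtain ⟨m, l, hl, hl0, hev⟩ := h.exists_order
  obtain ⟨U, hU, hU1, hUd⟩ := h.tame.diff
  have hbA : AnalyticAt ℂ b (2 * (1 / 2)) :=
    (hUd.analyticOnNhd hU) _ (hU1 (by simp))
  set B : ℂ → ℂ := fun s ↦ l s ^ 2 * (2 / (2 * s + 1)) ^ e₂ * ((2 * s + 1) / 2) ^ e₁ *
    b (2 * s) / s ^ 4 with hB
  have hBA : AnalyticAt ℂ B (1 / 2) := by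
    have h2 : AnalyticAt ℂ (fun s : ℂ ↦ 2 * s) (1 / 2) := by fun_prop
    have h3 : AnalyticAt ℂ (fun s ↦ b (2 * s)) (1 / 2) :=
      AnalyticAt.comp (g := b) (f := fun s ↦ 2 * s) hbA h2
    have h4 : AnalyticAt ℂ (fun s : ℂ ↦ 2 / (2 * s + 1)) (1 / 2) :=
      AnalyticAt.div (by fun_prop) (by fun_prop) (by norm_num)
    have h5 : AnalyticAt ℂ (fun s : ℂ ↦ (2 * s + 1) / 2) (1 / 2) :=
      AnalyticAt.div (by fun_prop) (by fun_prop) (by norm_num)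
    exact ((((hl.pow 2).mul (h4.pow _)).mul (h5.pow _)).mul h3).div (by fun_prop) (by norm_num)
  have hB0 : B (1 / 2) ≠ 0 := by
    have hb1 : b (2 * (1 / 2)) ≠ 0 := h.tame.ne_zero _ (by simp)
    simp only [hB]
    refine div_ne_zero (mul_ne_zero (mul_ne_zero (mul_ne_zero (pow_ne_zero _ hl0) ?_) ?_) hb1) ?_
      <;> refine pow_ne_zero _ ?_ <;> norm_num
  have hall := (hev.and (hBA.eventually_analyticAt.and
    (hBA.continuousAt.eventually_ne hB0)))
  obtain ⟨r, hr, hball⟩ := Metric.eventually_nhds_iff_ball.1 hall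
  refine ⟨m, B, r, hr, fun s hs ↦ (hball s hs).2.1.differentiableAt.differentiableWithinAt,
    fun s hs ↦ (hball s hs).2.2, fun s hs hsH ↦ ?_⟩
  have key := h.eq s hsH
  obtain ⟨hd1, hd2⟩ := moebius_denominators hsH
  have hs0 : s ≠ 0 := by
    rintro rfl
    simp [halfPlane] at hsH
    norm_num at hsH
  have hm : moebius s = (s - 1 / 2) * (2 / (2 * s + 1)) := by
    rw [moebius]; field_simp
  rw [(hball s hs).1, hm, mul_pow, mul_pow _ _ e₂] at key
  have hX : (2 / (2 * s + 1)) ^ e₁ * ((2 * s + 1) / 2) ^ e₁ = 1 := by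
    rw [← mul_pow, div_mul_div_comm, mul_comm, div_self (mul_ne_zero hd2 (by norm_num)), one_pow]
  simp only [hB]
  rw [div_pow, div_mul_eq_mul_div, mul_div_assoc', div_left_inj' (pow_ne_zero _ hs0)]
  calc f s ^ 4 * (s - 1 / 2) ^ e₁ =
      (f s ^ 4 * ((s - 1 / 2) ^ e₁ * (2 / (2 * s + 1)) ^ e₁)) * ((2 * s + 1) / 2) ^ e₁ := by
        linear_combination (-(f s ^ 4 * (s - 1 / 2) ^ e₁)) * hX
    _ = _ := by rw [key]; ring

lemma exists_local_factor (h : IsQuarterRoot Λ b f e₁ e₂) : ∃ (k : ℤ) (a : ℂ → ℂ) (r : ℝ),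
    0 < r ∧ -1 ≤ k ∧ (e₁ = 0 → 0 ≤ k) ∧ DifferentiableOn ℂ a (Metric.ball (1 / 2) r) ∧
      ∀ s ∈ Metric.ball (1 / 2 : ℂ) r, s ∈ halfPlane →
        f s / s = (s - 1 / 2) ^ ((k : ℂ) / 4) * a s := by
  obtain ⟨m, B, r, hr, hBd, hB0, hB⟩ := h.exists_local_pow_four
  obtain ⟨g, hg, hge⟩ := exists_holomorphic_log Metric.isOpen_ball (convex_ball (1 / 2 : ℂ) r)
    ⟨1 / 2, Metric.mem_ball_self hr⟩ hBd hB0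
  have hle := h.le₁
  set k : ℤ := 2 * m + e₂ - e₁ with hk
  set V : Set ℂ := Metric.ball (1 / 2) r ∩ halfPlane with hV
  have hslit : ∀ s ∈ halfPlane, s - 1 / 2 ∈ Complex.slitPlane := fun s hs ↦ by
    simp only [halfPlane, Set.mem_ofPred_eq] at hs
    refine Or.inl ?_
    simp; linarith
  have hne0 : ∀ s ∈ halfPlane, s - 1 / 2 ≠ 0 := fun s hs ↦ Complex.slitPlane_ne_zero (hslit s hs)
  have hs0 : ∀ s ∈ halfPlane, s ≠ 0 := by
    rintro s hs rfl
    simp [halfPlane] at hs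
    norm_num at hs
  have hcp : DifferentiableOn ℂ (fun s : ℂ ↦ (s - 1 / 2) ^ ((k : ℂ) / 4)) halfPlane := fun s hs ↦
    ((differentiableAt_id.sub_const _).cpow_const (hslit s hs)).differentiableWithinAt
  obtain ⟨c, hc, hcV⟩ := exists_eq_const_mul_of_pow_four_eq (V := V)
    (Metric.isOpen_ball.inter isOpen_halfPlane) ((convex_ball _ _).inter convex_halfPlane)
    ⟨1 / 2 + (r / 2 : ℝ), by
      constructor
      · rw [Metric.mem_ball, dist_eq_norm, add_sub_cancel_left, Complex.norm_real,
          Real.norm_of_nonneg (by positivity)]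
        linarith
      · simp [halfPlane]; positivity⟩
    (f := fun s ↦ f s / s) (g := fun s ↦ (s - 1 / 2) ^ ((k : ℂ) / 4) * exp (g s / 4))
    ((h.diff.mono Set.inter_subset_right).div differentiableOn_id fun s hs ↦ hs0 s hs.2)
    ((hcp.mono Set.inter_subset_right).mul ((hg.mono Set.inter_subset_left).div_const 4).cexp)
    (fun s hs ↦ mul_ne_zero (by rw [Ne, Complex.cpow_eq_zero_iff]; exact fun hh ↦ hne0 s hs.2 hh.1)
      (Complex.exp_ne_zero _))
    (fun s hs ↦ by
      have e1 : ((s - 1 / 2) ^ ((k : ℂ) / 4)) ^ 4 = (s - 1 / 2) ^ k := by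
        rw [← Complex.cpow_nat_mul, ← Complex.cpow_intCast]
        congr 1
        push_cast
        ring
      have e2 : exp (g s / 4) ^ 4 = B s := by
        rw [← Complex.exp_nat_mul, ← hge s hs.1]
        congr 1
        push_cast
        ring
      have hw := hne0 s hs.2
      simp only [mul_pow]
      rw [e1, e2]
      have e3 : (s - 1 / 2) ^ k = (s - 1 / 2) ^ (2 * m + e₂) / (s - 1 / 2) ^ e₁ := by
        rw [hk, zpow_sub₀ hw, zpow_natCast]
        congr 1
      rw [e3, div_mul_eq_mul_div, ← hB s hs.1 hs.2, mul_div_cancel_right₀ _ (pow_ne_zero _ hw)])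
  refine ⟨k, fun s ↦ c * exp (g s / 4), r, hr, by omega, by omega,
    (hg.div_const 4).cexp.const_mul c, fun s hs hsH ↦ ?_⟩
  rw [hcV s ⟨hs, hsH⟩]
  ring

end IsQuarterRoot

/-- The derivative of `f s / s` with its possible singular parts at `1 / 2` removed. -/
def regularPart (f : ℂ → ℂ) (α β : ℂ) (s : ℂ) : ℂ :=
  deriv (fun z ↦ f z / z) s + α * (s - 1 / 2) ^ (-(5 / 4) : ℂ) - β * (s - 1 / 2) ^ (-(3 / 4) : ℂ)

lemma sub_half_mem_slitPlane {s : ℂ} (hs : s ∈ halfPlane) : s - 1 / 2 ∈ Complex.slitPlane := by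
  simp only [halfPlane, Set.mem_ofPred_eq] at hs
  refine Or.inl ?_
  simp; linarith

lemma ne_zero_of_mem_halfPlane {s : ℂ} (hs : s ∈ halfPlane) : s ≠ 0 := by
  rintro rfl
  simp [halfPlane] at hs
  norm_num at hs

lemma differentiableOn_regularPart {f : ℂ → ℂ} (hf : DifferentiableOn ℂ f halfPlane) (α β : ℂ) :
    DifferentiableOn ℂ (regularPart f α β) halfPlane := by
  have hc : ∀ c : ℂ, DifferentiableOn ℂ (fun s : ℂ ↦ (s - 1 / 2) ^ c) halfPlane := fun c s hs ↦
    ((differentiableAt_id.sub_const _).cpow_const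
      (sub_half_mem_slitPlane hs)).differentiableWithinAt
  refine DifferentiableOn.sub (DifferentiableOn.add ?_ ((hc _).const_mul _)) ((hc _).const_mul _)
  exact (hf.div differentiableOn_id fun s hs ↦ ne_zero_of_mem_halfPlane hs).deriv isOpen_halfPlane

lemma norm_cpow_neg_five_quarters (w : ℂ) :
    ‖w ^ (-(5 / 4) : ℂ)‖ = ‖w‖ ^ (-(5 / 4) : ℝ) := by
  rw [← Complex.norm_cpow_real]; push_cast; rfl

lemma norm_cpow_neg_three_quarters (w : ℂ) :
    ‖w ^ (-(3 / 4) : ℂ)‖ = ‖w‖ ^ (-(3 / 4) : ℝ) := by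
  rw [← Complex.norm_cpow_real]; push_cast; rfl

lemma norm_mul_cpow_add_le {κ x M : ℝ} {w d e : ℂ} (hx : ‖w‖ = x) (hx0 : 0 < x) (hx1 : x ≤ 1)
    (hκ : -(1 / 4) ≤ κ) (hd : κ = 0 ∨ ‖d‖ ≤ M * x ∨ (1 / 2 ≤ κ ∧ ‖d‖ ≤ M)) (he : ‖e‖ ≤ M) :
    ‖κ * w ^ ((κ - 1 : ℝ) : ℂ) * d + w ^ (κ : ℂ) * e‖ ≤ (|κ| + 1) * M * x ^ (-(1 / 2) : ℝ) := by
  have hM : 0 ≤ M := (norm_nonneg _).trans he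
  have hmono : ∀ p : ℝ, -(1 / 2) ≤ p → x ^ p ≤ x ^ (-(1 / 2) : ℝ) := fun p hp ↦
    Real.rpow_le_rpow_of_exponent_ge hx0 hx1 hp
  have h2 : ‖w ^ (κ : ℂ) * e‖ ≤ x ^ (-(1 / 2) : ℝ) * M := by
    rw [norm_mul, Complex.norm_cpow_real, hx]
    exact mul_le_mul (hmono κ (by linarith)) he (norm_nonneg _) (by positivity)
  have h1 : ‖κ * w ^ ((κ - 1 : ℝ) : ℂ) * d‖ ≤ |κ| * (x ^ (-(1 / 2) : ℝ) * M) := by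
    rw [mul_assoc, norm_mul, Complex.norm_real, Real.norm_eq_abs, norm_mul, Complex.norm_cpow_real,
      hx]
    rcases hd with hd | hd | ⟨hd1, hd2⟩
    · rw [hd]; simp
    · refine mul_le_mul_of_nonneg_left ?_ (abs_nonneg _)
      calc x ^ (κ - 1) * ‖d‖ ≤ x ^ (κ - 1) * (M * x) := by gcongr
        _ = x ^ κ * M := by rw [Real.rpow_sub_one hx0.ne']; field_simp
        _ ≤ _ := mul_le_mul_of_nonneg_right (hmono κ (by linarith)) hM
    · exact mul_le_mul_of_nonneg_left
        (mul_le_mul (hmono (κ - 1) (by linarith)) hd2 (norm_nonneg _) (by positivity)) (abs_nonneg _)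
  calc _ ≤ _ := norm_add_le _ _
    _ ≤ _ := add_le_add h1 h2
    _ = _ := by ring

namespace IsQuarterRoot

variable {Λ b f : ℂ → ℂ} {e₁ e₂ : ℕ}

lemma exists_local_expansion (h : IsQuarterRoot Λ b f e₁ e₂) : ∃ (α β : ℂ) (r C : ℝ),
    0 < r ∧ 0 < C ∧ (e₁ = 0 → α = 0) ∧
      Tendsto (fun δ : ℝ ↦ (δ : ℂ) ^ (1 / 4 : ℂ) * f (1 / 2 + δ)) (nhdsWithin 0 (Set.Ioi 0))
        (nhds (2 * α)) ∧
      ∀ s ∈ halfPlane, ‖s - 1 / 2‖ < r →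
        ‖regularPart f α β s‖ ≤ C * ‖s - 1 / 2‖ ^ (-(1 / 2) : ℝ) := by
  obtain ⟨k, a, r, hr, hk, hk0, had, hfa⟩ := h.exists_local_factor
  set κ : ℝ := k / 4 with hκ
  have hκc : (k : ℂ) / 4 = (κ : ℂ) := by rw [hκ]; push_cast; rfl
  have hκ1 : -(1 / 4) ≤ κ := by
    have : (-1 : ℝ) ≤ k := by exact_mod_cast hk
    rw [hκ]; linarith
  set ρ : ℝ := min (r / 2) 1 with hρ
  have hρ0 : 0 < ρ := by positivity
  have hsub : Metric.closedBall (1 / 2 : ℂ) ρ ⊆ Metric.ball (1 / 2) r := by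
    refine Metric.closedBall_subset_ball ?_
    have : ρ ≤ r / 2 := min_le_left _ _
    linarith
  have hcpt : IsCompact (Metric.closedBall (1 / 2 : ℂ) ρ) := isCompact_closedBall _ _
  obtain ⟨M1, hM1⟩ := hcpt.exists_bound_of_continuousOn (had.continuousOn.mono hsub)
  obtain ⟨M2, hM2⟩ := hcpt.exists_bound_of_continuousOn
    ((had.deriv Metric.isOpen_ball).continuousOn.mono hsub)
  set M : ℝ := max (max M1 M2) 1 with hM
  have hMM1 : M1 ≤ M := (le_max_left _ _).trans (le_max_left _ _)
  have hMM2 : M2 ≤ M := (le_max_right _ _).trans (le_max_left _ _)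
  have hMpos : 0 < M := lt_of_lt_of_le one_pos (le_max_right _ _)
  have hadA : ∀ s ∈ Metric.closedBall (1 / 2 : ℂ) ρ, DifferentiableAt ℂ a s := fun s hs ↦
    had.differentiableAt (Metric.isOpen_ball.mem_nhds (hsub hs))
  have hlip : ∀ s ∈ Metric.closedBall (1 / 2 : ℂ) ρ, ‖a s - a (1 / 2)‖ ≤ M * ‖s - 1 / 2‖ :=
    fun s hs ↦ (convex_closedBall _ _).norm_image_sub_le_of_norm_deriv_le hadA
      (fun x hx ↦ (hM2 x hx).trans hMM2) (Metric.mem_closedBall_self hρ0.le) hs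
  have hder : ∀ s ∈ halfPlane, ‖s - 1 / 2‖ < ρ → deriv (fun z ↦ f z / z) s =
      κ * (s - 1 / 2) ^ ((κ - 1 : ℝ) : ℂ) * a s + (s - 1 / 2) ^ (κ : ℂ) * deriv a s := by
    intro s hs hsρ
    have hsb : s ∈ Metric.closedBall (1 / 2 : ℂ) ρ := by
      rw [Metric.mem_closedBall, dist_eq_norm]; exact hsρ.le
    have hev : (fun z ↦ f z / z) =ᶠ[nhds s] fun z ↦ (z - 1 / 2) ^ (κ : ℂ) * a z := by
      filter_upwards [isOpen_halfPlane.mem_nhds hs, Metric.isOpen_ball.mem_nhds (hsub hsb)]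
        with z hz hzb
      rw [hfa z hzb hz, hκc]
    rw [hev.deriv_eq]
    have hd := (((hasDerivAt_id s).sub_const (1 / 2)).cpow_const (c := (κ : ℂ))
      (sub_half_mem_slitPlane hs)).mul (hadA s hsb).hasDerivAt
    refine hd.deriv.trans ?_
    simp
  have hxb : ∀ s ∈ halfPlane, ‖s - 1 / 2‖ < ρ → 0 < ‖s - 1 / 2‖ ∧ ‖s - 1 / 2‖ ≤ 1 ∧
      s ∈ Metric.closedBall (1 / 2 : ℂ) ρ := fun s hs hsρ ↦
    ⟨norm_pos_iff.2 (Complex.slitPlane_ne_zero (sub_half_mem_slitPlane hs)),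
      hsρ.le.trans (min_le_right _ _), by rw [Metric.mem_closedBall, dist_eq_norm]; exact hsρ.le⟩
  refine ⟨if k = -1 then a (1 / 2) / 4 else 0, if k = 1 then a (1 / 2) / 4 else 0, ρ,
    (|κ| + 1) * M, hρ0, by positivity, fun he ↦ ?_, ?_, fun s hs hsρ ↦ ?_⟩
  · have := hk0 he
    rw [if_neg (by omega)]
  · have hev : ∀ᶠ δ : ℝ in nhdsWithin 0 (Set.Ioi 0), (1 / 2 + (δ : ℂ)) *
        ((δ : ℂ) ^ ((κ + 1 / 4 : ℝ) : ℂ) * a (1 / 2 + δ)) =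
        (δ : ℂ) ^ (1 / 4 : ℂ) * f (1 / 2 + δ) := by
      filter_upwards [self_mem_nhdsWithin, nhdsWithin_le_nhds (Iio_mem_nhds hρ0)] with δ hδ hδρ
      have hδ' : (0 : ℝ) < δ := hδ
      have hδ0 : (δ : ℂ) ≠ 0 := by exact_mod_cast hδ'.ne'
      have hmem : (1 / 2 + (δ : ℂ)) ∈ halfPlane := by simp [halfPlane]; exact hδ
      have := hfa (1 / 2 + δ) (hsub (by
        rw [Metric.mem_closedBall, dist_eq_norm, add_sub_cancel_left, Complex.norm_real,
          Real.norm_of_nonneg hδ'.le]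
        exact (Set.mem_Iio.1 hδρ).le)) hmem
      rw [div_eq_iff (ne_zero_of_mem_halfPlane hmem), add_sub_cancel_left, hκc] at this
      rw [this]
      push_cast
      rw [Complex.cpow_add _ _ hδ0]
      ring
    refine Tendsto.congr' hev ?_
    have ha : Tendsto (fun δ : ℝ ↦ a (1 / 2 + (δ : ℂ))) (nhdsWithin 0 (Set.Ioi 0))
        (nhds (a (1 / 2))) := by
      have hca : ContinuousAt a (1 / 2 + ((0 : ℝ) : ℂ)) := by
        rw [Complex.ofReal_zero, add_zero]
        exact (hadA _ (Metric.mem_closedBall_self hρ0.le)).continuousAt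
      have hcc : ContinuousAt (fun δ : ℝ ↦ a (1 / 2 + (δ : ℂ))) 0 :=
        ContinuousAt.comp (f := fun δ : ℝ ↦ 1 / 2 + (δ : ℂ)) (g := a) hca (by fun_prop)
      have := hcc.tendsto
      simp only [Complex.ofReal_zero, add_zero] at this
      exact this.mono_left nhdsWithin_le_nhds
    have hb' : Tendsto (fun δ : ℝ ↦ 1 / 2 + (δ : ℂ)) (nhdsWithin 0 (Set.Ioi 0))
        (nhds (1 / 2)) := by
      have hcc : ContinuousAt (fun δ : ℝ ↦ 1 / 2 + (δ : ℂ)) 0 := by fun_prop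
      have := hcc.tendsto
      simp only [Complex.ofReal_zero, add_zero] at this
      exact this.mono_left nhdsWithin_le_nhds
    split_ifs with hk1
    · have : κ + 1 / 4 = 0 := by rw [hκ, hk1]; norm_num
      simp only [this, Complex.ofReal_zero, Complex.cpow_zero, one_mul]
      convert hb'.mul ha using 2
      ring
    · have hpos : 0 < κ + 1 / 4 := by
        have : (0 : ℝ) ≤ k := by exact_mod_cast (by omega : (0 : ℤ) ≤ k)
        rw [hκ]; positivity
      have hp : Tendsto (fun δ : ℝ ↦ (δ : ℂ) ^ ((κ + 1 / 4 : ℝ) : ℂ)) (nhdsWithin 0 (Set.Ioi 0))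
          (nhds 0) := by
        rw [tendsto_zero_iff_norm_tendsto_zero]
        simp only [Complex.norm_cpow_real, Complex.norm_real]
        have : ContinuousAt (fun δ : ℝ ↦ ‖δ‖ ^ (κ + 1 / 4)) 0 :=
          (continuous_norm.continuousAt).rpow_const (Or.inr hpos.le)
        have := this.tendsto
        simp only [norm_zero, Real.zero_rpow hpos.ne'] at this
        exact this.mono_left nhdsWithin_le_nhds
      convert hb'.mul (hp.mul ha) using 2
      simp
  · obtain ⟨hx0, hx1, hsb⟩ := hxb s hs hsρ
    have hae := (hM2 s hsb).trans hMM2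
    rw [regularPart, hder s hs hsρ]
    by_cases hkm : k = -1
    · have hκv : κ = -(1 / 4) := by rw [hκ, hkm]; norm_num
      have := norm_mul_cpow_add_le (w := s - 1 / 2) (d := a s - a (1 / 2)) rfl hx0 hx1 hκ1
        (Or.inr (Or.inl (hlip s hsb))) hae
      refine le_of_eq_of_le (congrArg norm ?_) this
      rw [if_pos hkm, if_neg (by omega), hκv, show (-(1 / 4) - 1 : ℝ) = -(5 / 4) by norm_num]
      push_cast
      ring
    · by_cases hkp : k = 1
      · have hκv : κ = 1 / 4 := by rw [hκ, hkp]; norm_num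
        have := norm_mul_cpow_add_le (w := s - 1 / 2) (d := a s - a (1 / 2)) rfl hx0 hx1 hκ1
          (Or.inr (Or.inl (hlip s hsb))) hae
        refine le_of_eq_of_le (congrArg norm ?_) this
        rw [if_neg (by omega), if_pos hkp, hκv, show (1 / 4 - 1 : ℝ) = -(3 / 4) by norm_num]
        push_cast
        ring
      · rw [if_neg hkm, if_neg hkp, zero_mul, zero_mul, add_zero, sub_zero]
        refine norm_mul_cpow_add_le rfl hx0 hx1 hκ1 ?_ hae
        rcases eq_or_ne k 0 with h0 | h0
        · left; rw [hκ, h0]; norm_num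
        · refine Or.inr (Or.inr ⟨?_, (hM1 s hsb).trans hMM1⟩)
          have : (2 : ℝ) ≤ k := by exact_mod_cast (by omega : (2 : ℤ) ≤ k)
          rw [hκ]; linarith

end IsQuarterRoot

lemma norm_regularPart_sq_le (f : ℂ → ℂ) (α β : ℂ) (s : ℂ) :
    ‖regularPart f α β s‖ ^ 2 ≤ 3 * (‖deriv (fun z ↦ f z / z) s‖ ^ 2 +
      ‖α‖ ^ 2 * (‖s - 1 / 2‖ ^ (-(5 / 4) : ℝ)) ^ 2 +
      ‖β‖ ^ 2 * (‖s - 1 / 2‖ ^ (-(3 / 4) : ℝ)) ^ 2) := by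
  have h : ‖regularPart f α β s‖ ≤ ‖deriv (fun z ↦ f z / z) s‖ +
      ‖α‖ * ‖s - 1 / 2‖ ^ (-(5 / 4) : ℝ) + ‖β‖ * ‖s - 1 / 2‖ ^ (-(3 / 4) : ℝ) := by
    rw [regularPart, ← norm_cpow_neg_five_quarters, ← norm_cpow_neg_three_quarters, ← norm_mul,
      ← norm_mul]
    exact (norm_sub_le _ _).trans (add_le_add_left (norm_add_le _ _) _)
  have h0 := norm_nonneg (regularPart f α β s)
  generalize ‖s - 1 / 2‖ ^ (-(5 / 4) : ℝ) = x at *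
  generalize ‖s - 1 / 2‖ ^ (-(3 / 4) : ℝ) = y at *
  generalize ‖deriv (fun z ↦ f z / z) s‖ = d at *
  rw [← mul_pow, ← mul_pow]
  generalize ‖α‖ * x = u at *
  generalize ‖β‖ * y = v at *
  have := pow_le_pow_left₀ h0 h 2
  nlinarith [sq_nonneg (d - u), sq_nonneg (d - v), sq_nonneg (u - v)]

lemma rpow_neg_norm_le {r t x p : ℝ} (hr : 0 < r) (hr1 : r ≤ 1) (ht : r ≤ |t|) (hx : |t| ≤ x)
    (hp : 3 / 4 ≤ p) :
    (x ^ (-p)) ^ 2 ≤ ((r / 2) ^ (-p)) ^ 2 * (1 + ‖t‖) ^ (-(3 / 2) : ℝ) := by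
  have h1 : r / 2 * (1 + |t|) ≤ x := by nlinarith
  have h0 : 0 < 1 + |t| := by positivity
  have h2 : x ^ (-p) ≤ (r / 2) ^ (-p) * (1 + |t|) ^ (-(3 / 4) : ℝ) := by
    calc x ^ (-p) ≤ (r / 2 * (1 + |t|)) ^ (-p) :=
          Real.rpow_le_rpow_of_nonpos (by positivity) h1 (by linarith)
      _ = (r / 2) ^ (-p) * (1 + |t|) ^ (-p) := Real.mul_rpow (by positivity) h0.le
      _ ≤ _ := by
          refine mul_le_mul_of_nonneg_left ?_ (by positivity)
          exact Real.rpow_le_rpow_of_exponent_le (by linarith [abs_nonneg t]) (by linarith)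
  have hx0 : 0 ≤ x := (abs_nonneg t).trans hx
  calc _ ≤ _ := pow_le_pow_left₀ (by positivity) h2 2
    _ = _ := by
      rw [mul_pow, ← Real.rpow_natCast ((1 + |t|) ^ (-(3 / 4) : ℝ)), ← Real.rpow_mul h0.le,
        Real.norm_eq_abs]
      norm_num

namespace IsQuarterRoot

open MeasureTheory

variable {Λ b f : ℂ → ℂ} {e₁ e₂ : ℕ}

lemma exists_lintegral_regularPart_far_le (h : IsQuarterRoot Λ b f e₁ e₂) (α β : ℂ) {r : ℝ}
    (hr : 0 < r) (hr1 : r ≤ 1) : ∃ K, 0 < K ∧ ∀ δ : ℝ, 0 < δ → δ ≤ 1 / 8 →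
      ∫⁻ t in {t : ℝ | r ≤ |t|},
        ENNReal.ofReal (‖regularPart f α β ((1 / 2 + δ : ℝ) + t * I)‖ ^ 2) ≤
      ENNReal.ofReal (K * δ ^ (-(1 / 4) : ℝ)) := by
  obtain ⟨C, hC, hCb⟩ := h.exists_lintegral_deriv_div_le hr
  have h_int : Integrable (fun t : ℝ ↦ (1 + ‖t‖) ^ (-(3 / 2) : ℝ)) :=
    integrable_one_add_norm (by norm_num)
  set J : ℝ := ∫ t : ℝ, (1 + ‖t‖) ^ (-(3 / 2) : ℝ) with hJ
  have hJ0 : 0 ≤ J := integral_nonneg fun t ↦ by positivity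
  have hJe : ∫⁻ t : ℝ, ENNReal.ofReal ((1 + ‖t‖) ^ (-(3 / 2) : ℝ)) = ENNReal.ofReal J :=
    (ofReal_integral_eq_lintegral_ofReal h_int (ae_of_all _ fun t ↦ by positivity)).symm
  set L : ℝ := 3 * (‖α‖ ^ 2 * ((r / 2) ^ (-(5 / 4) : ℝ)) ^ 2 +
    ‖β‖ ^ 2 * ((r / 2) ^ (-(3 / 4) : ℝ)) ^ 2) with hL
  have hL0 : 0 ≤ L := by positivity
  refine ⟨3 * C + L * J, by positivity, fun δ hδ hδ' ↦ ?_⟩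
  have hpt : ∀ t ∈ {t : ℝ | r ≤ |t|},
      ENNReal.ofReal (‖regularPart f α β ((1 / 2 + δ : ℝ) + t * I)‖ ^ 2) ≤
      ENNReal.ofReal 3 *
        ENNReal.ofReal (‖deriv (fun s ↦ f s / s) ((1 / 2 + δ : ℝ) + t * I)‖ ^ 2) +
      ENNReal.ofReal L * ENNReal.ofReal ((1 + ‖t‖) ^ (-(3 / 2) : ℝ)) := by
    intro t ht
    have ht' : r ≤ |t| := ht
    rw [← ENNReal.ofReal_mul (by norm_num), ← ENNReal.ofReal_mul hL0,
      ← ENNReal.ofReal_add (by positivity) (by positivity)]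
    refine ENNReal.ofReal_le_ofReal ((norm_regularPart_sq_le f α β _).trans ?_)
    have hx : |t| ≤ ‖((1 / 2 + δ : ℝ) + t * I : ℂ) - 1 / 2‖ := by
      refine le_trans (le_of_eq ?_) (Complex.abs_im_le_norm _)
      simp
    have h5 := mul_le_mul_of_nonneg_left
      (rpow_neg_norm_le hr hr1 ht' hx (p := 5 / 4) (by norm_num)) (sq_nonneg ‖α‖)
    have h3 := mul_le_mul_of_nonneg_left
      (rpow_neg_norm_le hr hr1 ht' hx (p := 3 / 4) (by norm_num)) (sq_nonneg ‖β‖)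
    rw [hL]
    linarith
  have hmeas : Measurable fun t : ℝ ↦ ENNReal.ofReal L *
      ENNReal.ofReal ((1 + ‖t‖) ^ (-(3 / 2) : ℝ)) := by fun_prop
  calc _ ≤ ∫⁻ t in {t : ℝ | r ≤ |t|}, (ENNReal.ofReal 3 *
        ENNReal.ofReal (‖deriv (fun s ↦ f s / s) ((1 / 2 + δ : ℝ) + t * I)‖ ^ 2) +
      ENNReal.ofReal L * ENNReal.ofReal ((1 + ‖t‖) ^ (-(3 / 2) : ℝ))) :=
        setLIntegral_mono' (measurableSet_le measurable_const measurable_id.abs) hpt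
    _ ≤ ENNReal.ofReal 3 * ENNReal.ofReal (C * δ ^ (-(1 / 4) : ℝ)) +
        ENNReal.ofReal L * ENNReal.ofReal J := by
        rw [lintegral_add_right _ hmeas, lintegral_const_mul' _ _ ENNReal.ofReal_ne_top,
          lintegral_const_mul' _ _ ENNReal.ofReal_ne_top]
        gcongr
        · exact hCb δ hδ hδ'
        · rw [← hJe]; exact setLIntegral_le_lintegral _ _
    _ ≤ _ := by
        rw [← ENNReal.ofReal_mul (by norm_num), ← ENNReal.ofReal_mul hL0,
          ← ENNReal.ofReal_add (by positivity) (by positivity)]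
        refine ENNReal.ofReal_le_ofReal ?_
        have : 1 ≤ δ ^ (-(1 / 4) : ℝ) :=
          Real.one_le_rpow_of_pos_of_le_one_of_nonpos hδ (by linarith) (by norm_num)
        nlinarith [mul_nonneg hL0 hJ0]

lemma exists_lintegral_regularPart_le (h : IsQuarterRoot Λ b f e₁ e₂) {α β : ℂ} {r C : ℝ}
    (hr : 0 < r) (hC : 0 < C) (hloc : ∀ s ∈ halfPlane, ‖s - 1 / 2‖ < r →
        ‖regularPart f α β s‖ ≤ C * ‖s - 1 / 2‖ ^ (-(1 / 2) : ℝ)) :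
    ∃ δ₀ K, 0 < δ₀ ∧ 0 < K ∧ ∀ δ : ℝ, 0 < δ → δ ≤ δ₀ →
      ∫⁻ t : ℝ, ENNReal.ofReal (‖regularPart f α β ((1 / 2 + δ : ℝ) + t * I)‖ ^ 2) ≤
      ENNReal.ofReal (K * δ ^ (-(1 / 4) : ℝ)) := by
  set ρ : ℝ := min (r / 2) (1 / 2) with hρ
  have hρ0 : 0 < ρ := by positivity
  have hρr : ρ ≤ r / 2 := min_le_left _ _
  have hρ1 : ρ ≤ 1 / 2 := min_le_right _ _
  obtain ⟨K, hK, hKb⟩ := h.exists_lintegral_regularPart_far_le α β hρ0 (by linarith)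
  obtain ⟨K', hK', hKb'⟩ := exists_lintegral_inv_norm_le
  refine ⟨min ρ (1 / 8), K + C ^ 2 * (K' + K'), by positivity, by positivity, fun δ hδ hδ' ↦ ?_⟩
  have hδρ : δ ≤ ρ := hδ'.trans (min_le_left _ _)
  have hδ8 : δ ≤ 1 / 8 := hδ'.trans (min_le_right _ _)
  have hms : MeasurableSet {t : ℝ | ρ ≤ |t|} := measurableSet_le measurable_const measurable_id.abs
  rw [← lintegral_add_compl _ hms]
  have hnear : ∀ t ∈ {t : ℝ | ρ ≤ |t|}ᶜ,
      ENNReal.ofReal (‖regularPart f α β ((1 / 2 + δ : ℝ) + t * I)‖ ^ 2) ≤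
      ENNReal.ofReal (C ^ 2) *
        ENNReal.ofReal ‖((1 / 2 + δ : ℝ) + t * I : ℂ) - (1 / 2 : ℂ)‖⁻¹ := by
    intro t ht
    have ht' : |t| < ρ := by simpa using ht
    rw [← ENNReal.ofReal_mul (by positivity)]
    refine ENNReal.ofReal_le_ofReal ?_
    have hw : ‖((1 / 2 + δ : ℝ) + t * I : ℂ) - (1 / 2 : ℂ)‖ < r := by
      have : ((1 / 2 + δ : ℝ) + t * I : ℂ) - (1 / 2 : ℂ) = (δ : ℂ) + t * I := by push_cast; ring
      rw [this]
      refine (norm_add_le _ _).trans_lt ?_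
      simp only [Complex.norm_real, norm_mul, Complex.norm_I, mul_one, Real.norm_eq_abs,
        abs_of_pos hδ]
      linarith
    have hb := hloc ((1 / 2 + δ : ℝ) + t * I) (by simp [halfPlane, hδ]) hw
    calc _ ≤ _ := pow_le_pow_left₀ (norm_nonneg _) hb 2
      _ = _ := by
        rw [mul_pow, ← Real.rpow_natCast (‖_‖ ^ (_ : ℝ)), ← Real.rpow_mul (norm_nonneg _)]
        norm_num [Real.rpow_neg_one]
  have hsub : {t : ℝ | ρ ≤ |t|}ᶜ ⊆ Set.Icc (-1) (-1 + 1) ∪ Set.Icc 0 (0 + 1) := by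
    intro t ht
    have ht' : |t| < ρ := by simpa using ht
    obtain ⟨h1, h2⟩ := abs_lt.1 ht'
    rcases le_total t 0 with h0 | h0
    · left; constructor <;> linarith
    · right; constructor <;> linarith
  have hre : (1 / 2 : ℂ).re ≤ 1 / 2 := by norm_num
  calc _ ≤ ENNReal.ofReal (K * δ ^ (-(1 / 4) : ℝ)) + ENNReal.ofReal (C ^ 2) *
        (ENNReal.ofReal (K' * δ ^ (-(1 / 4) : ℝ)) + ENNReal.ofReal (K' * δ ^ (-(1 / 4) : ℝ))) := by
        refine add_le_add (hKb δ hδ hδ8) ?_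
        refine (setLIntegral_mono' hms.compl hnear).trans ?_
        rw [lintegral_const_mul' _ _ ENNReal.ofReal_ne_top]
        refine mul_le_mul_right ?_ _
        refine (lintegral_mono_set hsub).trans ((lintegral_union_le _ _ _).trans ?_)
        exact add_le_add (hKb' _ δ (-1) hre hδ (by linarith)) (hKb' _ δ 0 hre hδ (by linarith))
    _ = _ := by
        rw [← ENNReal.ofReal_add (by positivity) (by positivity),
          ← ENNReal.ofReal_mul (by positivity), ← ENNReal.ofReal_add (by positivity) (by positivity)]
        congr 1
        ring

end IsQuarterRoot

lemma exists_norm_sqFactor_le {N : ℕ} [NeZero N] (χ : DirichletCharacter ℂ N) {σ : ℝ}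
    (hσ : 1 / 2 < σ) : ∃ M, 0 < M ∧ ∀ s : ℂ, σ ≤ s.re → ‖sqFactor χ s‖ ≤ M := by
  obtain ⟨m, M, hm, hM, hb⟩ := exists_norm_threeSeries_bounds (χ ^ 2) (σ := 2 * σ) (by linarith)
  set x : ℝ := 2 ^ (-(1 / 2) : ℝ) with hx
  have hx1 : x < 1 := Real.rpow_lt_one_of_one_lt_of_neg (by norm_num) (by norm_num)
  have hx1' : 0 < 1 - x := by linarith
  refine ⟨M / (1 - x), by positivity, fun s hs ↦ ?_⟩
  have h1 := (hb (2 * s) (by simp; linarith)).2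
  have h2 : ‖χ ((2 : ℕ) : ZMod N) * ((2 : ℕ) : ℂ) ^ (-s)‖ ≤ x := by
    rw [norm_mul, Complex.norm_natCast_cpow_of_pos (by norm_num)]
    calc _ ≤ 1 * ((2 : ℕ) : ℝ) ^ (-s).re := by gcongr; exact χ.norm_le_one _
      _ ≤ x := by
        rw [one_mul, hx, Nat.cast_two]
        refine Real.rpow_le_rpow_of_exponent_le (by norm_num) ?_
        simp; linarith
  have h3 : 1 - x ≤ ‖1 - χ ((2 : ℕ) : ZMod N) * ((2 : ℕ) : ℂ) ^ (-s)‖ := by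
    have := norm_sub_norm_le (1 : ℂ) (χ ((2 : ℕ) : ZMod N) * ((2 : ℕ) : ℂ) ^ (-s))
    rw [norm_one] at this
    linarith
  rw [sqFactor, norm_div]
  exact div_le_div₀ hM.le h1 hx1' h3

lemma exists_norm_regularPart_le {N : ℕ} [NeZero N] {χ : DirichletCharacter ℂ N} {f : ℂ → ℂ}
    (hΛ : PairLBounds (pairL χ)) (hf : DifferentiableOn ℂ f halfPlane)
    (hsq : ∀ s ∈ halfPlane, f s ^ 2 = pairL χ s * sqFactor χ s) (α β : ℂ) {σ : ℝ}
    (hσ : 1 / 2 < σ) : ∃ B, 0 < B ∧ ∀ s : ℂ, σ ≤ s.re → ‖regularPart f α β s‖ ≤ B := by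
  set δ : ℝ := (σ - 1 / 2) / 2 with hδ
  have hδ0 : 0 < δ := by rw [hδ]; linarith
  obtain ⟨M, hM, hMb⟩ := exists_norm_sqFactor_le χ (σ := 1 / 2 + δ) (by linarith)
  obtain ⟨C, hC, hCb⟩ := hΛ.quad
  have hquot : ∀ s : ℂ, 1 / 2 + δ ≤ s.re → ‖f s / s‖ ≤ √(C * M) := by
    intro s hs
    have hs' : s ∈ halfPlane := by simp only [halfPlane, Set.mem_ofPred_eq]; linarith
    have hs0 : 0 < ‖s‖ := norm_pos_iff.2 (ne_zero_of_mem_halfPlane hs')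
    refine Real.le_sqrt_of_sq_le ?_
    rw [← norm_pow, div_pow, hsq s hs', norm_div, norm_mul, norm_pow, div_le_iff₀ (by positivity)]
    calc _ ≤ C * ‖s‖ ^ 2 * M :=
          mul_le_mul (hCb s (by linarith)) (hMb s hs) (norm_nonneg _) (by positivity)
      _ = _ := by ring
  refine ⟨√(C * M) / δ + ‖α‖ * (2 * δ) ^ (-(5 / 4) : ℝ) + ‖β‖ * (2 * δ) ^ (-(3 / 4) : ℝ), ?_,
    fun s hs ↦ ?_⟩
  · have : 0 < √(C * M) := Real.sqrt_pos.2 (by positivity)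
    positivity
  have hw : 2 * δ ≤ ‖s - 1 / 2‖ := by
    refine le_trans ?_ ((le_abs_self _).trans (Complex.abs_re_le_norm _))
    simp; linarith
  have hd : ‖deriv (fun z ↦ f z / z) s‖ ≤ √(C * M) / δ := by
    have hre : ∀ z ∈ Metric.closedBall s δ, 1 / 2 + δ ≤ z.re := by
      intro z hz
      have h1 : |(z - s).re| ≤ δ := (Complex.abs_re_le_norm _).trans
        (by simpa [dist_eq_norm] using hz)
      rw [Complex.sub_re] at h1
      have := (abs_le.1 h1).1
      linarith
    refine Complex.norm_deriv_le_of_forall_mem_sphere_norm_le hδ0 ?_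
      fun z hz ↦ hquot z (hre z (Metric.sphere_subset_closedBall hz))
    refine DifferentiableOn.diffContOnCl_ball (U := halfPlane) ?_ ?_
    · exact hf.div differentiableOn_id fun s hs ↦ ne_zero_of_mem_halfPlane hs
    · intro z hz
      have := hre z hz
      simp only [halfPlane, Set.mem_ofPred_eq]; linarith
  have h5 : ‖s - 1 / 2‖ ^ (-(5 / 4) : ℝ) ≤ (2 * δ) ^ (-(5 / 4) : ℝ) :=
    Real.rpow_le_rpow_of_nonpos (by positivity) hw (by norm_num)
  have h3 : ‖s - 1 / 2‖ ^ (-(3 / 4) : ℝ) ≤ (2 * δ) ^ (-(3 / 4) : ℝ) :=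
    Real.rpow_le_rpow_of_nonpos (by positivity) hw (by norm_num)
  rw [regularPart]
  refine (norm_sub_le _ _).trans (add_le_add ((norm_add_le _ _).trans (add_le_add hd ?_)) ?_)
  · rw [norm_mul, norm_cpow_neg_five_quarters]; gcongr
  · rw [norm_mul, norm_cpow_neg_three_quarters]; gcongr

open scoped ComplexConjugate

lemma LSeries_conj {a : ℕ → ℂ} (ha : ∀ n, conj (a n) = a n) (s : ℂ) :
    LSeries a (conj s) = conj (LSeries a s) := by
  rw [LSeries, LSeries, Complex.conj_tsum]
  refine tsum_congr fun n ↦ ?_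
  rw [LSeries.term_def, LSeries.term_def]
  split_ifs with hn
  · simp
  · rw [map_div₀, ha, Complex.cpow_conj _ _ (by simp [Complex.natCast_arg, Real.pi_ne_zero.symm]),
      Complex.conj_natCast]

lemma conj_apply_of_sq_eq_one {N : ℕ} {χ : DirichletCharacter ℂ N} (hχ : χ ^ 2 = 1) (n : ZMod N) :
    conj (χ n) = χ n := by
  have h := MulChar.star_apply χ n
  rw [MulChar.star_eq_inv, inv_eq_of_mul_eq_one_left (by rw [← sq]; exact hχ)] at h
  exact h.symm

lemma conj_STwist {N : ℕ} {χ : DirichletCharacter ℂ N} (hχ : χ ^ 2 = 1) (n : ℕ) :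
    conj (STwist χ n) = STwist χ n := by
  unfold STwist; split_ifs
  · exact conj_apply_of_sq_eq_one hχ _
  · simp

lemma eqOn_conj_of_LSeries {f : ℂ → ℂ} {a : ℕ → ℂ} (hf : DifferentiableOn ℂ f halfPlane)
    (ha : ∀ n, conj (a n) = a n) (hfa : ∀ s : ℂ, 1 < s.re → f s = LSeries a s) {s : ℂ}
    (hs : s ∈ halfPlane) : f (conj s) = conj (f s) := by
  have hconj : ∀ s ∈ halfPlane, conj s ∈ halfPlane := fun s hs ↦ by
    simpa [halfPlane] using hs
  have hg : DifferentiableOn ℂ (fun s ↦ conj (f (conj s))) halfPlane := by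
    intro z hz
    have h1 : DifferentiableAt ℂ f (conj z) :=
      (hf _ (hconj z hz)).differentiableAt (isOpen_halfPlane.mem_nhds (hconj z hz))
    have := h1.conj_conj
    rw [Complex.conj_conj] at this
    exact this.differentiableWithinAt
  have h2 : (2 : ℂ) ∈ halfPlane := by simp [halfPlane]; norm_num
  have heq : (fun s ↦ conj (f (conj s))) =ᶠ[nhds 2] f := by
    have : {s : ℂ | 1 < s.re} ∈ nhds (2 : ℂ) :=
      (isOpen_lt continuous_const Complex.continuous_re).mem_nhds (by simp)
    filter_upwards [this] with z hz
    have hz' : 1 < z.re := hz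
    rw [hfa _ hz', hfa _ (by simpa using hz'), LSeries_conj ha, Complex.conj_conj]
  have := (hg.analyticOnNhd isOpen_halfPlane).eqOn_of_preconnected_of_eventuallyEq
    (hf.analyticOnNhd isOpen_halfPlane) convex_halfPlane.isPreconnected h2 heq hs
  rw [← this, Complex.conj_conj]

lemma ofReal_mem_halfPlane {σ : ℝ} (hσ : 1 / 2 < σ) : (σ : ℂ) ∈ halfPlane := by
  simpa [halfPlane] using hσ

lemma pos_of_LSeries {f : ℂ → ℂ} {a : ℕ → ℂ} (hf : DifferentiableOn ℂ f halfPlane)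
    (ha : ∀ n, conj (a n) = a n) (hfa : ∀ s : ℂ, 1 < s.re → f s = LSeries a s)
    (ha1 : a 1 = 1) (hab : LSeries.abscissaOfAbsConv a < ⊤)
    (h0 : ∀ s ∈ halfPlane, f s ≠ 0) {σ : ℝ} (hσ : 1 / 2 < σ) :
    0 < (f σ).re ∧ (((f σ).re : ℝ) : ℂ) = f σ := by
  have hreal : ∀ x : ℝ, 1 / 2 < x → (((f x).re : ℝ) : ℂ) = f x := by
    intro x hx
    have := eqOn_conj_of_LSeries hf ha hfa (ofReal_mem_halfPlane hx)
    rw [Complex.conj_ofReal] at this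
    exact Complex.conj_eq_iff_re.1 this.symm
  refine ⟨?_, hreal σ hσ⟩
  by_contra! hneg
  have hlim : Tendsto (fun x : ℝ ↦ (LSeries a x).re) atTop (nhds 1) := by
    have := (Complex.continuous_re.tendsto _).comp (LSeries.tendsto_atTop hab)
    rw [ha1, Complex.one_re] at this
    exact this
  obtain ⟨x, hx0, hx1⟩ := ((hlim.eventually (lt_mem_nhds zero_lt_one)).and
    (eventually_gt_atTop 1)).exists
  rw [← hfa x (by simpa using hx1)] at hx0
  have hcont : ContinuousOn (fun x : ℝ ↦ (f x).re) (Set.Ioi (1 / 2)) :=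
    Complex.continuous_re.comp_continuousOn (hf.continuousOn.comp
      Complex.continuous_ofReal.continuousOn fun y hy ↦ ofReal_mem_halfPlane hy)
  obtain ⟨y, hy, hy0⟩ := isPreconnected_Ioi.intermediate_value (Set.mem_Ioi.2 hσ)
    (Set.mem_Ioi.2 (by linarith : 1 / 2 < x)) hcont ⟨hneg, hx0.le⟩
  have hy0' : (f y).re = 0 := hy0
  exact h0 y (ofReal_mem_halfPlane hy) (by rw [← hreal y hy, hy0', Complex.ofReal_zero])

lemma mulChiNeg4_one_ne_one {q : ℕ} (hq : 0 < q) :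
    mulChiNeg4 (1 : DirichletCharacter ℂ q) ≠ 1 := by
  intro h
  have hcop : Nat.Coprime (4 * q - 1) (4 * q) := by
    have : Nat.Coprime (4 * q - 1) (4 * q - 1 + 1) := by simp
    rwa [Nat.sub_add_cancel (by omega)] at this
  have h1 := mulChiNeg4_natCast (1 : DirichletCharacter ℂ q) (4 * q - 1)
  rw [h, MulChar.one_apply ((ZMod.isUnit_iff_coprime _ _).2 hcop),
    MulChar.one_apply ((ZMod.isUnit_iff_coprime _ _).2 (Nat.Coprime.coprime_mul_left_right hcop))]
    at h1
  have h2 : chiNeg4 ((4 * q - 1 : ℕ) : ZMod 4) = -1 := by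
    have : ((4 * q - 1 : ℕ) : ZMod 4) = 3 := by
      rw [Nat.cast_sub (by omega), Nat.cast_mul]
      have : ((4 : ℕ) : ZMod 4) = 0 := by decide
      rw [this]; simp; decide
    rw [this]
    have h3 : ZMod.χ₄ 3 = -1 := by decide
    simp [chiNeg4, MulChar.ringHomComp_apply, h3]
  rw [h2] at h1
  norm_num at h1

open scoped ComplexOrder in
lemma threeSeries_one_pos (q : ℕ) {x : ℝ} (hx : 1 < x) :
    0 < threeSeries (1 : DirichletCharacter ℂ q) x := by
  refine LSeries.positive (fun n ↦ ?_) ?_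
    ((abscissa_threeTwist_le _).trans_lt (by exact_mod_cast hx))
  · simp only [threeTwist, Pi.zero_apply]
    split_ifs
    · by_cases hn : IsUnit (n : ZMod q)
      · rw [MulChar.one_apply hn]; exact zero_le_one
      · rw [MulChar.map_nonunit _ hn]
    · exact le_rfl
  · simp [threeTwist, onlyThreeModFour_one]

lemma ofReal_norm_threeSeries_one (q : ℕ) {x : ℝ} (hx : 1 < x) :
    ((‖threeSeries (1 : DirichletCharacter ℂ q) x‖ : ℝ) : ℂ) =
      threeSeries (1 : DirichletCharacter ℂ q) x := by
  obtain ⟨h1, h2⟩ := Complex.lt_def.1 (threeSeries_one_pos q hx)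
  have h3 : threeSeries (1 : DirichletCharacter ℂ q) x =
      ((threeSeries (1 : DirichletCharacter ℂ q) x).re : ℝ) :=
    Complex.ext (by simp) (by simpa using h2.symm)
  rw [h3, Complex.norm_real, Real.norm_of_nonneg h1.le]

lemma tendsto_one_add_two_mul :
    Tendsto (fun δ : ℝ ↦ (1 : ℂ) + 2 * δ) (nhdsWithin 0 (Set.Ioi 0)) (nhds 1) := by
  have : Continuous fun δ : ℝ ↦ (1 : ℂ) + 2 * δ := by fun_prop
  simpa using (this.tendsto 0).mono_left nhdsWithin_le_nhds

lemma exists_tendsto_mul_threeSeries_sq {q : ℕ} (hq : 0 < q) : ∃ G : ℂ, G ≠ 0 ∧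
    Tendsto (fun δ : ℝ ↦ (δ : ℂ) * threeSeries (1 : DirichletCharacter ℂ q) (1 + 2 * δ) ^ 2)
      (nhdsWithin 0 (Set.Ioi 0)) (nhds G) := by
  have : NeZero q := ⟨hq.ne'⟩
  set ψ : DirichletCharacter ℂ (4 * q) := mulChiNeg4 (1 : DirichletCharacter ℂ q) with hψ
  have hψ1 : ψ ≠ 1 := mulChiNeg4_one_ne_one hq
  set Q : ℂ := ∏ p ∈ q.primeFactors, (1 - (p : ℂ)⁻¹) with hQ
  have hQ0 : Q ≠ 0 := by
    refine Finset.prod_ne_zero_iff.2 fun p hp ↦ ?_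
    have : 1 < p := (Nat.prime_of_mem_primeFactors hp).one_lt
    rw [sub_ne_zero, ne_comm, inv_ne_one]
    exact_mod_cast this.ne'
  have hlim := tendsto_one_add_two_mul
  have hlim' : Tendsto (fun δ : ℝ ↦ (1 : ℂ) + 2 * δ) (nhdsWithin 0 (Set.Ioi 0))
      (nhdsWithin 1 {1}ᶜ) := by
    refine tendsto_nhdsWithin_iff.2 ⟨hlim, ?_⟩
    filter_upwards [self_mem_nhdsWithin] with δ hδ
    have : (δ : ℂ) ≠ 0 := by exact_mod_cast (ne_of_gt hδ)
    simpa using this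
  have h1 := (DirichletCharacter.LFunctionTrivChar_residue_one (N := q)).comp hlim'
  have h2 : Tendsto (fun δ : ℝ ↦ 1 - (1 : DirichletCharacter ℂ q) ((2 : ℕ) : ZMod q) *
      ((2 : ℕ) : ℂ) ^ (-((1 : ℂ) + 2 * δ))) (nhdsWithin 0 (Set.Ioi 0))
      (nhds (1 - (1 : DirichletCharacter ℂ q) ((2 : ℕ) : ZMod q) * ((2 : ℕ) : ℂ) ^ (-1 : ℂ))) := by
    have : Continuous fun s : ℂ ↦ 1 - (1 : DirichletCharacter ℂ q) ((2 : ℕ) : ZMod q) *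
      ((2 : ℕ) : ℂ) ^ (-s) := by
      refine continuous_const.sub (continuous_const.mul ?_)
      exact continuous_neg.const_cpow (Or.inl (by norm_num))
    exact (this.tendsto 1).comp hlim
  have h3 : Tendsto (fun δ : ℝ ↦ threeSeries ((1 : DirichletCharacter ℂ q) ^ 2)
      (2 * ((1 : ℂ) + 2 * δ))) (nhdsWithin 0 (Set.Ioi 0))
      (nhds (threeSeries ((1 : DirichletCharacter ℂ q) ^ 2) (2 * 1))) := by
    have hc := ((differentiableOn_threeSeries ((1 : DirichletCharacter ℂ q) ^ 2)).differentiableAt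
      ((isOpen_lt continuous_const Complex.continuous_re).mem_nhds
        (by simp : (2 * 1 : ℂ) ∈ {s : ℂ | 1 < s.re}))).continuousAt
    exact hc.tendsto.comp (hlim.const_mul 2)
  have h4 : Tendsto (fun δ : ℝ ↦ DirichletCharacter.LFunction ψ ((1 : ℂ) + 2 * δ))
      (nhdsWithin 0 (Set.Ioi 0)) (nhds (DirichletCharacter.LFunction ψ 1)) :=
    ((DirichletCharacter.differentiable_LFunction hψ1).continuous.tendsto 1).comp hlim
  have h4' : DirichletCharacter.LFunction ψ 1 ≠ 0 :=
    ψ.LFunction_ne_zero_of_one_le_re (Or.inl hψ1) (by simp)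
  refine ⟨_, ?_, ((((h1.mul h2).mul h3).div h4 h4').mul_const (1 / 2)).congr' ?_⟩
  · refine mul_ne_zero (div_ne_zero (mul_ne_zero (mul_ne_zero hQ0 ?_) ?_) h4') (by norm_num)
    · exact one_sub_ne_zero_of_norm_lt_one
        (norm_character_mul_cpow_lt_one _ (by simp) one_lt_two)
    · exact threeSeries_ne_zero _ (by simp)
  · filter_upwards [self_mem_nhdsWithin] with δ hδ
    have hδ' : 0 < δ := hδ
    have hs : 1 < ((1 : ℂ) + 2 * δ).re := by simpa using hδ'
    have hne : DirichletCharacter.LFunction ψ ((1 : ℂ) + 2 * δ) ≠ 0 :=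
      ψ.LFunction_ne_zero_of_one_le_re (Or.inl hψ1) hs.le
    have hmain := threeSeries_sq_mul (1 : DirichletCharacter ℂ q) hs
    rw [← DirichletCharacter.LFunction_eq_LSeries _ hs,
      ← DirichletCharacter.LFunction_eq_LSeries _ hs] at hmain
    simp only [Function.comp_apply, Pi.div_apply]
    rw [div_mul_eq_mul_div, div_eq_iff hne, mul_assoc, mul_assoc _ (threeSeries _ _ ^ 2),
      hmain, DirichletCharacter.LFunctionTrivChar]
    ring

lemma exists_tendsto_sqrt_threeSeries {q : ℕ} (hq : 0 < q) : ∃ G : ℝ, 0 < G ∧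
    Tendsto (fun δ : ℝ ↦ δ ^ (1 / 4 : ℝ) *
      √‖threeSeries (1 : DirichletCharacter ℂ q) ((1 + 2 * δ : ℝ) : ℂ)‖)
      (nhdsWithin 0 (Set.Ioi 0)) (nhds G) := by
  obtain ⟨G, hG, hlim⟩ := exists_tendsto_mul_threeSeries_sq hq
  refine ⟨‖G‖ ^ (1 / 4 : ℝ), by positivity, (hlim.norm.rpow_const
    (Or.inr (by norm_num : (0 : ℝ) ≤ 1 / 4))).congr' ?_⟩
  filter_upwards [self_mem_nhdsWithin] with δ hδ
  have hδ' : 0 < δ := hδ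
  rw [norm_mul, Complex.norm_real, Real.norm_of_nonneg hδ'.le, norm_pow,
    Real.mul_rpow hδ'.le (by positivity), ← Real.rpow_natCast, ← Real.rpow_mul (norm_nonneg _),
    Real.sqrt_eq_rpow]
  push_cast
  norm_num

lemma eq_real_limit {N : ℕ} [NeZero N] {χ : DirichletCharacter ℂ N} (hχ : χ ^ 2 = 1) {f : ℂ → ℂ}
    (hΛ : PairLBounds (pairL χ)) (hf : DifferentiableOn ℂ f halfPlane)
    (hsq : ∀ s ∈ halfPlane, f s ^ 2 = pairL χ s * sqFactor χ s)
    (hfL : ∀ s : ℂ, 1 < s.re → f s = LSeries (STwist χ) s) (hne : ∀ s ∈ halfPlane, f s ≠ 0)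
    {G : ℝ} (hG : Tendsto (fun δ : ℝ ↦ δ ^ (1 / 4 : ℝ) *
      √‖threeSeries (1 : DirichletCharacter ℂ N) ((1 + 2 * δ : ℝ) : ℂ)‖)
      (nhdsWithin 0 (Set.Ioi 0)) (nhds G)) {l : ℂ}
    (hl : Tendsto (fun δ : ℝ ↦ (δ : ℂ) ^ (1 / 4 : ℂ) * f (1 / 2 + δ))
      (nhdsWithin 0 (Set.Ioi 0)) (nhds l)) :
    l = ((G * ((1 - (χ (2 : ZMod N)).re / √2) ^ (-(1 / 2) : ℝ) *
      √((pairL χ (1 / 2)).re)) : ℝ) : ℂ) := by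
  set c : ℝ := (χ (2 : ZMod N)).re with hc
  have hcχ : (c : ℂ) = χ ((2 : ℕ) : ZMod N) := by
    rw [Nat.cast_two]; exact Complex.conj_eq_iff_re.1 (conj_apply_of_sq_eq_one hχ 2)
  have hc1 : c ≤ 1 := (Complex.re_le_norm _).trans (χ.norm_le_one _)
  have hden : ∀ σ : ℝ, 0 < σ → 0 < 1 - c * (2 : ℝ) ^ (-σ) := by
    intro σ hσ
    have : (2 : ℝ) ^ (-σ) < 1 := Real.rpow_lt_one_of_one_lt_of_neg one_lt_two (by linarith)
    have h0 : (0 : ℝ) < (2 : ℝ) ^ (-σ) := by positivity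
    nlinarith
  have hab : LSeries.abscissaOfAbsConv (STwist χ) < ⊤ :=
    (LSeries.abscissaOfAbsConv_le_of_le_const ⟨1, fun n _ ↦ norm_STwist_le χ n⟩).trans_lt
      (by exact_mod_cast EReal.coe_lt_top 1)
  have hone : STwist χ 1 = 1 := by
    have : IsSum2Sq 1 := ⟨1, 0, by norm_num⟩
    simp [STwist, this]
  have hval : ∀ δ : ℝ, 0 < δ → δ ^ (1 / 4 : ℝ) * (f (1 / 2 + δ)).re =
      δ ^ (1 / 4 : ℝ) * √‖threeSeries (1 : DirichletCharacter ℂ N) ((1 + 2 * δ : ℝ) : ℂ)‖ *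
      (√((1 - c * (2 : ℝ) ^ (-(1 / 2 + δ)))⁻¹) * √((pairL χ (1 / 2 + δ)).re)) ∧
      (f (1 / 2 + δ)) = ((f (1 / 2 + δ)).re : ℝ) := by
    intro δ hδ
    have hσ : 1 / 2 < 1 / 2 + δ := by linarith
    obtain ⟨hpos, hre⟩ := pos_of_LSeries hf (conj_STwist hχ) hfL hone hab hne hσ
    have hcast : ((1 / 2 + δ : ℝ) : ℂ) = 1 / 2 + δ := by push_cast; rfl
    have hs := hsq _ (ofReal_mem_halfPlane hσ)
    rw [hcast] at hpos hre hs
    refine ⟨?_, hre.symm⟩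
    set g : ℝ := ‖threeSeries (1 : DirichletCharacter ℂ N) ((1 + 2 * δ : ℝ) : ℂ)‖ with hg
    have hg' := ofReal_norm_threeSeries_one N (by linarith : 1 < 1 + 2 * δ)
    rw [← hg] at hg'
    have hg0 : 0 < g := norm_pos_iff.2 (threeSeries_ne_zero _ (by simpa using hδ))
    set d : ℝ := 1 - c * (2 : ℝ) ^ (-(1 / 2 + δ)) with hd
    have hd0 : 0 < d := hden _ (by linarith)
    have hdc : (1 : ℂ) - χ ((2 : ℕ) : ZMod N) * ((2 : ℕ) : ℂ) ^ (-(1 / 2 + δ : ℂ)) = (d : ℝ) := by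
      rw [hd, ← hcχ]; push_cast
      rw [Complex.ofReal_cpow (by norm_num)]; push_cast; rfl
    have h2 : (2 * (1 / 2 + δ : ℂ)) = ((1 + 2 * δ : ℝ) : ℂ) := by push_cast; ring
    rw [sqFactor, hχ, h2, ← hg', hdc, ← hre, ← Complex.ofReal_div] at hs
    have hs' : (f (1 / 2 + δ)).re ^ 2 = (pairL χ (1 / 2 + δ)).re * (g / d) := by
      have := congrArg Complex.re hs
      rwa [Complex.re_mul_ofReal, ← Complex.ofReal_pow, Complex.ofReal_re] at this
    have hΛ0 : 0 < (pairL χ (1 / 2 + δ)).re := by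
      have h1 : 0 < (f (1 / 2 + δ)).re ^ 2 := by positivity
      rw [hs'] at h1
      exact (pos_iff_pos_of_mul_pos h1).2 (by positivity)
    rw [← Real.sqrt_sq hpos.le, hs', div_eq_mul_inv g d, Real.sqrt_mul hΛ0.le, Real.sqrt_mul hg0.le]
    ring
  have hΛlim : Tendsto (fun δ : ℝ ↦ √((pairL χ (1 / 2 + δ)).re)) (nhdsWithin 0 (Set.Ioi 0))
      (nhds (√((pairL χ (1 / 2)).re))) := by
    have hcΛ := hΛ.diff.continuous
    have : Continuous fun δ : ℝ ↦ √((pairL χ (1 / 2 + δ)).re) :=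
      Real.continuous_sqrt.comp (Complex.continuous_re.comp
        (hcΛ.comp (by fun_prop : Continuous fun δ : ℝ ↦ (1 / 2 + δ : ℂ))))
    simpa using (this.tendsto 0).mono_left nhdsWithin_le_nhds
  have hdlim : Tendsto (fun δ : ℝ ↦ √((1 - c * (2 : ℝ) ^ (-(1 / 2 + δ)))⁻¹))
      (nhdsWithin 0 (Set.Ioi 0)) (nhds ((1 - c / √2) ^ (-(1 / 2) : ℝ))) := by
    have h0 := hden (1 / 2) (by norm_num)
    have h1 : c * (2 : ℝ) ^ (-(1 / 2) : ℝ) = c / √2 := by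
      rw [Real.rpow_neg (by norm_num), ← Real.sqrt_eq_rpow, div_eq_mul_inv]
    have hcont : ContinuousAt (fun δ : ℝ ↦ √((1 - c * (2 : ℝ) ^ (-(1 / 2 + δ)))⁻¹)) 0 := by
      have h2 : Continuous fun δ : ℝ ↦ (1 - c * (2 : ℝ) ^ (-(1 / 2 + δ))) := by
        refine continuous_const.sub (continuous_const.mul ?_)
        exact Continuous.rpow continuous_const (by fun_prop) fun x ↦ Or.inl (by norm_num)
      exact Real.continuous_sqrt.continuousAt.comp (h2.continuousAt.inv₀ (by simpa using h0.ne'))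
    have h3 := hcont.tendsto.mono_left (nhdsWithin_le_nhds (s := Set.Ioi (0 : ℝ)))
    rw [add_zero, h1] at h3
    rw [h1] at h0
    rwa [Real.rpow_neg h0.le, ← Real.sqrt_eq_rpow, ← Real.sqrt_inv]
  have hlim := hG.mul (hdlim.mul hΛlim)
  refine tendsto_nhds_unique hl (((Complex.continuous_ofReal.tendsto _).comp hlim).congr' ?_)
  filter_upwards [self_mem_nhdsWithin] with δ hδ
  have hδ' : 0 < δ := hδ
  obtain ⟨h1, h2⟩ := hval δ hδ'
  simp only [Function.comp_apply]
  rw [← h1, Complex.ofReal_mul, ← h2, Complex.ofReal_cpow hδ'.le]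
  push_cast; rfl

section ExpTransform

open MeasureTheory FourierTransform SchwartzMap
open scoped ContDiff

/-- The two-sided exponential transform of a test function. -/
def expTransform (ψ : ℝ → ℂ) (s : ℂ) : ℂ := ∫ u : ℝ, cexp (s * u) * ψ u

variable {ψ : ℝ → ℂ}

lemma integrable_cexp_mul (hψ : Continuous ψ) (hc : HasCompactSupport ψ) (s : ℂ) :
    Integrable fun u : ℝ ↦ cexp (s * u) * ψ u :=
  Continuous.integrable_of_hasCompactSupport (by fun_prop) hc.mul_left

lemma hasDerivAt_expTransform (hψ : Continuous ψ) (hc : HasCompactSupport ψ) (s : ℂ) :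
    HasDerivAt (expTransform ψ) (∫ u : ℝ, cexp (s * u) * u * ψ u) s := by
  have hb : Integrable fun u : ℝ ↦ Real.exp ((‖s‖ + 1) * |u|) * |u| * ‖ψ u‖ :=
    Continuous.integrable_of_hasCompactSupport (by fun_prop) hc.norm.mul_left
  refine (hasDerivAt_integral_of_dominated_loc_of_deriv_le (μ := volume)
    (F := fun s (u : ℝ) ↦ cexp (s * u) * ψ u) (F' := fun s (u : ℝ) ↦ cexp (s * u) * u * ψ u)
    (Metric.ball_mem_nhds s one_pos) (Eventually.of_forall fun z ↦
      (integrable_cexp_mul hψ hc z).aestronglyMeasurable) (integrable_cexp_mul hψ hc s)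
    (Continuous.aestronglyMeasurable (by fun_prop)) (ae_of_all _ fun u z hz ↦ ?_) hb
    (ae_of_all _ fun u z _ ↦ ?_)).2
  · rw [norm_mul, norm_mul, Complex.norm_exp, Complex.norm_real, Real.norm_eq_abs]
    gcongr
    have h1 : ‖z‖ ≤ ‖s‖ + 1 := by
      have := norm_sub_norm_le z s
      rw [Metric.mem_ball, dist_eq_norm] at hz
      linarith
    calc (z * u).re ≤ ‖z * u‖ := Complex.re_le_norm _
      _ = ‖z‖ * |u| := by rw [norm_mul, Complex.norm_real, Real.norm_eq_abs]
      _ ≤ _ := by gcongr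
  · have h1 : HasDerivAt (fun z : ℂ ↦ z * u) (u : ℂ) z := by
      simpa using (hasDerivAt_id z).mul_const (u : ℂ)
    exact h1.cexp.mul_const _

lemma differentiable_expTransform (hψ : Continuous ψ) (hc : HasCompactSupport ψ) :
    Differentiable ℂ (expTransform ψ) :=
  fun s ↦ (hasDerivAt_expTransform hψ hc s).differentiableAt

lemma mul_expTransform (hψ : ContDiff ℝ ∞ ψ) (hc : HasCompactSupport ψ) (s : ℂ) :
    s * expTransform ψ s = -expTransform (deriv ψ) s := by
  have hψ' : Continuous (deriv ψ) := hψ.continuous_deriv (by simp)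
  have hder : ∀ u : ℝ, HasDerivAt (fun u : ℝ ↦ cexp (s * u)) (cexp (s * u) * s) u := fun u ↦ by
    have h1 : HasDerivAt (fun u : ℝ ↦ s * (u : ℂ)) s u := by
      simpa using (Complex.ofRealCLM.hasDerivAt (x := u)).const_mul s
    exact h1.cexp
  have hd : Differentiable ℝ ψ := hψ.differentiable (by simp)
  have h := integral_mul_deriv_eq_deriv_mul_of_integrable (u := fun u : ℝ ↦ cexp (s * u)) (v := ψ)
    (fun u _ ↦ hder u) (fun u _ ↦ (hd u).hasDerivAt)
    (integrable_cexp_mul hψ' hc.deriv s)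
    (Continuous.integrable_of_hasCompactSupport (by fun_prop) hc.mul_left)
    (integrable_cexp_mul hψ.continuous hc s)
  rw [expTransform, expTransform, h, neg_neg, ← integral_const_mul]
  refine integral_congr_ae (ae_of_all _ fun u ↦ ?_)
  simp only
  ring

lemma norm_expTransform_le (hψ : Continuous ψ) (hc : HasCompactSupport ψ) {σ : ℝ} {s : ℂ}
    (hs : |s.re| ≤ σ) : ‖expTransform ψ s‖ ≤ ∫ u : ℝ, Real.exp (σ * |u|) * ‖ψ u‖ := by
  refine norm_integral_le_of_norm_le ?_ (ae_of_all _ fun u ↦ ?_)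
  · exact Continuous.integrable_of_hasCompactSupport (by fun_prop) hc.norm.mul_left
  · rw [norm_mul, Complex.norm_exp]
    gcongr
    calc (s * u).re = s.re * u := by simp
      _ ≤ |s.re * u| := le_abs_self _
      _ = |s.re| * |u| := abs_mul _ _
      _ ≤ _ := by gcongr

lemma exists_norm_expTransform_mul_abs_im_le (hψ : ContDiff ℝ ∞ ψ) (hc : HasCompactSupport ψ)
    (σ : ℝ) : ∃ K, ∀ s : ℂ, |s.re| ≤ σ → ‖expTransform ψ s‖ * |s.im| ≤ K := by
  have hψ' : Continuous (deriv ψ) := hψ.continuous_deriv (by simp)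
  refine ⟨∫ u : ℝ, Real.exp (σ * |u|) * ‖deriv ψ u‖, fun s hs ↦ ?_⟩
  calc _ ≤ ‖expTransform ψ s‖ * ‖s‖ := by gcongr; exact Complex.abs_im_le_norm s
    _ = ‖s * expTransform ψ s‖ := by rw [norm_mul, mul_comm]
    _ ≤ _ := by
      rw [mul_expTransform hψ hc, norm_neg]
      exact norm_expTransform_le hψ' hc.deriv hs

/-- A test function multiplied by a real exponential, as a Schwartz function. -/
def expSchwartz (hψ : ContDiff ℝ ∞ ψ) (hc : HasCompactSupport ψ) (σ : ℝ) : 𝓢(ℝ, ℂ) :=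
  HasCompactSupport.toSchwartzMap (f := fun u : ℝ ↦ cexp (σ * u) * ψ u) hc.mul_left
    (ContDiff.mul ((contDiff_const.mul Complex.ofRealCLM.contDiff).cexp) hψ)

lemma expSchwartz_apply (hψ : ContDiff ℝ ∞ ψ) (hc : HasCompactSupport ψ) (σ u : ℝ) :
    expSchwartz hψ hc σ u = cexp (σ * u) * ψ u := rfl

lemma fourierInv_expSchwartz (hψ : ContDiff ℝ ∞ ψ) (hc : HasCompactSupport ψ) (σ ξ : ℝ) :
    𝓕⁻ (expSchwartz hψ hc σ) ξ = expTransform ψ (σ + (2 * Real.pi * ξ : ℝ) * I) := by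
  rw [SchwartzMap.fourierInv_coe, Real.fourierInv_eq', expTransform]
  refine integral_congr_ae (ae_of_all _ fun u ↦ ?_)
  simp only [expSchwartz_apply, smul_eq_mul]
  rw [← mul_assoc, ← Complex.exp_add]
  congr 2
  simp only [RCLike.inner_apply, conj_trivial]
  push_cast
  ring

lemma integral_norm_sq_expTransform (hψ : ContDiff ℝ ∞ ψ) (hc : HasCompactSupport ψ) (σ : ℝ) :
    ∫ ξ : ℝ, ‖expTransform ψ (σ + (2 * Real.pi * ξ : ℝ) * I)‖ ^ 2 =
      ∫ u : ℝ, ‖cexp (σ * u) * ψ u‖ ^ 2 := by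
  have h := SchwartzMap.integral_norm_sq_fourier (𝓕⁻ (expSchwartz hψ hc σ))
  rw [FourierTransform.fourier_fourierInv_eq] at h
  simp only [fourierInv_expSchwartz, expSchwartz_apply] at h
  exact h.symm

lemma integral_mul_eq_integral_fourier_mul (hψ : ContDiff ℝ ∞ ψ) (hc : HasCompactSupport ψ)
    {h : ℝ → ℂ} {σ : ℝ} (h_int : Integrable fun u : ℝ ↦ cexp (-(σ * u)) * h u) :
    ∫ u : ℝ, h u * ψ u = ∫ ξ : ℝ, 𝓕 (fun u : ℝ ↦ cexp (-(σ * u)) * h u) ξ *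
      expTransform ψ (σ + (2 * Real.pi * ξ : ℝ) * I) := by
  have key := VectorFourier.integral_fourierIntegral_smul_eq_flip (L := innerₗ ℝ)
    Real.continuous_fourierChar continuous_inner h_int
    ((𝓕⁻ (expSchwartz hψ hc σ) : 𝓢(ℝ, ℂ)).integrable (μ := volume))
  rw [flip_innerₗ] at key
  have h2 : ∀ u : ℝ, VectorFourier.fourierIntegral Real.fourierChar volume (innerₗ ℝ)
      (𝓕⁻ (expSchwartz hψ hc σ) : 𝓢(ℝ, ℂ)) u = cexp (σ * u) * ψ u := by
    intro u
    rw [← expSchwartz_apply hψ hc]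
    exact DFunLike.congr_fun (FourierTransform.fourier_fourierInv_eq (E := 𝓢(ℝ, ℂ))
      (F := 𝓢(ℝ, ℂ)) (expSchwartz hψ hc σ)) u
  simp only [h2, smul_eq_mul, fourierInv_expSchwartz] at key
  refine Eq.trans ?_ key.symm
  refine integral_congr_ae (ae_of_all _ fun u ↦ ?_)
  simp only
  rw [mul_comm (cexp _) (h u), mul_assoc (h u), ← mul_assoc (cexp _) (cexp _),
    ← Complex.exp_add]
  simp

end ExpTransform

section Shift

open MeasureTheory FourierTransform SchwartzMap
open scoped ContDiff

lemma integral_vertical_eq {F : ℂ → ℂ} {σ σ₁ K : ℝ} (hσ : σ ≤ σ₁)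
    (hF : DifferentiableOn ℂ F {s | σ ≤ s.re}) (hi : Integrable fun t : ℝ ↦ F (σ + t * I))
    (hi₁ : Integrable fun t : ℝ ↦ F (σ₁ + t * I))
    (hK : ∀ s : ℂ, σ ≤ s.re → s.re ≤ σ₁ → ‖F s‖ * |s.im| ≤ K) :
    ∫ t : ℝ, F (σ₁ + t * I) = ∫ t : ℝ, F (σ + t * I) := by
  have hrect : ∀ T : ℝ, 0 < T →
      ‖(∫ t in (-T)..T, F (σ₁ + t * I)) - ∫ t in (-T)..T, F (σ + t * I)‖ ≤
        2 * K * (σ₁ - σ) / T := by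
    intro T hT
    have hsub : DifferentiableOn ℂ F (Set.uIcc (σ - T * I : ℂ).re (σ₁ + T * I : ℂ).re ×ℂ
        Set.uIcc (σ - T * I : ℂ).im (σ₁ + T * I : ℂ).im) := by
      refine hF.mono fun s hs ↦ ?_
      have := hs.1
      simp only [Complex.sub_re, Complex.add_re, Complex.ofReal_re, Complex.mul_re, Complex.I_re,
        Complex.I_im, Complex.ofReal_im, mul_zero, mul_one, zero_mul, sub_zero, add_zero,
        Set.uIcc_of_le hσ, Set.mem_preimage] at this
      exact this.1
    have h := Complex.integral_boundary_rect_eq_zero_of_differentiableOn F _ _ hsub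
    simp only [Complex.sub_re, Complex.add_re, Complex.ofReal_re, Complex.mul_re, Complex.I_re,
      Complex.I_im, Complex.ofReal_im, Complex.sub_im, Complex.add_im, Complex.mul_im, mul_zero,
      mul_one, zero_mul, sub_zero, add_zero, zero_sub, zero_add, smul_eq_mul] at h
    have hbd : ∀ y : ℝ, |y| = T → ‖∫ x in σ..σ₁, F (x + y * I)‖ ≤ K / T * (σ₁ - σ) := by
      intro y hy
      refine (intervalIntegral.norm_integral_le_of_norm_le_const fun x hx ↦ ?_).trans_eq
        (by rw [abs_of_nonneg (sub_nonneg.2 hσ)])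
      rw [Set.uIoc_of_le hσ] at hx
      have := hK (x + y * I) (by simpa using hx.1.le) (by simpa using hx.2)
      rw [le_div_iff₀ hT, ← hy]
      simpa using this
    have h1 := hbd (-T) (by rw [abs_neg, abs_of_pos hT])
    have h2 := hbd T (abs_of_pos hT)
    have heq : (∫ t in (-T)..T, F (σ₁ + t * I)) - ∫ t in (-T)..T, F (σ + t * I) =
        I * ((∫ x in σ..σ₁, F (x + (-T : ℝ) * I)) - ∫ x in σ..σ₁, F (x + T * I)) := by
      linear_combination (-I) * h + ((∫ t in (-T)..T, F (σ₁ + t * I)) -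
        ∫ t in (-T)..T, F (σ + t * I)) * Complex.I_sq
    rw [heq, norm_mul, Complex.norm_I, one_mul]
    refine (norm_sub_le _ _).trans ((add_le_add h1 h2).trans_eq ?_)
    ring
  have hlim : Tendsto (fun T : ℝ ↦ (∫ t in (-T)..T, F (σ₁ + t * I)) -
      ∫ t in (-T)..T, F (σ + t * I)) atTop
      (nhds ((∫ t : ℝ, F (σ₁ + t * I)) - ∫ t : ℝ, F (σ + t * I))) :=
    (intervalIntegral_tendsto_integral hi₁ tendsto_neg_atTop_atBot tendsto_id).sub
      (intervalIntegral_tendsto_integral hi tendsto_neg_atTop_atBot tendsto_id)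
  have hzero : Tendsto (fun T : ℝ ↦ (∫ t in (-T)..T, F (σ₁ + t * I)) -
      ∫ t in (-T)..T, F (σ + t * I)) atTop (nhds 0) := by
    refine squeeze_zero_norm' (a := fun T : ℝ ↦ 2 * K * (σ₁ - σ) / T) ?_
      (tendsto_const_nhds.div_atTop tendsto_id)
    exact (eventually_gt_atTop 0).mono fun T hT ↦ hrect T hT
  exact sub_eq_zero.1 (tendsto_nhds_unique hlim hzero)

variable {φ : ℂ → ℂ} {ψ : ℝ → ℂ}

lemma ofReal_add_mul_I_mem_halfPlane {σ : ℝ} (hσ : 1 / 2 < σ) (t : ℝ) :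
    (σ + t * I : ℂ) ∈ halfPlane := by
  simpa [halfPlane] using hσ

lemma continuous_vertical (hφ : DifferentiableOn ℂ φ halfPlane) {σ : ℝ} (hσ : 1 / 2 < σ) :
    Continuous fun t : ℝ ↦ φ (σ + t * I) :=
  hφ.continuousOn.comp_continuous (by fun_prop) (ofReal_add_mul_I_mem_halfPlane hσ)

lemma integrable_mul_expTransform (hφ : DifferentiableOn ℂ φ halfPlane)
    (hψ : ContDiff ℝ ∞ ψ) (hc : HasCompactSupport ψ) {σ B : ℝ} (hσ : 1 / 2 < σ)
    (hB : ∀ s : ℂ, σ ≤ s.re → ‖φ s‖ ≤ B) :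
    Integrable fun t : ℝ ↦ φ (σ + t * I) * expTransform ψ (σ + t * I) := by
  have h1 : Integrable fun t : ℝ ↦ expTransform ψ (σ + t * I) := by
    have := (𝓕⁻ (expSchwartz hψ hc σ) : 𝓢(ℝ, ℂ)).integrable (μ := volume)
    have h2 : (fun ξ : ℝ ↦ expTransform ψ (σ + (2 * Real.pi * ξ : ℝ) * I)) =
        ⇑(𝓕⁻ (expSchwartz hψ hc σ) : 𝓢(ℝ, ℂ)) := by
      ext ξ; rw [fourierInv_expSchwartz]
    rw [← h2] at this
    exact (integrable_comp_mul_left_iff (fun t : ℝ ↦ expTransform ψ (σ + t * I))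
      (by positivity : 2 * Real.pi ≠ 0)).1 this
  refine h1.bdd_mul (c := B) (continuous_vertical hφ hσ).aestronglyMeasurable
    (ae_of_all _ fun t ↦ hB _ (by simp))

lemma integral_sq_norm_le_of_lintegral_le {g : ℝ → ℂ} (hg : Continuous g) {L : ℝ} (hL : 0 ≤ L)
    (h : ∫⁻ t : ℝ, ENNReal.ofReal (‖g t‖ ^ 2) ≤ ENNReal.ofReal L) :
    Integrable (fun t ↦ ‖g t‖ ^ 2) ∧ ∫ t : ℝ, ‖g t‖ ^ 2 ≤ L := by
  have hm : AEStronglyMeasurable (fun t ↦ ‖g t‖ ^ 2) volume :=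
    (Continuous.aestronglyMeasurable (by fun_prop))
  refine ⟨⟨hm, ?_⟩, ?_⟩
  · rw [hasFiniteIntegral_iff_ofReal (ae_of_all _ fun t ↦ by positivity)]
    exact h.trans_lt ENNReal.ofReal_lt_top
  · rw [integral_eq_lintegral_of_nonneg_ae (ae_of_all _ fun t ↦ by positivity) hm]
    exact ENNReal.toReal_le_of_le_ofReal hL h

lemma norm_integral_mul_sq_le {f g : ℝ → ℂ} (hf : Continuous f) (hg : Continuous g)
    (hf2 : Integrable fun t ↦ ‖f t‖ ^ 2) (hg2 : Integrable fun t ↦ ‖g t‖ ^ 2) :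
    ‖∫ t, f t * g t‖ ^ 2 ≤ (∫ t, ‖f t‖ ^ 2) * ∫ t, ‖g t‖ ^ 2 := by
  have hfL : MemLp (fun t ↦ ‖f t‖) (ENNReal.ofReal 2) := by
    rw [ENNReal.ofReal_ofNat]
    exact ((memLp_two_iff_integrable_sq_norm hf.aestronglyMeasurable).2 hf2).norm
  have hgL : MemLp (fun t ↦ ‖g t‖) (ENNReal.ofReal 2) := by
    rw [ENNReal.ofReal_ofNat]
    exact ((memLp_two_iff_integrable_sq_norm hg.aestronglyMeasurable).2 hg2).norm
  have h := integral_mul_le_Lp_mul_Lq_of_nonneg (μ := volume) Real.HolderConjugate.two_two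
    (ae_of_all _ fun t ↦ norm_nonneg (f t)) (ae_of_all _ fun t ↦ norm_nonneg (g t)) hfL hgL
  have h1 : ‖∫ t, f t * g t‖ ≤ ∫ t, ‖f t‖ * ‖g t‖ := by
    simpa only [norm_mul] using norm_integral_le_integral_norm (fun t ↦ f t * g t)
  have h2 := pow_le_pow_left₀ (norm_nonneg _) (h1.trans h) 2
  refine h2.trans_eq ?_
  have hF : 0 ≤ ∫ t, ‖f t‖ ^ 2 := integral_nonneg fun t ↦ by positivity
  have hG : 0 ≤ ∫ t, ‖g t‖ ^ 2 := integral_nonneg fun t ↦ by positivity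
  simp only [Real.rpow_two]
  rw [mul_pow, ← Real.sqrt_eq_rpow, ← Real.sqrt_eq_rpow, Real.sq_sqrt hF, Real.sq_sqrt hG]

lemma norm_integral_mul_testFunction_sq_le (hφ : DifferentiableOn ℂ φ halfPlane)
    (hφb : ∀ σ : ℝ, 1 / 2 < σ → ∃ B, ∀ s : ℂ, σ ≤ s.re → ‖φ s‖ ≤ B)
    {h : ℝ → ℂ} {σ₁ : ℝ} (h_int : Integrable fun u : ℝ ↦ cexp (-(σ₁ * u)) * h u)
    (hLap : ∀ t : ℝ, ∫ u : ℝ, cexp (-((σ₁ + t * I) * u)) * h u = -φ (σ₁ + t * I))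
    (hψ : ContDiff ℝ ∞ ψ) (hc : HasCompactSupport ψ) {σ L : ℝ} (hσ : 1 / 2 < σ) (hσ₁ : σ ≤ σ₁)
    (hL : 0 ≤ L)
    (hL2 : ∫⁻ t : ℝ, ENNReal.ofReal (‖φ (σ + t * I)‖ ^ 2) ≤ ENNReal.ofReal L) :
    ‖∫ u : ℝ, h u * ψ u‖ ^ 2 ≤ L * ∫ u : ℝ, ‖cexp (σ * u) * ψ u‖ ^ 2 := by
  have hπ : (0 : ℝ) < 2 * Real.pi := by positivity
  obtain ⟨B, hB⟩ := hφb σ hσ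
  have hscale : ∀ σ' : ℝ, ∫ ξ : ℝ, φ (σ' + (2 * Real.pi * ξ : ℝ) * I) *
      expTransform ψ (σ' + (2 * Real.pi * ξ : ℝ) * I) =
      |(2 * Real.pi)⁻¹| • ∫ t : ℝ, φ (σ' + t * I) * expTransform ψ (σ' + t * I) := fun σ' ↦
    Measure.integral_comp_mul_left
      (fun t : ℝ ↦ φ (σ' + t * I) * expTransform ψ (σ' + t * I)) (2 * Real.pi)
  have hF : ∀ ξ : ℝ, 𝓕 (fun u : ℝ ↦ cexp (-(σ₁ * u)) * h u) ξ =
      -φ (σ₁ + (2 * Real.pi * ξ : ℝ) * I) := by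
    intro ξ
    rw [← hLap, Real.fourier_eq']
    refine integral_congr_ae (ae_of_all _ fun u ↦ ?_)
    simp only [smul_eq_mul]
    rw [← mul_assoc, ← Complex.exp_add]
    congr 2
    simp only [RCLike.inner_apply, conj_trivial]
    push_cast
    ring
  have hshift : ∫ t : ℝ, φ (σ₁ + t * I) * expTransform ψ (σ₁ + t * I) =
      ∫ t : ℝ, φ (σ + t * I) * expTransform ψ (σ + t * I) := by
    obtain ⟨K, hK⟩ := exists_norm_expTransform_mul_abs_im_le hψ hc σ₁
    refine integral_vertical_eq (F := fun s ↦ φ s * expTransform ψ s) (K := B * K) hσ₁ ?_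
      (integrable_mul_expTransform hφ hψ hc hσ hB)
      (integrable_mul_expTransform hφ hψ hc (hσ.trans_le hσ₁) fun s hs ↦ hB s (hσ₁.trans hs)) ?_
    · refine (hφ.mono fun s hs ↦ ?_).mul
        (differentiable_expTransform hψ.continuous hc).differentiableOn
      have hs' : σ ≤ s.re := hs
      simp only [halfPlane, Set.mem_ofPred_eq]; linarith
    · intro s hs1 hs2
      have hK' := hK s (by rw [abs_of_pos (by linarith)]; exact hs2)
      have hB0 : 0 ≤ B := (norm_nonneg _).trans (hB s hs1)
      calc _ = ‖φ s‖ * (‖expTransform ψ s‖ * |s.im|) := by rw [norm_mul, mul_assoc]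
        _ ≤ _ := mul_le_mul (hB s hs1) hK' (by positivity) hB0
  have hmain : ∫ u : ℝ, h u * ψ u = -∫ ξ : ℝ, φ (σ + (2 * Real.pi * ξ : ℝ) * I) *
      expTransform ψ (σ + (2 * Real.pi * ξ : ℝ) * I) := by
    rw [integral_mul_eq_integral_fourier_mul hψ hc h_int, hscale σ, ← hshift, ← hscale σ₁,
      ← integral_neg]
    refine integral_congr_ae (ae_of_all _ fun ξ ↦ ?_)
    simp only
    rw [hF, neg_mul]
  obtain ⟨hφi, hφL⟩ := integral_sq_norm_le_of_lintegral_le (continuous_vertical hφ hσ) hL hL2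
  have hφi' : Integrable fun ξ : ℝ ↦ ‖φ (σ + (2 * Real.pi * ξ : ℝ) * I)‖ ^ 2 :=
    (integrable_comp_mul_left_iff (fun t : ℝ ↦ ‖φ (σ + t * I)‖ ^ 2) hπ.ne').2 hφi
  have hφL' : ∫ ξ : ℝ, ‖φ (σ + (2 * Real.pi * ξ : ℝ) * I)‖ ^ 2 ≤ L := by
    rw [Measure.integral_comp_mul_left (fun t : ℝ ↦ ‖φ (σ + t * I)‖ ^ 2) (2 * Real.pi),
      smul_eq_mul]
    have h1 : |(2 * Real.pi)⁻¹| ≤ 1 := by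
      rw [abs_of_pos (by positivity)]
      exact inv_le_one_of_one_le₀ (by linarith [Real.pi_gt_three])
    exact (mul_le_of_le_one_left (integral_nonneg fun t ↦ by positivity) h1).trans hφL
  have hψi : Integrable fun ξ : ℝ ↦ ‖expTransform ψ (σ + (2 * Real.pi * ξ : ℝ) * I)‖ ^ 2 := by
    have := ((𝓕⁻ (expSchwartz hψ hc σ) : 𝓢(ℝ, ℂ)).memLp 2 volume)
    have h2 := (memLp_two_iff_integrable_sq_norm this.1).1 this
    simpa only [fourierInv_expSchwartz] using h2
  rw [hmain, norm_neg]
  have hs : Continuous fun ξ : ℝ ↦ 2 * Real.pi * ξ := by fun_prop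
  refine (norm_integral_mul_sq_le (f := fun ξ : ℝ ↦ φ (σ + (2 * Real.pi * ξ : ℝ) * I))
    (g := fun ξ : ℝ ↦ expTransform ψ (σ + (2 * Real.pi * ξ : ℝ) * I))
    ((continuous_vertical hφ hσ).comp hs)
    ((differentiable_expTransform hψ.continuous hc).continuous.comp (by fun_prop))
    hφi' hψi).trans ?_
  rw [integral_norm_sq_expTransform hψ hc]
  exact mul_le_mul_of_nonneg_right hφL' (integral_nonneg fun t ↦ by positivity)

end Shift

section Laplace

open MeasureTheory Set

lemma norm_summatory_le {a : ℕ → ℂ} (ha : ∀ n, ‖a n‖ ≤ 1) (n : ℕ) :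
    ‖∑ k ∈ Finset.Icc 1 n, a k‖ ≤ n := by
  refine (norm_sum_le _ _).trans ((Finset.sum_le_sum fun k _ ↦ ha k).trans_eq ?_)
  simp

lemma norm_summatory_exp_le {a : ℕ → ℂ} (ha : ∀ n, ‖a n‖ ≤ 1) (u : ℝ) :
    ‖∑ k ∈ Finset.Icc 1 ⌊Real.exp u⌋₊, a k‖ ≤ Real.exp u :=
  (norm_summatory_le ha _).trans (Nat.floor_le (Real.exp_pos u).le)

lemma measurable_summatory_exp (a : ℕ → ℂ) :
    Measurable fun u : ℝ ↦ ∑ k ∈ Finset.Icc 1 ⌊Real.exp u⌋₊, a k :=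
  (measurable_from_nat (f := fun n ↦ ∑ k ∈ Finset.Icc 1 n, a k)).comp
    (Nat.measurable_floor.comp Real.measurable_exp)

lemma LSeries_div_eq_integral {a : ℕ → ℂ} (ha : ∀ n, ‖a n‖ ≤ 1) {s : ℂ} (hs : 1 < s.re) :
    LSeries a s / s = ∫ u in Ioi (0 : ℝ), cexp (-(s * u)) *
      ∑ k ∈ Finset.Icc 1 ⌊Real.exp u⌋₊, a k := by
  have hs0 : s ≠ 0 := by rintro rfl; norm_num at hs
  have hsum : LSeriesSummable a s :=
    LSeriesSummable_of_bounded_of_one_lt_re (m := 1) (fun n _ ↦ ha n) hs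
  rw [LSeries_eq_mul_integral a zero_le_one hs hsum, mul_div_cancel_left₀ _ hs0]
  · have h := integral_comp_exp_Ioi
      (fun t : ℝ ↦ (∑ k ∈ Finset.Icc 1 ⌊t⌋₊, a k) * (t : ℂ) ^ (-(s + 1))) 0
    rw [Real.exp_zero] at h
    rw [← h]
    refine setIntegral_congr_fun measurableSet_Ioi fun u _ ↦ ?_
    have h1 : ((Real.exp u : ℝ) : ℂ) ^ (-(s + 1)) = cexp (-(s * u)) * cexp (-u) := by
      rw [Complex.cpow_def_of_ne_zero (by exact_mod_cast (Real.exp_pos u).ne'),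
        ← Complex.ofReal_log (Real.exp_pos u).le, Real.log_exp, ← Complex.exp_add]
      ring_nf
    have h2 : ((Real.exp u : ℝ) : ℂ) * cexp (-u) = 1 := by
      rw [Complex.ofReal_exp, ← Complex.exp_add, add_neg_cancel, Complex.exp_zero]
    simp only [Complex.real_smul]
    rw [h1]
    linear_combination (cexp (-(s * u)) * ∑ k ∈ Finset.Icc 1 ⌊Real.exp u⌋₊, a k) * h2
  · refine Asymptotics.IsBigO.of_bound 1 (Eventually.of_forall fun n ↦ ?_)
    rw [Real.rpow_one, one_mul, Real.norm_of_nonneg n.cast_nonneg]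
    exact norm_summatory_le ha n

lemma hasDerivAt_laplace {B : ℝ → ℂ} (hB : Measurable B) (hb : ∀ u, ‖B u‖ ≤ Real.exp u) {s : ℂ}
    (hs : 2 ≤ s.re) :
    IntegrableOn (fun u : ℝ ↦ cexp (-(s * u)) * (u * B u)) (Ioi 0) ∧
    HasDerivAt (fun z : ℂ ↦ ∫ u in Ioi (0 : ℝ), cexp (-(z * u)) * B u)
      (-∫ u in Ioi (0 : ℝ), cexp (-(s * u)) * (u * B u)) s := by
  have hm : ∀ z : ℂ, Measurable fun u : ℝ ↦ cexp (-(z * u)) := fun z ↦ by fun_prop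
  have hnorm : ∀ z : ℂ, 3 / 2 ≤ z.re → ∀ u : ℝ, 0 < u →
      ‖cexp (-(z * u))‖ * ‖B u‖ ≤ Real.exp (-(1 / 2) * u) := by
    intro z hz u hu
    rw [Complex.norm_exp]
    refine (mul_le_mul_of_nonneg_left (hb u) (Real.exp_pos _).le).trans ?_
    rw [← Real.exp_add, Real.exp_le_exp]
    simp only [Complex.neg_re, Complex.mul_re, Complex.ofReal_re, Complex.ofReal_im, mul_zero,
      sub_zero]
    nlinarith
  have hbi : IntegrableOn (fun u : ℝ ↦ u * Real.exp (-(1 / 2) * u)) (Ioi 0) := by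
    have := integrableOn_rpow_mul_exp_neg_mul_rpow (p := 1) (s := 1) (b := 1 / 2) (by norm_num)
      one_pos (by norm_num)
    simpa only [Real.rpow_one] using this
  have key := hasDerivAt_integral_of_dominated_loc_of_deriv_le (μ := volume.restrict (Ioi (0 : ℝ)))
    (F := fun z u ↦ cexp (-(z * u)) * B u) (F' := fun z u ↦ -(cexp (-(z * u)) * (u * B u)))
    (bound := fun u : ℝ ↦ u * Real.exp (-(1 / 2) * u))
    (Metric.ball_mem_nhds s (by norm_num : (0 : ℝ) < 1 / 2))
    (Eventually.of_forall fun z ↦ ((hm z).mul hB).aestronglyMeasurable)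
    ?_ ?_ ?_ hbi ?_
  · exact ⟨by simpa [IntegrableOn] using key.1.neg, by simpa only [integral_neg] using key.2⟩
  · refine (exp_neg_integrableOn_Ioi 0 (by norm_num : (0 : ℝ) < 1 / 2)).mono'
      ((hm s).mul hB).aestronglyMeasurable ?_
    filter_upwards [ae_restrict_mem measurableSet_Ioi] with u hu
    rw [norm_mul]
    exact hnorm s (by linarith) u hu
  · exact ((hm s).mul (Complex.measurable_ofReal.mul hB)).neg.aestronglyMeasurable
  · filter_upwards [ae_restrict_mem measurableSet_Ioi] with u hu z hz
    have hz' : 3 / 2 ≤ z.re := by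
      have h1 := (Complex.abs_re_le_norm (z - s)).trans_lt (mem_ball_iff_norm.1 hz)
      rw [Complex.sub_re] at h1
      linarith [(abs_lt.1 h1).1]
    rw [norm_neg, norm_mul, norm_mul, Complex.norm_real, Real.norm_of_nonneg (le_of_lt hu)]
    have := mul_le_mul_of_nonneg_left (hnorm z hz' u hu) (le_of_lt hu)
    linarith
  · refine ae_of_all _ fun u z _ ↦ ?_
    have h1 : HasDerivAt (fun z : ℂ ↦ cexp (-(z * u))) (cexp (-(z * u)) * (-(1 * u))) z :=
      (((hasDerivAt_id z).mul_const (u : ℂ)).neg).cexp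
    refine (h1.mul_const (B u)).congr_deriv ?_
    ring

lemma continuousOn_ofReal_cpow (p : ℂ) : ContinuousOn (fun u : ℝ ↦ (u : ℂ) ^ p) (Ioi 0) :=
  fun u hu ↦ ((Complex.continuous_ofReal.continuousAt (x := u)).cpow
    continuousAt_const (Complex.ofReal_mem_slitPlane.2 hu)).continuousWithinAt

lemma aestronglyMeasurable_cpow_mul_cexp (p w : ℂ) :
    AEStronglyMeasurable (fun u : ℝ ↦ (u : ℂ) ^ p * cexp (-(w * u)))
      (volume.restrict (Ioi 0)) :=
  ((continuousOn_ofReal_cpow p).mul (by fun_prop)).aestronglyMeasurable measurableSet_Ioi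

lemma norm_cpow_mul_cexp (p : ℝ) (w : ℂ) {u : ℝ} (hu : 0 < u) :
    ‖(u : ℂ) ^ (p : ℂ) * cexp (-(w * u))‖ = u ^ p * Real.exp (-w.re * u) := by
  rw [norm_mul, Complex.norm_cpow_eq_rpow_re_of_pos hu, Complex.norm_exp]
  simp

lemma integrableOn_rpow_mul_exp_neg {p b : ℝ} (hp : -1 < p) (hb : 0 < b) :
    IntegrableOn (fun u : ℝ ↦ u ^ p * Real.exp (-b * u)) (Ioi 0) := by
  simpa only [Real.rpow_one] using
    integrableOn_rpow_mul_exp_neg_mul_rpow (p := 1) (s := p) hp one_pos hb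

lemma integrableOn_cpow_mul_cexp {p : ℝ} (hp : -1 < p) {w : ℂ} (hw : 0 < w.re) :
    IntegrableOn (fun u : ℝ ↦ (u : ℂ) ^ (p : ℂ) * cexp (-(w * u))) (Ioi 0) := by
  refine (integrableOn_rpow_mul_exp_neg hp hw).mono' (aestronglyMeasurable_cpow_mul_cexp p w) ?_
  filter_upwards [ae_restrict_mem measurableSet_Ioi] with u hu
  exact (norm_cpow_mul_cexp p w hu).le

lemma differentiableAt_integral_cpow_mul_cexp {p : ℝ} (hp : -1 < p) {w : ℂ} (hw : 0 < w.re) :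
    DifferentiableAt ℂ
      (fun z : ℂ ↦ ∫ u in Ioi (0 : ℝ), (u : ℂ) ^ (p : ℂ) * cexp (-(z * u))) w := by
  have key := hasDerivAt_integral_of_dominated_loc_of_deriv_le (μ := volume.restrict (Ioi (0 : ℝ)))
    (F := fun z u ↦ (u : ℂ) ^ (p : ℂ) * cexp (-(z * u)))
    (F' := fun z u ↦ (u : ℂ) ^ (p : ℂ) * cexp (-(z * u)) * (-u))
    (bound := fun u : ℝ ↦ u ^ (p + 1) * Real.exp (-(w.re / 2) * u))
    (Metric.ball_mem_nhds w (half_pos hw))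
    (Eventually.of_forall fun z ↦ aestronglyMeasurable_cpow_mul_cexp p z)
    (integrableOn_cpow_mul_cexp hp hw)
    ((aestronglyMeasurable_cpow_mul_cexp p w).mul (by fun_prop)) ?_
    (integrableOn_rpow_mul_exp_neg (by linarith) (half_pos hw)) ?_
  · exact key.2.differentiableAt
  · filter_upwards [ae_restrict_mem measurableSet_Ioi] with u hu z hz
    have hz' : w.re / 2 ≤ z.re := by
      have h1 := (Complex.abs_re_le_norm (z - w)).trans_lt (mem_ball_iff_norm.1 hz)
      rw [Complex.sub_re] at h1
      linarith [(abs_lt.1 h1).1]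
    have hu' : 0 < u := hu
    rw [norm_mul, norm_cpow_mul_cexp p z hu, norm_neg, Complex.norm_real,
      Real.norm_of_nonneg hu'.le, mul_right_comm, Real.rpow_add hu', Real.rpow_one]
    refine mul_le_mul_of_nonneg_left (Real.exp_le_exp.2 ?_) (by positivity)
    nlinarith
  · refine ae_of_all _ fun u z _ ↦ ?_
    have h1 : HasDerivAt (fun z : ℂ ↦ cexp (-(z * u))) (cexp (-(z * u)) * (-(1 * u))) z :=
      (((hasDerivAt_id z).mul_const (u : ℂ)).neg).cexp
    refine (h1.const_mul ((u : ℂ) ^ (p : ℂ))).congr_deriv ?_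
    ring

lemma integral_cpow_mul_cexp {p : ℝ} (hp : 0 < p) {w : ℂ} (hw : 0 < w.re) :
    ∫ u in Ioi (0 : ℝ), (u : ℂ) ^ ((p - 1 : ℝ) : ℂ) * cexp (-(w * u)) =
      Complex.Gamma p * w ^ (-p : ℂ) := by
  have hopen : IsOpen {z : ℂ | 0 < z.re} := isOpen_lt continuous_const Complex.continuous_re
  have h1 : AnalyticOnNhd ℂ (fun z : ℂ ↦ ∫ u in Ioi (0 : ℝ),
      (u : ℂ) ^ ((p - 1 : ℝ) : ℂ) * cexp (-(z * u))) {z : ℂ | 0 < z.re} :=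
    DifferentiableOn.analyticOnNhd (fun z hz ↦ (differentiableAt_integral_cpow_mul_cexp
      (by linarith) hz).differentiableWithinAt) hopen
  have h2 : AnalyticOnNhd ℂ (fun z : ℂ ↦ Complex.Gamma p * z ^ (-p : ℂ)) {z : ℂ | 0 < z.re} :=
    DifferentiableOn.analyticOnNhd (fun z hz ↦ ((differentiableAt_id.cpow_const
      (Or.inl hz)).const_mul _).differentiableWithinAt) hopen
  refine h1.eqOn_of_preconnected_of_frequently_eq h2 (convex_halfSpace_re_gt 0).isPreconnected
    (z₀ := 1) (by simp) ?_ hw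
  have htend : Tendsto (fun δ : ℝ ↦ ((1 + δ : ℝ) : ℂ)) (nhdsWithin 0 (Ioi 0))
      (nhdsWithin 1 {1}ᶜ) := by
    refine tendsto_nhdsWithin_iff.2 ⟨?_, ?_⟩
    · refine Tendsto.mono_left ?_ nhdsWithin_le_nhds
      have : Continuous fun δ : ℝ ↦ ((1 + δ : ℝ) : ℂ) := by fun_prop
      simpa using this.tendsto 0
    · filter_upwards [self_mem_nhdsWithin] with δ hδ
      have hδ' : (0 : ℝ) < δ := hδ
      simpa using hδ'.ne'
  refine htend.frequently (Eventually.frequently ?_)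
  filter_upwards [self_mem_nhdsWithin] with δ hδ
  have hδ' : (0 : ℝ) < 1 + δ := add_pos one_pos hδ
  have := Complex.integral_cpow_mul_exp_neg_mul_Ioi (a := p) (by simpa using hp) hδ'
  push_cast at this ⊢
  rw [this, one_div, Complex.inv_cpow _ _ (by
    rw [← Complex.ofReal_one, ← Complex.ofReal_add, Complex.arg_ofReal_of_nonneg hδ'.le]
    exact Real.pi_pos.ne), Complex.cpow_neg, mul_comm]

lemma laplace_cpow {p : ℝ} (hp : 0 < p) {s : ℂ} (hs : 1 / 2 < s.re) :
    IntegrableOn (fun u : ℝ ↦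
      cexp (-(s * u)) * ((u : ℂ) ^ ((p - 1 : ℝ) : ℂ) * cexp (u / 2))) (Ioi 0) ∧
    ∫ u in Ioi (0 : ℝ), cexp (-(s * u)) * ((u : ℂ) ^ ((p - 1 : ℝ) : ℂ) * cexp (u / 2)) =
      Complex.Gamma p * (s - 1 / 2) ^ (-p : ℂ) := by
  have hre : 0 < (s - 1 / 2).re := by
    simp only [Complex.sub_re, Complex.div_ofNat_re, Complex.one_re]
    linarith
  have heq : ∀ u : ℝ, cexp (-(s * u)) * ((u : ℂ) ^ ((p - 1 : ℝ) : ℂ) * cexp (u / 2)) =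
      (u : ℂ) ^ ((p - 1 : ℝ) : ℂ) * cexp (-((s - 1 / 2) * u)) := by
    intro u
    have : cexp (-((s - 1 / 2) * u)) = cexp (-(s * u)) * cexp (u / 2) := by
      rw [← Complex.exp_add]; ring_nf
    rw [this]; ring
  simp only [heq]
  exact ⟨integrableOn_cpow_mul_cexp (by linarith) hre, integral_cpow_mul_cexp hp hre⟩

/-- The function whose Laplace transform is `-regularPart D α β`. -/
def laplaceKernel (a : ℕ → ℂ) (α β : ℂ) (u : ℝ) : ℂ :=
  (Ioi (0 : ℝ)).indicator (fun u : ℝ ↦ u * (∑ k ∈ Finset.Icc 1 ⌊Real.exp u⌋₊, a k)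
    - α / Complex.Gamma (5 / 4 : ℝ) * ((u : ℂ) ^ ((5 / 4 - 1 : ℝ) : ℂ) * cexp (u / 2))
    + β / Complex.Gamma (3 / 4 : ℝ) * ((u : ℂ) ^ ((3 / 4 - 1 : ℝ) : ℂ) * cexp (u / 2))) u

lemma integral_laplaceKernel {a : ℕ → ℂ} (ha : ∀ n, ‖a n‖ ≤ 1) {D : ℂ → ℂ}
    (hD : ∀ s : ℂ, 1 < s.re → D s = LSeries a s) (α β : ℂ) {s : ℂ} (hs : 2 ≤ s.re) :
    Integrable (fun u : ℝ ↦ cexp (-(s * u)) * laplaceKernel a α β u) ∧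
    ∫ u : ℝ, cexp (-(s * u)) * laplaceKernel a α β u = -regularPart D α β s := by
  obtain ⟨hi, hd⟩ := hasDerivAt_laplace (measurable_summatory_exp a) (norm_summatory_exp_le ha) hs
  obtain ⟨hi₁, he₁⟩ := laplace_cpow (p := 5 / 4) (by norm_num) (s := s) (by linarith)
  obtain ⟨hi₂, he₂⟩ := laplace_cpow (p := 3 / 4) (by norm_num) (s := s) (by linarith)
  have hderiv : deriv (fun z ↦ D z / z) s = -∫ u in Ioi (0 : ℝ), cexp (-(s * u)) *
      (u * ∑ k ∈ Finset.Icc 1 ⌊Real.exp u⌋₊, a k) := by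
    rw [← hd.deriv]
    refine EventuallyEq.deriv_eq ?_
    filter_upwards [(isOpen_lt continuous_const Complex.continuous_re).mem_nhds
      (show (1 : ℝ) < s.re by linarith)] with z hz
    rw [hD z hz, LSeries_div_eq_integral ha hz]
  have hind : (fun u : ℝ ↦ cexp (-(s * u)) * laplaceKernel a α β u) =
      (Ioi (0 : ℝ)).indicator (fun u : ℝ ↦
        cexp (-(s * u)) * (u * (∑ k ∈ Finset.Icc 1 ⌊Real.exp u⌋₊, a k))
        - α / Complex.Gamma (5 / 4 : ℝ) *
          (cexp (-(s * u)) * ((u : ℂ) ^ ((5 / 4 - 1 : ℝ) : ℂ) * cexp (u / 2)))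
        + β / Complex.Gamma (3 / 4 : ℝ) *
          (cexp (-(s * u)) * ((u : ℂ) ^ ((3 / 4 - 1 : ℝ) : ℂ) * cexp (u / 2)))) := by
    ext u
    by_cases hu : u ∈ Ioi (0 : ℝ)
    · rw [laplaceKernel, indicator_of_mem hu, indicator_of_mem hu]; ring
    · rw [laplaceKernel, indicator_of_notMem hu, indicator_of_notMem hu, mul_zero]
  have hi₁' := hi₁.const_mul (α / Complex.Gamma (5 / 4 : ℝ))
  have hi₂' := hi₂.const_mul (β / Complex.Gamma (3 / 4 : ℝ))
  have hG₁ : Complex.Gamma (5 / 4 : ℝ) ≠ 0 := Complex.Gamma_ne_zero_of_re_pos (by norm_num)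
  have hG₂ : Complex.Gamma (3 / 4 : ℝ) ≠ 0 := Complex.Gamma_ne_zero_of_re_pos (by norm_num)
  constructor
  · rw [hind, integrable_indicator_iff measurableSet_Ioi]
    exact (hi.sub hi₁').add hi₂'
  · rw [hind, integral_indicator measurableSet_Ioi]
    refine (integral_add (hi.sub hi₁') hi₂').trans ?_
    refine (congrArg (· + _) (integral_sub hi hi₁')).trans ?_
    rw [integral_const_mul, integral_const_mul, he₁, he₂, regularPart, hderiv,
      ← mul_assoc, ← mul_assoc, div_mul_cancel₀ _ hG₁, div_mul_cancel₀ _ hG₂]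
    push_cast
    ring_nf

end Laplace

section BumpSum

open MeasureTheory Set
open scoped ContDiff

/-- A smooth bump function supported in the interval `(log m, log (m + 1))`. -/
lemma exists_bump {m : ℕ} (hm : 1 ≤ m) : ∃ g : ℝ → ℝ, ContDiff ℝ ∞ g ∧ HasCompactSupport g ∧
    (∀ u, 0 ≤ g u ∧ g u ≤ 1) ∧ (∀ u, g u ≠ 0 → ⌊Real.exp u⌋₊ = m) ∧
    1 / (2 * ((m : ℝ) + 1)) ≤ ∫ u, g u := by
  have hm0 : (0 : ℝ) < m := by exact_mod_cast hm
  set l := Real.log (m + 1) - Real.log m with hl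
  have hl1 : 1 / ((m : ℝ) + 1) ≤ l := by
    have h1 := Real.one_sub_inv_le_log_of_pos (show 0 < ((m : ℝ) + 1) / m by positivity)
    rw [Real.log_div (by positivity) (by positivity), inv_div] at h1
    refine le_trans (le_of_eq ?_) h1
    field_simp
    ring
  have hl0 : 0 < l := lt_of_lt_of_le (by positivity) hl1
  let f : ContDiffBump ((Real.log m + Real.log (m + 1)) / 2) := ⟨l / 4, l / 2, by linarith,
    by linarith⟩
  refine ⟨f, f.contDiff, f.hasCompactSupport, fun u ↦ ⟨f.nonneg, f.le_one⟩, fun u hu ↦ ?_, ?_⟩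
  · have hu' : u ∈ Function.support f := hu
    rw [f.support_eq, Metric.mem_ball, Real.dist_eq, abs_lt] at hu'
    have h1 : Real.log m < u := by
      have : f.rOut = l / 2 := rfl
      linarith [hu'.1]
    have h2 : u < Real.log (m + 1) := by
      have : f.rOut = l / 2 := rfl
      linarith [hu'.2]
    rw [Nat.floor_eq_iff (Real.exp_pos u).le]
    exact ⟨((Real.log_lt_iff_lt_exp hm0).1 h1).le, (Real.lt_log_iff_exp_lt (by positivity)).1 h2⟩
  · refine le_trans ?_ (f.measure_closedBall_le_integral volume)
    have : f.rIn = l / 4 := rfl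
    rw [Measure.real, Real.volume_closedBall, this, ENNReal.toReal_ofReal (by linarith),
      one_div, mul_inv]
    rw [one_div] at hl1
    linarith

lemma exists_bump_sum (s : Finset ℕ) (hs : ∀ m ∈ s, 1 ≤ m) :
    ∃ g : ℝ → ℝ, ContDiff ℝ ∞ g ∧ HasCompactSupport g ∧
    (∀ u, 0 ≤ g u ∧ g u ≤ 1) ∧ (∀ u, g u ≠ 0 → ⌊Real.exp u⌋₊ ∈ s) ∧
    ∑ m ∈ s, 1 / (2 * ((m : ℝ) + 1)) ≤ ∫ u, g u := by
  induction s using Finset.induction_on with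
  | empty => exact ⟨fun _ ↦ 0, contDiff_const, HasCompactSupport.zero, by simp, by simp, by simp⟩
  | insert m s hms ih =>
    obtain ⟨g, hg1, hg2, hg3, hg4, hg5⟩ := ih fun k hk ↦ hs k (Finset.mem_insert_of_mem hk)
    obtain ⟨f, hf1, hf2, hf3, hf4, hf5⟩ := exists_bump (hs m (Finset.mem_insert_self m s))
    refine ⟨fun u ↦ f u + g u, hf1.add hg1, hf2.add hg2, fun u ↦ ⟨add_nonneg (hf3 u).1 (hg3 u).1,
      ?_⟩, fun u hu ↦ ?_, ?_⟩
    · by_cases h : f u = 0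
      · simpa [h] using (hg3 u).2
      · have : g u = 0 := by
          by_contra h'
          exact hms (hf4 u h ▸ hg4 u h')
        simpa [this] using (hf3 u).2
    · rw [Finset.mem_insert]
      by_cases h : f u = 0
      · exact Or.inr (hg4 u (by simpa [h] using hu))
      · exact Or.inl (hf4 u h)
    · rw [Finset.sum_insert hms, integral_add (hf1.continuous.integrable_of_hasCompactSupport hf2)
        (hg1.continuous.integrable_of_hasCompactSupport hg2)]
      exact add_le_add hf5 hg5

end BumpSum

section Oscillation

open MeasureTheory Set
open scoped ContDiff

lemma norm_integral_mul_sq_le_of_support {φ : ℂ → ℂ} {h : ℝ → ℂ}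
    (hφ : DifferentiableOn ℂ φ halfPlane)
    (hφb : ∀ σ : ℝ, 1 / 2 < σ → ∃ B, ∀ s : ℂ, σ ≤ s.re → ‖φ s‖ ≤ B)
    (hLap : ∀ s : ℂ, 2 ≤ s.re → Integrable (fun u : ℝ ↦ cexp (-(s * u)) * h u) ∧
      ∫ u : ℝ, cexp (-(s * u)) * h u = -φ s)
    {δ₀ K : ℝ} (hδ₀ : 0 < δ₀) (hK : 0 < K)
    (hL2 : ∀ δ : ℝ, 0 < δ → δ ≤ δ₀ →
      ∫⁻ t : ℝ, ENNReal.ofReal (‖φ ((1 / 2 + δ : ℝ) + t * I)‖ ^ 2) ≤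
        ENNReal.ofReal (K * δ ^ (-(1 / 4) : ℝ)))
    {U : ℝ} (hU : 1 ≤ U) (hUδ : 1 / U ≤ δ₀) {g : ℝ → ℝ} (hg : ContDiff ℝ ∞ g)
    (hc : HasCompactSupport g) (hg01 : ∀ u, 0 ≤ g u ∧ g u ≤ 1) (hsupp : ∀ u, g u ≠ 0 → u ≤ U + 1) :
    ‖∫ u : ℝ, h u * g u‖ ^ 2 ≤ K * U ^ (1 / 4 : ℝ) * (Real.exp (U + 5) * ∫ u, g u) := by
  have hU0 : 0 < U := by linarith
  have hU1 : 1 / U ≤ 1 := by rw [div_le_one hU0]; exact hU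
  have hU2 : 0 < 1 / U := by positivity
  have hgi : Integrable g := hg.continuous.integrable_of_hasCompactSupport hc
  have hψ : ContDiff ℝ ∞ fun u : ℝ ↦ (g u : ℂ) := Complex.ofRealCLM.contDiff.comp hg
  have hψc : HasCompactSupport fun u : ℝ ↦ (g u : ℂ) := hc.comp_left Complex.ofReal_zero
  have hpow : (1 / U) ^ (-(1 / 4) : ℝ) = U ^ (1 / 4 : ℝ) := by
    rw [one_div, Real.inv_rpow hU0.le, Real.rpow_neg hU0.le, inv_inv]
  have key := norm_integral_mul_testFunction_sq_le hφ hφb (σ₁ := 2) (σ := 1 / 2 + 1 / U)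
    (L := K * (1 / U) ^ (-(1 / 4) : ℝ)) (by simpa using (hLap (2 : ℝ) (by simp)).1)
    (fun t ↦ by simpa using (hLap ((2 : ℝ) + t * I) (by simp)).2) hψ hψc (by linarith)
    (by linarith) (by positivity) (hL2 _ hU2 hUδ)
  rw [hpow] at key
  refine key.trans (mul_le_mul_of_nonneg_left ?_ (by positivity))
  rw [← integral_const_mul]
  refine integral_mono_of_nonneg (ae_of_all _ fun u ↦ by positivity) (hgi.const_mul _)
    (ae_of_all _ fun u ↦ ?_)
  obtain ⟨h0, h1⟩ := hg01 u
  by_cases hu : g u = 0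
  · simp [hu]
  have hu' := hsupp u hu
  simp only
  rw [norm_mul, mul_pow, Complex.norm_real, Real.norm_of_nonneg h0, Complex.norm_exp, sq (g u)]
  refine mul_le_mul ?_ (mul_le_of_le_one_left h0 h1) (by positivity) (Real.exp_pos _).le
  rw [← Real.exp_nat_mul, Real.exp_le_exp]
  have h3 : ((((1 / 2 + 1 / U : ℝ) : ℂ) * (u : ℂ))).re = (1 / 2 + 1 / U) * u := by
    rw [← Complex.ofReal_mul, Complex.ofReal_re]
  rw [h3]
  have h4 : (1 / U) * U = 1 := by field_simp
  push_cast
  nlinarith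

lemma laplaceKernel_re_le {a : ℕ → ℂ} {A : ℕ → ℝ}
    (hA : ∀ n, ∑ k ∈ Finset.Icc 1 n, a k = A n) {α : ℝ} (hα : 0 < α) (β : ℂ) :
    ∃ c U₀ : ℝ, 0 < c ∧ 1 ≤ U₀ ∧ ∀ u, U₀ ≤ u → A ⌊Real.exp u⌋₊ ≤ 0 →
      (laplaceKernel a α β u).re ≤ -(c * (u ^ (1 / 4 : ℝ) * Real.exp (u / 2))) := by
  set G₁ := Real.Gamma (5 / 4) with hG₁
  have hG₁0 : 0 < G₁ := Real.Gamma_pos_of_pos (by norm_num)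
  set b := ‖β / Complex.Gamma (3 / 4 : ℝ)‖ with hb
  have hev : ∀ᶠ u : ℝ in atTop, 1 ≤ u ∧ b / (α / G₁ / 2) ≤ u ^ (1 / 2 : ℝ) :=
    (eventually_ge_atTop 1).and
      ((tendsto_rpow_atTop (by norm_num : (0 : ℝ) < 1 / 2)).eventually_ge_atTop _)
  obtain ⟨U₀, hU₀⟩ := eventually_atTop.1 hev
  refine ⟨α / G₁ / 2, U₀, by positivity, (hU₀ U₀ le_rfl).1, fun u hu hAu ↦ ?_⟩
  obtain ⟨h1, h2⟩ := hU₀ u hu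
  have hu0 : 0 < u := by linarith
  rw [div_le_iff₀ (by positivity)] at h2
  have hterm : (β / Complex.Gamma (3 / 4 : ℝ) *
      ((u : ℂ) ^ ((3 / 4 - 1 : ℝ) : ℂ) * cexp (u / 2))).re ≤
      b * (u ^ (-(1 / 4) : ℝ) * Real.exp (u / 2)) := by
    refine (Complex.re_le_norm _).trans_eq ?_
    rw [norm_mul, norm_mul, Complex.norm_cpow_eq_rpow_re_of_pos hu0, Complex.norm_exp]
    norm_num [hb]
  have hmain : (α : ℂ) / Complex.Gamma (5 / 4 : ℝ) *
      ((u : ℂ) ^ ((5 / 4 - 1 : ℝ) : ℂ) * cexp (u / 2)) =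
      ((α / G₁ * (u ^ (1 / 4 : ℝ) * Real.exp (u / 2)) : ℝ) : ℂ) := by
    rw [Complex.Gamma_ofReal]
    push_cast
    rw [Complex.ofReal_cpow hu0.le]
    norm_num [hG₁]
  have hsplit : u ^ (1 / 4 : ℝ) = u ^ (1 / 2 : ℝ) * u ^ (-(1 / 4) : ℝ) := by
    rw [← Real.rpow_add hu0]; norm_num
  rw [laplaceKernel, indicator_of_mem (show u ∈ Ioi (0 : ℝ) from hu0), hA, hmain, Complex.add_re,
    Complex.sub_re, ← Complex.ofReal_mul, Complex.ofReal_re, Complex.ofReal_re]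
  have h5 : u * A ⌊Real.exp u⌋₊ ≤ 0 := mul_nonpos_of_nonneg_of_nonpos hu0.le hAu
  have h6 := mul_le_mul_of_nonneg_right h2
    (show 0 ≤ u ^ (-(1 / 4) : ℝ) * Real.exp (u / 2) by positivity)
  have h7 : u ^ (1 / 2 : ℝ) * (α / G₁ / 2) * (u ^ (-(1 / 4) : ℝ) * Real.exp (u / 2)) =
      (α / G₁ / 2) * (u ^ (1 / 4 : ℝ) * Real.exp (u / 2)) := by rw [hsplit]; ring
  linarith

theorem exists_card_nonpos_le {a : ℕ → ℂ} {A : ℕ → ℝ} (ha : ∀ n, ‖a n‖ ≤ 1)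
    (hA : ∀ n, ∑ k ∈ Finset.Icc 1 n, a k = A n) {D : ℂ → ℂ}
    (hD : ∀ s : ℂ, 1 < s.re → D s = LSeries a s) (hdiff : DifferentiableOn ℂ D halfPlane)
    {α : ℝ} (hα : 0 < α) {β : ℂ}
    (hb : ∀ σ : ℝ, 1 / 2 < σ → ∃ B, ∀ s : ℂ, σ ≤ s.re → ‖regularPart D α β s‖ ≤ B)
    {δ₀ K : ℝ} (hδ₀ : 0 < δ₀) (hK : 0 < K)
    (hL2 : ∀ δ : ℝ, 0 < δ → δ ≤ δ₀ →
      ∫⁻ t : ℝ, ENNReal.ofReal (‖regularPart D α β ((1 / 2 + δ : ℝ) + t * I)‖ ^ 2) ≤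
        ENNReal.ofReal (K * δ ^ (-(1 / 4) : ℝ))) :
    ∃ M U₁ : ℝ, 0 < M ∧ 1 ≤ U₁ ∧ ∀ U, U₁ ≤ U → ∀ s : Finset ℕ,
      (∀ m ∈ s, Real.exp U ≤ m ∧ (m : ℝ) + 1 ≤ Real.exp (U + 1) ∧ A m ≤ 0) →
      (s.card : ℝ) ≤ M * (Real.exp U * U ^ (-(1 / 4) : ℝ)) := by
  obtain ⟨c, U₀, hc, hU₀, hker⟩ := laplaceKernel_re_le hA hα β
  set h := laplaceKernel a α β with hh
  have hLap : ∀ s : ℂ, 2 ≤ s.re → Integrable (fun u : ℝ ↦ cexp (-(s * u)) * h u) ∧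
      ∫ u : ℝ, cexp (-(s * u)) * h u = -regularPart D α β s :=
    fun s hs ↦ integral_laplaceKernel ha hD α β hs
  refine ⟨2 * Real.exp 1 * (K * Real.exp 5 / c ^ 2), max U₀ (1 / δ₀), by positivity,
    hU₀.trans (le_max_left _ _), fun U hU s hs ↦ ?_⟩
  have hUU₀ : U₀ ≤ U := (le_max_left _ _).trans hU
  have hU1 : 1 ≤ U := hU₀.trans hUU₀
  have hU0 : 0 < U := by linarith
  have hUδ : 1 / U ≤ δ₀ := by
    have := (le_max_right _ _).trans hU
    rw [div_le_iff₀ hδ₀] at this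
    rw [div_le_iff₀ hU0]; linarith
  obtain ⟨g, hg1, hg2, hg3, hg4, hg5⟩ := exists_bump_sum s fun m hm ↦ by
    have h1 := (Real.exp_pos U).trans_le (hs m hm).1
    exact_mod_cast h1
  have hsupp : ∀ u, g u ≠ 0 → U ≤ u ∧ u ≤ U + 1 ∧ A ⌊Real.exp u⌋₊ ≤ 0 := by
    intro u hu
    obtain ⟨h1, h2, h3⟩ := hs _ (hg4 u hu)
    exact ⟨Real.exp_le_exp.1 (h1.trans (Nat.floor_le (Real.exp_pos u).le)),
      Real.exp_le_exp.1 ((Nat.lt_floor_add_one (Real.exp u)).le.trans h2), h3⟩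
  have key := norm_integral_mul_sq_le_of_support (differentiableOn_regularPart hdiff α β) hb hLap
    hδ₀ hK hL2 hU1 hUδ hg1 hg2 hg3 fun u hu ↦ (hsupp u hu).2.1
  set P := ∫ u, g u with hP
  have hgi : Integrable g := hg1.continuous.integrable_of_hasCompactSupport hg2
  have hP0 : 0 ≤ P := integral_nonneg fun u ↦ (hg3 u).1
  have hhi : Integrable fun u ↦ h u * g u := by
    have h1 := (hLap 2 (by simp)).1
    have hcont : Continuous fun u : ℝ ↦ cexp (2 * u) * g u := by
      have := hg1.continuous
      fun_prop
    have hcs : HasCompactSupport fun u : ℝ ↦ cexp (2 * u) * g u :=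
      (hg2.comp_left Complex.ofReal_zero).mul_left
    obtain ⟨B, hB⟩ := hcs.exists_bound_of_continuous hcont
    refine (h1.mul_bdd hcont.aestronglyMeasurable (ae_of_all _ hB)).congr (ae_of_all _ fun u ↦ ?_)
    have h2 : cexp (-(2 * u)) * cexp (2 * u) = 1 := by
      rw [← Complex.exp_add, neg_add_cancel, Complex.exp_zero]
    simp only
    linear_combination (h u * g u) * h2
  set V := c * (U ^ (1 / 4 : ℝ) * Real.exp (U / 2)) with hV
  have hV0 : 0 < V := by positivity
  have hle : V * P ≤ ‖∫ u : ℝ, h u * g u‖ := by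
    have h1 : (∫ u : ℝ, h u * g u).re ≤ -(V * P) := by
      have h2 : (∫ u : ℝ, h u * g u).re = ∫ u : ℝ, (h u * g u).re :=
        (Complex.reCLM.integral_comp_comm hhi).symm
      rw [h2, hP, ← neg_mul, ← integral_const_mul]
      refine integral_mono (Complex.reCLM.integrable_comp hhi) (hgi.const_mul _) fun u ↦ ?_
      rw [Complex.re_mul_ofReal]
      by_cases hu : g u = 0
      · simp [hu]
      obtain ⟨h3, -, h4⟩ := hsupp u hu
      refine mul_le_mul_of_nonneg_right ((hker u (hUU₀.trans h3) h4).trans ?_) (hg3 u).1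
      rw [neg_le_neg_iff, hV]
      have hu0 : 0 < u := hU0.trans_le h3
      gcongr
    have h2 := (Complex.abs_re_le_norm (∫ u : ℝ, h u * g u))
    have h3 := neg_abs_le (∫ u : ℝ, h u * g u).re
    linarith
  have hsq : (V * P) ^ 2 ≤ K * U ^ (1 / 4 : ℝ) * (Real.exp (U + 5) * P) :=
    (pow_le_pow_left₀ (by positivity) hle 2).trans key
  have hP1 : P ≤ K * Real.exp 5 / c ^ 2 * U ^ (-(1 / 4) : ℝ) := by
    rcases hP0.eq_or_lt with h0 | h0
    · rw [← h0]; positivity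
    have h1 : V ^ 2 = c ^ 2 * (U ^ (1 / 4 : ℝ)) ^ 2 * Real.exp U := by
      rw [hV, mul_pow, mul_pow, ← Real.exp_nat_mul]
      push_cast
      ring_nf
    have h2 : U ^ (1 / 4 : ℝ) * U ^ (-(1 / 4) : ℝ) = 1 := by
      rw [← Real.rpow_add hU0]; norm_num
    have hq : 0 < U ^ (1 / 4 : ℝ) := by positivity
    rw [mul_pow, h1, Real.exp_add] at hsq
    have h3 : c ^ 2 * U ^ (1 / 4 : ℝ) * P ≤ K * Real.exp 5 := by
      refine le_of_mul_le_mul_right ?_ (show 0 < U ^ (1 / 4 : ℝ) * Real.exp U * P by positivity)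
      calc _ = c ^ 2 * (U ^ (1 / 4 : ℝ)) ^ 2 * Real.exp U * P ^ 2 := by ring
        _ ≤ _ := hsq
        _ = _ := by ring
    rw [div_mul_eq_mul_div, le_div_iff₀ (by positivity)]
    calc P * c ^ 2 = c ^ 2 * U ^ (1 / 4 : ℝ) * P * U ^ (-(1 / 4) : ℝ) := by
          linear_combination (-(P * c ^ 2)) * h2
      _ ≤ _ := mul_le_mul_of_nonneg_right h3 (by positivity)
  have hcard : (s.card : ℝ) * (1 / (2 * Real.exp (U + 1))) ≤ P := by
    refine le_trans ?_ hg5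
    rw [← nsmul_eq_mul]
    refine Finset.card_nsmul_le_sum _ _ _ fun m hm ↦ ?_
    have := (hs m hm).2.1
    gcongr
  rw [mul_one_div, div_le_iff₀ (by positivity), Real.exp_add] at hcard
  refine hcard.trans ((mul_le_mul_of_nonneg_right hP1 (by positivity)).trans_eq ?_)
  ring

end Oscillation

section Density

lemma card_filter_le_add_exp {p : ℕ → Prop} {M U₁ ε : ℝ} (hM : 0 < M) (hε : 0 < ε)
    (h : ∀ U, U₁ ≤ U → ∀ s : Finset ℕ,
      (∀ m ∈ s, Real.exp U ≤ m ∧ (m : ℝ) + 1 ≤ Real.exp (U + 1) ∧ p m) →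
      (s.card : ℝ) ≤ M * (Real.exp U * U ^ (-(1 / 4) : ℝ))) :
    ∃ C : ℝ, ∀ n : ℕ, (((Finset.Icc 1 n).filter p).card : ℝ) ≤ C + 2 * ε * n := by
  set B : ℝ → ℝ := fun y ↦ (((Finset.Icc 1 ⌊Real.exp y⌋₊).filter p).card : ℝ) with hB
  have hB1 : ∀ y, B y ≤ Real.exp y := by
    intro y
    refine le_trans ?_ (Nat.floor_le (Real.exp_pos y).le)
    simp only [hB]
    have := Finset.card_filter_le (Finset.Icc 1 ⌊Real.exp y⌋₊) p
    rw [Nat.card_Icc, Nat.add_sub_cancel] at this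
    exact_mod_cast this
  have hstep : ∀ y, U₁ ≤ y - 1 →
      B y ≤ B (y - 1) + 1 + M * (Real.exp (y - 1) * (y - 1) ^ (-(1 / 4) : ℝ)) := by
    intro y hy
    set N := ⌊Real.exp y⌋₊ with hN
    set N' := ⌊Real.exp (y - 1)⌋₊ with hN'
    have hsub : (Finset.Icc 1 N).filter p ⊆ ((Finset.Icc 1 N').filter p ∪ {N}) ∪
        (Finset.Ioo N' N).filter p := by
      intro m hm
      simp only [Finset.mem_union, Finset.mem_filter, Finset.mem_Icc, Finset.mem_Ioo,
        Finset.mem_singleton] at hm ⊢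
      rcases eq_or_ne m N with h1 | h1
      · exact Or.inl (Or.inr h1)
      · rcases le_or_gt m N' with h2 | h2
        · exact Or.inl (Or.inl ⟨⟨hm.1.1, h2⟩, hm.2⟩)
        · exact Or.inr ⟨⟨h2, lt_of_le_of_ne hm.1.2 h1⟩, hm.2⟩
    have hcard : ((Finset.Icc 1 N).filter p).card ≤ ((Finset.Icc 1 N').filter p).card + 1 +
        ((Finset.Ioo N' N).filter p).card := by
      refine (Finset.card_le_card hsub).trans ((Finset.card_union_le _ _).trans ?_)
      gcongr
      exact (Finset.card_union_le _ _).trans_eq (by simp)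
    have hlast := h (y - 1) hy ((Finset.Ioo N' N).filter p) fun m hm ↦ by
      rw [Finset.mem_filter, Finset.mem_Ioo] at hm
      refine ⟨(Nat.lt_of_floor_lt hm.1.1).le, ?_, hm.2⟩
      rw [sub_add_cancel]
      refine le_trans ?_ (Nat.floor_le (Real.exp_pos y).le)
      exact_mod_cast hm.1.2
    have : B y ≤ B (y - 1) + 1 + (((Finset.Ioo N' N).filter p).card : ℝ) := by
      simp only [hB]
      exact_mod_cast hcard
    linarith
  have hev : ∀ᶠ y : ℝ in atTop, U₁ ≤ y - 1 ∧ 1 ≤ ε / 2 * Real.exp y ∧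
      M * (y - 1) ^ (-(1 / 4) : ℝ) ≤ ε / 2 := by
    have ht : Tendsto (fun y : ℝ ↦ y - 1) atTop atTop := tendsto_atTop_add_const_right _ _ tendsto_id
    refine (ht.eventually_ge_atTop _).and (((Real.tendsto_exp_atTop.const_mul_atTop
      (half_pos hε)).eventually_ge_atTop _).and ?_)
    have := ((tendsto_rpow_neg_atTop (by norm_num : (0 : ℝ) < 1 / 4)).comp ht).const_mul M
    rw [mul_zero] at this
    exact this.eventually_le_const (half_pos hε)
  obtain ⟨y₀, hy₀⟩ := eventually_atTop.1 hev
  have hind : ∀ k : ℕ, ∀ y : ℝ, y ≤ y₀ + k → B y ≤ Real.exp y₀ + 2 * ε * Real.exp y := by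
    intro k
    induction k with
    | zero =>
      intro y hy
      have h1 := (hB1 y).trans (Real.exp_le_exp.2 (by simpa using hy))
      have h2 : 0 < 2 * ε * Real.exp y := by positivity
      linarith
    | succ k ih =>
      intro y hy
      rcases le_or_gt y y₀ with h1 | h1
      · have h1 := (hB1 y).trans (Real.exp_le_exp.2 h1)
        have h2 : 0 < 2 * ε * Real.exp y := by positivity
        linarith
      · obtain ⟨h2, h3, h4⟩ := hy₀ y h1.le
        have h5 := ih (y - 1) (by push_cast at hy; linarith)
        have h6 := hstep y h2
        have h7 : Real.exp (y - 1) ≤ Real.exp y / 2 := by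
          rw [Real.exp_sub]
          have := Real.add_one_le_exp 1
          gcongr
          linarith
        have h8 : M * (Real.exp (y - 1) * (y - 1) ^ (-(1 / 4) : ℝ)) ≤
            ε / 2 * Real.exp (y - 1) := by
          have := mul_le_mul_of_nonneg_right h4 (Real.exp_pos (y - 1)).le
          linarith
        have h9 := mul_le_mul_of_nonneg_left h7 hε.le
        have h10 : 0 < ε * Real.exp (y - 1) := by positivity
        have h11 : 0 < ε * Real.exp y := by positivity
        linarith
  refine ⟨Real.exp y₀, fun n ↦ ?_⟩
  rcases Nat.eq_zero_or_pos n with rfl | hn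
  · simpa using (Real.exp_pos y₀).le
  · have hn' : (0 : ℝ) < n := by exact_mod_cast hn
    obtain ⟨k, hk⟩ := exists_nat_ge (Real.log n - y₀)
    have := hind k (Real.log n) (by linarith)
    simpa only [hB, Real.exp_log hn', Nat.floor_natCast] using this

lemma tendsto_card_filter_div {p : ℕ → Prop} {M U₁ : ℝ} (hM : 0 < M)
    (h : ∀ U, U₁ ≤ U → ∀ s : Finset ℕ,
      (∀ m ∈ s, Real.exp U ≤ m ∧ (m : ℝ) + 1 ≤ Real.exp (U + 1) ∧ ¬ p m) →
      (s.card : ℝ) ≤ M * (Real.exp U * U ^ (-(1 / 4) : ℝ))) :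
    Tendsto (fun n : ℕ ↦ (((Finset.Icc 1 n).filter p).card : ℝ) / n) atTop (nhds 1) := by
  have hsplit : ∀ n : ℕ, (((Finset.Icc 1 n).filter p).card : ℝ) =
      n - ((Finset.Icc 1 n).filter fun m ↦ ¬ p m).card := by
    intro n
    have := Finset.card_filter_add_card_filter_not (s := Finset.Icc 1 n) p
    rw [Nat.card_Icc, Nat.add_sub_cancel] at this
    rw [eq_sub_iff_add_eq]
    exact_mod_cast this
  rw [Metric.tendsto_atTop]
  intro ε hε
  obtain ⟨C, hC⟩ := card_filter_le_add_exp hM (show 0 < ε / 4 by positivity) h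
  obtain ⟨k, hk⟩ := exists_nat_gt (C / (ε / 2))
  refine ⟨k + 1, fun n hn ↦ ?_⟩
  have hn0 : (0 : ℝ) < n := by exact_mod_cast (Nat.succ_pos k).trans_le hn
  have hkn : (k : ℝ) ≤ n := by exact_mod_cast (Nat.le_succ k).trans hn
  have h1 : C < ε / 2 * n := by
    rw [div_lt_iff₀ (by positivity)] at hk
    nlinarith
  have h2 : (((Finset.Icc 1 n).filter p).card : ℝ) / n - 1 =
      -(((Finset.Icc 1 n).filter fun m ↦ ¬ p m).card / n) := by
    rw [hsplit]; field_simp; ring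
  rw [Real.dist_eq, h2, abs_neg, abs_of_nonneg (by positivity), div_lt_iff₀ hn0]
  refine lt_of_le_of_lt (b := C + 2 * (ε / 4) * n) ?_ (by linarith)
  refine le_trans (le_of_eq ?_) (hC n)
  congr!

end Density

section TameTransform

open MeasureTheory

/-- `D` is holomorphic on the half plane, and after removal of the singularities at `1/2` the
derivative of `D s / s` is bounded on smaller half planes with square integral at most
`K * δ ^ (-1/4)` on the line `re s = 1/2 + δ`. -/
structure HasRegularPart (D : ℂ → ℂ) (α β : ℂ) : Prop where
  diff : DifferentiableOn ℂ D halfPlane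
  bounded : ∀ σ : ℝ, 1 / 2 < σ → ∃ B, ∀ s : ℂ, σ ≤ s.re → ‖regularPart D α β s‖ ≤ B
  lintegral_le : ∃ δ₀ K : ℝ, 0 < δ₀ ∧ 0 < K ∧ ∀ δ : ℝ, 0 < δ → δ ≤ δ₀ →
    ∫⁻ t : ℝ, ENNReal.ofReal (‖regularPart D α β ((1 / 2 + δ : ℝ) + t * I)‖ ^ 2) ≤
      ENNReal.ofReal (K * δ ^ (-(1 / 4) : ℝ))

lemma regularPart_zero (s : ℂ) : regularPart (fun _ ↦ 0) 0 0 s = 0 := by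
  simp [regularPart]

lemma hasRegularPart_zero : HasRegularPart (fun _ ↦ 0) 0 0 where
  diff := differentiableOn_const 0
  bounded σ _ := ⟨0, fun s _ ↦ by rw [regularPart_zero, norm_zero]⟩
  lintegral_le := ⟨1, 1, one_pos, one_pos, fun δ _ _ ↦ by simp [regularPart_zero]⟩

lemma regularPart_add_const_mul {D f : ℂ → ℂ} (hD : DifferentiableOn ℂ D halfPlane)
    (hf : DifferentiableOn ℂ f halfPlane) (α β α' β' c : ℂ) {s : ℂ} (hs : s ∈ halfPlane) :
    regularPart (fun z ↦ D z + c * f z) (α + c * α') (β + c * β') s =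
      regularPart D α β s + c * regularPart f α' β' s := by
  have hnhds := isOpen_halfPlane.mem_nhds hs
  have hs0 := ne_zero_of_mem_halfPlane hs
  have h1 : DifferentiableAt ℂ (fun z ↦ D z / z) s :=
    (hD.differentiableAt hnhds).div differentiableAt_id hs0
  have h2 : DifferentiableAt ℂ (fun z ↦ f z / z) s :=
    (hf.differentiableAt hnhds).div differentiableAt_id hs0
  have h3 : (fun z ↦ (D z + c * f z) / z) = fun z ↦ D z / z + c * (f z / z) := by
    ext z; ring
  simp only [regularPart]
  rw [h3, deriv_fun_add h1 (h2.const_mul c), deriv_const_mul _ h2]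
  ring

lemma HasRegularPart.add_const_mul {D f : ℂ → ℂ} {α β α' β' : ℂ} (hD : HasRegularPart D α β)
    (hf : HasRegularPart f α' β') (c : ℂ) :
    HasRegularPart (fun z ↦ D z + c * f z) (α + c * α') (β + c * β') := by
  have hsplit := fun s (hs : s ∈ halfPlane) ↦
    regularPart_add_const_mul hD.diff hf.diff α β α' β' c hs
  refine ⟨hD.diff.add (hf.diff.const_mul c), fun σ hσ ↦ ?_, ?_⟩
  · obtain ⟨B, hB⟩ := hD.bounded σ hσ
    obtain ⟨B', hB'⟩ := hf.bounded σ hσ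
    refine ⟨B + ‖c‖ * B', fun s hs ↦ ?_⟩
    rw [hsplit s (show 1 / 2 < s.re from hσ.trans_le hs)]
    refine (norm_add_le _ _).trans (add_le_add (hB s hs) ?_)
    rw [norm_mul]
    exact mul_le_mul_of_nonneg_left (hB' s hs) (norm_nonneg c)
  · obtain ⟨δ₁, K₁, hδ₁, hK₁, h₁⟩ := hD.lintegral_le
    obtain ⟨δ₂, K₂, hδ₂, hK₂, h₂⟩ := hf.lintegral_le
    refine ⟨min δ₁ δ₂, 2 * K₁ + 2 * ‖c‖ ^ 2 * K₂, lt_min hδ₁ hδ₂, by positivity,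
      fun δ hδ hδle ↦ ?_⟩
    have hσ : 1 / 2 < 1 / 2 + δ := by linarith
    have hpt : ∀ t : ℝ, ENNReal.ofReal (‖regularPart (fun z ↦ D z + c * f z) (α + c * α')
          (β + c * β') ((1 / 2 + δ : ℝ) + t * I)‖ ^ 2) ≤
        ENNReal.ofReal 2 *
          ENNReal.ofReal (‖regularPart D α β ((1 / 2 + δ : ℝ) + t * I)‖ ^ 2) +
        ENNReal.ofReal (2 * ‖c‖ ^ 2) *
          ENNReal.ofReal (‖regularPart f α' β' ((1 / 2 + δ : ℝ) + t * I)‖ ^ 2) := by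
      intro t
      rw [← ENNReal.ofReal_mul (by norm_num), ← ENNReal.ofReal_mul (by positivity),
        ← ENNReal.ofReal_add (by positivity) (by positivity),
        hsplit _ (ofReal_add_mul_I_mem_halfPlane hσ t)]
      refine ENNReal.ofReal_le_ofReal ?_
      set x := regularPart D α β ((1 / 2 + δ : ℝ) + t * I)
      set y := regularPart f α' β' ((1 / 2 + δ : ℝ) + t * I)
      have h3 : ‖x + c * y‖ ≤ ‖x‖ + ‖c‖ * ‖y‖ := (norm_add_le _ _).trans_eq (by rw [norm_mul])
      have h4 := pow_le_pow_left₀ (norm_nonneg _) h3 2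
      nlinarith [sq_nonneg (‖x‖ - ‖c‖ * ‖y‖)]
    have hmeas : Measurable fun t : ℝ ↦ ENNReal.ofReal 2 *
        ENNReal.ofReal (‖regularPart D α β ((1 / 2 + δ : ℝ) + t * I)‖ ^ 2) :=
      (ENNReal.measurable_ofReal.comp (((continuous_vertical
        (differentiableOn_regularPart hD.diff α β) hσ).norm.pow 2).measurable)).const_mul _
    refine (lintegral_mono hpt).trans ?_
    rw [lintegral_add_left hmeas, lintegral_const_mul' _ _ ENNReal.ofReal_ne_top,
      lintegral_const_mul' _ _ ENNReal.ofReal_ne_top]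
    refine (add_le_add (mul_le_mul_right (h₁ δ hδ (hδle.trans (min_le_left _ _))) _)
      (mul_le_mul_right (h₂ δ hδ (hδle.trans (min_le_right _ _))) _)).trans_eq ?_
    rw [← ENNReal.ofReal_mul (by norm_num), ← ENNReal.ofReal_mul (by positivity),
      ← ENNReal.ofReal_add (by positivity) (by positivity)]
    congr 1
    ring

lemma hasRegularPart_sum {ι : Type*} (s : Finset ι) (c α β : ι → ℂ) (f : ι → ℂ → ℂ)
    (h : ∀ i ∈ s, HasRegularPart (f i) (α i) (β i)) :
    HasRegularPart (fun z ↦ ∑ i ∈ s, c i * f i z) (∑ i ∈ s, c i * α i) (∑ i ∈ s, c i * β i) := by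
  induction s using Finset.induction_on with
  | empty => simpa using hasRegularPart_zero
  | insert i s hi ih =>
    simp only [Finset.sum_insert hi]
    have := (ih fun j hj ↦ h j (Finset.mem_insert_of_mem hj)).add_const_mul
      (h i (Finset.mem_insert_self i s)) (c i)
    simpa only [add_comm] using this

lemma exists_hasRegularPart {q : ℕ} [NeZero q]
    (hGRH : ∀ χ : DirichletCharacter ℂ q, GRH χ ∧ GRH (mulChiNeg4 χ)) {G : ℝ}
    (hG : Tendsto (fun δ : ℝ ↦
      δ ^ (1 / 4 : ℝ) * √‖threeSeries (1 : DirichletCharacter ℂ q) ((1 + 2 * δ : ℝ) : ℂ)‖)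
      (nhdsWithin 0 (Set.Ioi 0)) (nhds G))
    {χ : DirichletCharacter ℂ q} (h₁ : χ ≠ 1) (h₂ : mulChiNeg4 χ ≠ 1) :
    ∃ (f : ℂ → ℂ) (α β : ℂ), HasRegularPart f α β ∧
      (∀ s : ℂ, 1 < s.re → f s = LSeries (STwist χ) s) ∧ (χ ^ 2 ≠ 1 → α = 0) ∧
      (χ ^ 2 = 1 → 2 * α = ((G * ((1 - (χ (2 : ZMod q)).re / √2) ^ (-(1 / 2) : ℝ) *
        √((LVal χ (1 / 2) * LVal (mulChiNeg4 χ) (1 / 2)).re)) : ℝ) : ℂ)) := by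
  have hΛ := pairLBounds h₁ h₂ (hGRH χ).1 (hGRH χ).2
  obtain ⟨f, hf, hsq, hfL⟩ := exists_continuation hΛ
  obtain ⟨b, e₁, e₂, he₁, he₂, he, hb, heq⟩ :=
    exists_pow_four_eq (hGRH (χ ^ 2)).1 (hGRH (χ ^ 2)).2 hsq
  have hQ : IsQuarterRoot (pairL χ) b f e₁ e₂ := ⟨hΛ, hb, he₁, he₂, hf, heq⟩
  obtain ⟨α, β, r, C, hr, hC, hα, hlim, hloc⟩ := hQ.exists_local_expansion
  refine ⟨f, α, β, ⟨hf, fun σ hσ ↦ ?_, hQ.exists_lintegral_regularPart_le hr hC hloc⟩, hfL,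
    fun h ↦ hα (he h), fun h ↦ ?_⟩
  · obtain ⟨B, -, hB⟩ := exists_norm_regularPart_le hΛ hf hsq α β hσ
    exact ⟨B, hB⟩
  · exact eq_real_limit h hΛ hf hsq hfL (fun s hs ↦ hQ.ne_zero hs) hG hlim

end TameTransform

section SumsOfTwoSquares

lemma apply_eq_one_of_mulChiNeg4_eq_one {q : ℕ} {χ : DirichletCharacter ℂ q}
    (hχ : χ = 1 ∨ mulChiNeg4 χ = 1) {a : ℕ} (ha1 : a ≡ 1 [MOD Nat.gcd 4 q])
    (ha : Nat.Coprime a q) : χ (a : ZMod q) = 1 := by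
  rcases hχ with rfl | hχ
  · exact MulChar.one_apply ((ZMod.isUnit_iff_coprime a q).2 ha)
  · obtain ⟨k, hk4, hkq⟩ := Nat.chineseRemainder' ha1.symm
    have hkq' : (k : ZMod q) = (a : ZMod q) := (ZMod.natCast_eq_natCast_iff _ _ _).2 hkq
    have hk4' : (k : ZMod 4) = 1 := by
      simpa using (ZMod.natCast_eq_natCast_iff k 1 4).2 hk4
    have hcop4 : Nat.Coprime k 4 := by
      rw [Nat.Coprime, hk4.gcd_eq]; rfl
    have hcopq : Nat.Coprime k q := by
      rw [Nat.Coprime, hkq.gcd_eq]; exact ha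
    have h := mulChiNeg4_natCast χ k
    rw [hχ, hkq', hk4', map_one, mul_one,
      MulChar.one_apply ((ZMod.isUnit_iff_coprime k (4 * q)).2 (hcop4.mul_right hcopq))] at h
    exact h.symm

/-- The coefficient sequence of `Scount q a - Scount q b`. -/
def biasSeq (q a b n : ℕ) : ℂ :=
  if IsSum2Sq n then (if (a : ZMod q) = n then 1 else 0) - (if (b : ZMod q) = n then 1 else 0)
  else 0

lemma norm_biasSeq_le (q a b n : ℕ) : ‖biasSeq q a b n‖ ≤ 1 := by
  unfold biasSeq
  split_ifs <;> simp

lemma sum_biasSeq (q a b n : ℕ) :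
    ∑ k ∈ Finset.Icc 1 n, biasSeq q a b k =
      (((Scount q a (n : ℝ) : ℝ) - (Scount q b (n : ℝ) : ℝ) : ℝ) : ℂ) := by
  have h : ∀ c : ℕ, (Scount q c (n : ℝ) : ℂ) =
      ∑ k ∈ Finset.Icc 1 n, if IsSum2Sq k then (if (c : ZMod q) = k then (1 : ℂ) else 0) else 0 := by
    intro c
    simp only [Scount, Nat.floor_natCast, Finset.card_filter, Nat.cast_sum]
    refine Finset.sum_congr rfl fun k _ ↦ ?_
    by_cases h1 : IsSum2Sq k <;> by_cases h2 : (c : ZMod q) = k <;>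
      simp [h1, h2, eq_comm (a := (k : ZMod q))]
  push_cast
  rw [h a, h b, ← Finset.sum_sub_distrib]
  refine Finset.sum_congr rfl fun k _ ↦ ?_
  unfold biasSeq
  split_ifs <;> simp

/-- The coefficient of `χ` in the expansion of `biasSeq` into characters. -/
def biasCoeff {q : ℕ} (a b : ℕ) (χ : DirichletCharacter ℂ q) : ℂ :=
  (χ (a : ZMod q)⁻¹ - χ (b : ZMod q)⁻¹) / q.totient

lemma biasSeq_eq_sum {q a b : ℕ} [NeZero q] (ha : Nat.Coprime a q) (hb : Nat.Coprime b q) (n : ℕ) :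
    biasSeq q a b n = ∑ χ : DirichletCharacter ℂ q, biasCoeff a b χ * STwist χ n := by
  have hφ : (q.totient : ℂ) ≠ 0 := by
    exact_mod_cast (Nat.totient_pos.2 (Nat.pos_of_neZero q)).ne'
  have key : ∀ c : ℕ, Nat.Coprime c q → (if (c : ZMod q) = n then (1 : ℂ) else 0) =
      ∑ χ : DirichletCharacter ℂ q, χ (c : ZMod q)⁻¹ / q.totient * χ (n : ZMod q) := by
    intro c hc
    have h := DirichletCharacter.sum_char_inv_mul_char_eq ℂ ((ZMod.isUnit_iff_coprime c q).2 hc)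
      (n : ZMod q)
    simp only [div_mul_eq_mul_div]
    rw [← Finset.sum_div, h]
    split_ifs <;> simp [hφ]
  by_cases h : IsSum2Sq n
  · simp only [biasSeq, STwist, if_pos h]
    rw [key a ha, key b hb, ← Finset.sum_sub_distrib]
    refine Finset.sum_congr rfl fun χ _ ↦ ?_
    rw [biasCoeff]; ring
  · simp [biasSeq, STwist, h]

lemma LSeries_biasSeq {q a b : ℕ} [NeZero q] (ha : Nat.Coprime a q) (hb : Nat.Coprime b q) {s : ℂ}
    (hs : 1 < s.re) : LSeries (biasSeq q a b) s =
      ∑ χ : DirichletCharacter ℂ q, biasCoeff a b χ * LSeries (STwist χ) s := by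
  have h1 : biasSeq q a b = ∑ χ : DirichletCharacter ℂ q, biasCoeff a b χ • STwist χ := by
    ext n
    rw [biasSeq_eq_sum ha hb, Finset.sum_apply]
    rfl
  rw [h1, LSeries_sum fun χ _ ↦ (LSeriesSummable_STwist χ hs).smul _]
  exact Finset.sum_congr rfl fun χ _ ↦ LSeries_smul _ _ _

lemma biasCoeff_of_sq_eq_one {q : ℕ} {a b : ℕ} (ha : Nat.Coprime a q) (hb : Nat.Coprime b q)
    {χ : DirichletCharacter ℂ q} (hχ : χ ^ 2 = 1) :
    biasCoeff a b χ = ((((χ (a : ZMod q)).re - (χ (b : ZMod q)).re) / q.totient : ℝ) : ℂ) := by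
  have key : ∀ c : ℕ, Nat.Coprime c q → χ (c : ZMod q)⁻¹ = ((χ (c : ZMod q)).re : ℂ) := by
    intro c hc
    have hu := (ZMod.isUnit_iff_coprime c q).2 hc
    have h1 : χ (c : ZMod q) * χ (c : ZMod q) = 1 := by
      rw [← MulChar.mul_apply, ← sq, hχ, MulChar.one_apply hu]
    have h2 : χ (c : ZMod q)⁻¹ * χ (c : ZMod q) = 1 := by
      rw [← map_mul, ZMod.inv_mul_of_unit _ hu, map_one]
    have h3 : χ (c : ZMod q)⁻¹ = χ (c : ZMod q) := by
      linear_combination (χ (c : ZMod q)) * h2 - χ (c : ZMod q)⁻¹ * h1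
    rw [h3]
    exact (Complex.conj_eq_iff_re.1 (conj_apply_of_sq_eq_one hχ _)).symm
  rw [biasCoeff, key a ha, key b hb]
  push_cast
  ring

lemma biasCoeff_eq_zero {q : ℕ} {a b : ℕ} (ha1 : a ≡ 1 [MOD Nat.gcd 4 q])
    (hb1 : b ≡ 1 [MOD Nat.gcd 4 q]) (ha : Nat.Coprime a q) (hb : Nat.Coprime b q)
    {χ : DirichletCharacter ℂ q} (hχ : χ = 1 ∨ mulChiNeg4 χ = 1) : biasCoeff a b χ = 0 := by
  have key : ∀ c : ℕ, c ≡ 1 [MOD Nat.gcd 4 q] → Nat.Coprime c q → χ (c : ZMod q)⁻¹ = 1 := by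
    intro c hc1 hc
    have h2 : χ (c : ZMod q)⁻¹ * χ (c : ZMod q) = 1 := by
      rw [← map_mul, ZMod.inv_mul_of_unit _ ((ZMod.isUnit_iff_coprime c q).2 hc), map_one]
    rwa [apply_eq_one_of_mulChiNeg4_eq_one hχ hc1 hc, mul_one] at h2
  rw [biasCoeff, key a ha1 ha, key b hb1 hb, sub_self, zero_div]

lemma exists_hasRegularPart_bias
    (q : ℕ) (hq : 0 < q)
    (hGRH : ∀ χ : DirichletCharacter ℂ q, GRH χ ∧ GRH (mulChiNeg4 χ))
    (a b : ℕ)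
    (ha1 : a ≡ 1 [MOD Nat.gcd 4 q]) (hb1 : b ≡ 1 [MOD Nat.gcd 4 q])
    (ha : Nat.Coprime a q) (hb : Nat.Coprime b q)
    (hC : 0 < ∑ᶠ (χ : DirichletCharacter ℂ q) (_ : χ ^ 2 = 1),
      ((χ (a : ZMod q)).re - (χ (b : ZMod q)).re)
        * (1 - (χ (2 : ZMod q)).re / Real.sqrt 2) ^ (-(1 / 2) : ℝ)
        * Real.sqrt ((LVal χ (1 / 2) * LVal (mulChiNeg4 χ) (1 / 2)).re)) :
    ∃ (α₀ : ℝ) (β₀ : ℂ) (D : ℂ → ℂ), 0 < α₀ ∧ HasRegularPart D α₀ β₀ ∧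
      ∀ s : ℂ, 1 < s.re → D s = LSeries (biasSeq q a b) s := by
  have : NeZero q := ⟨hq.ne'⟩
  obtain ⟨G, hG0, hG⟩ := exists_tendsto_sqrt_threeSeries hq
  have hdata := fun (χ : DirichletCharacter ℂ q) (h : χ ≠ 1 ∧ mulChiNeg4 χ ≠ 1) ↦
    exists_hasRegularPart hGRH hG h.1 h.2
  choose! f α β hreg hfL hα₀ hα using hdata
  set good : Finset (DirichletCharacter ℂ q) :=
    Finset.univ.filter fun χ ↦ χ ≠ 1 ∧ mulChiNeg4 χ ≠ 1 with hgood
  have hmem : ∀ χ, χ ∈ good ↔ χ ≠ 1 ∧ mulChiNeg4 χ ≠ 1 := fun χ ↦ by simp [hgood]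
  have hnot : ∀ χ, χ ∉ good → biasCoeff a b χ = 0 := fun χ hχ ↦ by
    rw [hmem, not_and_or, not_not, not_not] at hχ
    exact biasCoeff_eq_zero ha1 hb1 ha hb hχ
  have hR := hasRegularPart_sum good (biasCoeff a b) α β f fun χ hχ ↦ hreg χ ((hmem χ).1 hχ)
  have hφ : (0 : ℝ) < q.totient := by exact_mod_cast Nat.totient_pos.2 hq
  set T : DirichletCharacter ℂ q → ℝ := fun χ ↦ ((χ (a : ZMod q)).re - (χ (b : ZMod q)).re)
    * (1 - (χ (2 : ZMod q)).re / Real.sqrt 2) ^ (-(1 / 2) : ℝ)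
    * Real.sqrt ((LVal χ (1 / 2) * LVal (mulChiNeg4 χ) (1 / 2)).re) with hT
  have hCsum : 0 < ∑ χ, if χ ^ 2 = 1 then T χ else 0 := by
    have : (∑ᶠ (χ : DirichletCharacter ℂ q) (_ : χ ^ 2 = 1), T χ) =
        ∑ χ, if χ ^ 2 = 1 then T χ else 0 := by
      rw [finsum_eq_sum_of_fintype]
      exact Finset.sum_congr rfl fun χ _ ↦ finsum_eq_if
    rw [← this]
    exact hC
  obtain ⟨α₀, hα₀pos, hαeq⟩ : ∃ α₀ : ℝ, 0 < α₀ ∧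
      ∑ χ ∈ good, biasCoeff a b χ * α χ = (α₀ : ℂ) := by
    refine ⟨G / (2 * q.totient) * ∑ χ, if χ ^ 2 = 1 then T χ else 0, by positivity, ?_⟩
    rw [Finset.mul_sum, Complex.ofReal_sum]
    have hz : ∀ χ ∈ Finset.univ, χ ∉ good →
        ((G / (2 * q.totient) * (if χ ^ 2 = 1 then T χ else 0) : ℝ) : ℂ) = 0 := by
      intro χ _ hχ
      split_ifs with h
      · have h1 := hnot χ hχ
        rw [biasCoeff_of_sq_eq_one ha hb h, Complex.ofReal_eq_zero, div_eq_zero_iff] at h1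
        simp [hT, h1.resolve_right hφ.ne']
      · simp
    rw [← Finset.sum_subset (Finset.subset_univ good) hz]
    refine Finset.sum_congr rfl fun χ hχ ↦ ?_
    have hg := (hmem χ).1 hχ
    split_ifs with h
    · have h1 := hα χ hg h
      have hφ' : (q.totient : ℂ) ≠ 0 := by exact_mod_cast hφ.ne'
      rw [biasCoeff_of_sq_eq_one ha hb h, show α χ = (2 * α χ) / 2 by ring, h1, hT]
      push_cast
      field_simp
    · rw [hα₀ χ hg h]; simp
  rw [hαeq] at hR
  refine ⟨α₀, _, _, hα₀pos, hR, fun s hs ↦ ?_⟩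
  rw [LSeries_biasSeq ha hb hs, ← Finset.sum_subset (Finset.subset_univ good) fun χ _ hχ ↦ by
    rw [hnot χ hχ, zero_mul]]
  exact Finset.sum_congr rfl fun χ hχ ↦ by rw [hfL χ ((hmem χ).1 hχ) s hs]

end SumsOfTwoSquares

/-- **Theorem 1.1 (Chebyshev's bias for sums of two squares).** -/
theorem sums_of_two_squares_bias
    (q : ℕ) (hq : 0 < q)
    (hGRH : ∀ χ : DirichletCharacter ℂ q, GRH χ ∧ GRH (mulChiNeg4 χ))
    (a b : ℕ)
    (ha1 : a ≡ 1 [MOD Nat.gcd 4 q]) (hb1 : b ≡ 1 [MOD Nat.gcd 4 q])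
    (ha : Nat.Coprime a q) (hb : Nat.Coprime b q)
    (hC : 0 < ∑ᶠ (χ : DirichletCharacter ℂ q) (_ : χ ^ 2 = 1),
      ((χ (a : ZMod q)).re - (χ (b : ZMod q)).re)
        * (1 - (χ (2 : ZMod q)).re / Real.sqrt 2) ^ (-(1 / 2) : ℝ)
        * Real.sqrt ((LVal χ (1 / 2) * LVal (mulChiNeg4 χ) (1 / 2)).re)) :
    Tendsto (fun n : ℕ =>
        (((Finset.Icc 1 n).filter
          (fun m : ℕ => Scount q b (m : ℝ) < Scount q a (m : ℝ))).card : ℝ) / n)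
      atTop (nhds 1) := by
  obtain ⟨α₀, β₀, D, hα₀, hR, hD⟩ :=
    exists_hasRegularPart_bias q hq hGRH a b ha1 hb1 ha hb hC
  obtain ⟨δ₀, K, hδ₀, hK, hL2⟩ := hR.lintegral_le
  obtain ⟨M, U₁, hM, -, hcard⟩ := exists_card_nonpos_le
    (A := fun n ↦ (Scount q a (n : ℝ) : ℝ) - (Scount q b (n : ℝ) : ℝ)) (norm_biasSeq_le q a b)
    (sum_biasSeq q a b) hD hR.diff hα₀ hR.bounded hδ₀ hK hL2
  have hlim := tendsto_card_filter_div
    (p := fun m : ℕ ↦ Scount q b (m : ℝ) < Scount q a (m : ℝ)) hM fun U hU s hs ↦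
      hcard U hU s fun m hm ↦ ⟨(hs m hm).1, (hs m hm).2.1,
        sub_nonpos.2 (Nat.cast_le.2 (not_lt.1 (hs m hm).2.2))⟩
  convert hlim

end
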